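/- arXiv:0901.3182 — 6 statements merged into one kernel-verified Lean document; each statement's English description precedes it below -/
import Mathlib

section
/- Let p be a prime and let G be a finite non-abelian p-group. Suppose that every automorphism of G of order p that fixes the Frattini subgroup Φ(G) elementwise is an inner automorphism. Then for every maximal subgroup M of G and every element g ∈ G with g ∉ M, every element z of the center Z(G) satisfying z^p = 1 can be written as z = a⁻¹·g⁻¹·a·g for some a ∈ Z(M), where Z(M) denotes the set of elements of M that commute with every element of M. -/
/-- A subgroup containing a maximal subgroup and an element outside it is everything. -/
lemma IsCoatom.mem_of_le_of_mem {G : Type*} [Group G] {M K : Subgroup G} (hM : IsCoatom M)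
    {g : G} (hg : g ∉ M) (hMK : M ≤ K) (hgK : g ∈ K) (x : G) : x ∈ K := by
  have hK : K = ⊤ := hM.2 K (lt_of_le_of_ne hMK fun h => hg (h ▸ hgK))
  exact hK ▸ Subgroup.mem_top x

/-- A homomorphism killing a maximal subgroup of a `p`-group may send an element outside it
to any element of exponent `p`. -/
lemma IsPGroup.exists_monoidHom_of_isCoatom {p : ℕ} (hp : p.Prime) {G : Type*} [Group G]
    [Finite G] (hpG : IsPGroup p G) {M : Subgroup G} (hM : IsCoatom M) {g : G} (hg : g ∉ M)
    {w : G} (hw : w ^ p = 1) :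
    ∃ f : G →* G, (∀ m ∈ M, f m = 1) ∧ f g = w ∧ ∀ x, f x ∈ Subgroup.zpowers w := by
  have : Fact p.Prime := ⟨hp⟩
  have : Group.IsNilpotent G := hpG.isNilpotent
  have : M.Normal := Subgroup.NormalizerCondition.normal_of_coatom M
    Group.normalizerCondition_of_isNilpotent hM
  have hgen : ∀ x : G ⧸ M, x ∈ Subgroup.zpowers (g : G ⧸ M) := by
    intro x
    obtain ⟨x, rfl⟩ := QuotientGroup.mk_surjective x
    refine hM.mem_of_le_of_mem (K := (Subgroup.zpowers (g : G ⧸ M)).comap (QuotientGroup.mk' M))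
      hg (fun m hm => ?_) (Subgroup.mem_zpowers (g : G ⧸ M)) x
    have h1 : (m : G ⧸ M) = 1 := (QuotientGroup.eq_one_iff m).2 hm
    simp [Subgroup.mem_comap, h1, one_mem]
  have hord : orderOf w ∣ orderOf (g : G ⧸ M) :=
    (orderOf_dvd_of_pow_eq_one hw).trans
      ((hpG.to_quotient M).dvd_orderOf fun h => hg ((QuotientGroup.eq_one_iff g).1 h))
  let f := (monoidHomOfForallMemZpowers hgen hord).comp (QuotientGroup.mk' M)
  have hfM : ∀ m ∈ M, f m = 1 := fun m hm => by
    simp [f, (QuotientGroup.eq_one_iff m).2 hm]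
  have hfg : f g = w := monoidHomOfForallMemZpowers_apply_gen hgen hord
  refine ⟨f, hfM, hfg, fun x => ?_⟩
  refine hM.mem_of_le_of_mem (K := (Subgroup.zpowers w).comap f) hg (fun m hm => ?_) ?_ x
  · simp [Subgroup.mem_comap, hfM m hm, one_mem]
  · simp [Subgroup.mem_comap, hfg]

/-- The central automorphism attached to a maximal subgroup `M`, an element `g ∉ M` and a central
element `w ∈ M` of order `p`: it fixes `M` elementwise and sends `g` to `g * w`. -/
lemma IsPGroup.exists_mulAut_of_isCoatom {p : ℕ} (hp : p.Prime) {G : Type*} [Group G]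
    [Finite G] (hpG : IsPGroup p G) {M : Subgroup G} (hM : IsCoatom M) {g : G} (hg : g ∉ M)
    {w : G} (hwM : w ∈ M) (hwZ : w ∈ Subgroup.center G) (hw : w ^ p = 1) (hw1 : w ≠ 1) :
    ∃ α : MulAut G, orderOf α = p ∧ (∀ m ∈ M, α m = m) ∧ α g = g * w := by
  obtain ⟨f, hfM, hfg, hfw⟩ := hpG.exists_monoidHom_of_isCoatom hp hM hg hw
  have hfZ : ∀ x, f x ∈ Subgroup.center G := fun x => Subgroup.zpowers_le.2 hwZ (hfw x)
  have hff : ∀ x, f (f x) = 1 := fun x => hfM _ (Subgroup.zpowers_le.2 hwM (hfw x))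
  have hfp : ∀ x, f x ^ p = 1 := fun x => by
    obtain ⟨k, hk⟩ := Subgroup.mem_zpowers_iff.1 (hfw x)
    rw [← hk, ← zpow_natCast, zpow_comm, zpow_natCast, hw, one_zpow]
  let α : MulAut G :=
    { toFun := fun x => x * f x
      invFun := fun x => x * (f x)⁻¹
      left_inv := fun x => by simp [hff]
      right_inv := fun x => by simp [hff]
      map_mul' := fun x y => by
        have h := Subgroup.mem_center_iff.1 (hfZ x) y
        simp only [map_mul, mul_assoc]
        rw [← mul_assoc y, h, mul_assoc] }
  have hα : ∀ x, α x = x * f x := fun _ => rfl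
  have hpow : ∀ (n : ℕ) x, (α ^ n) x = x * f x ^ n := by
    intro n
    induction n with
    | zero => simp
    | succ n ih =>
      intro x
      rw [pow_succ, MulAut.mul_apply, ih, hα, map_mul, hff, mul_one, mul_assoc, ← pow_succ']
  have : Fact p.Prime := ⟨hp⟩
  refine ⟨α, orderOf_eq_prime ?_ ?_, fun m hm => by rw [hα, hfM m hm, mul_one],
    by rw [hα, hfg]⟩
  · ext x
    rw [hpow, hfp, mul_one, MulAut.one_apply]
  · intro h
    have h1 := hα g
    rw [h, hfg, MulAut.one_apply] at h1
    exact hw1 (by simpa using h1)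

/-- A maximal subgroup of a non-abelian `p`-group that does not contain the center still contains a
central element of order `p`. -/
lemma IsPGroup.exists_central_mem_of_isCoatom {p : ℕ} (hp : p.Prime) {G : Type*} [Group G]
    [Finite G] (hpG : IsPGroup p G) (hna : ¬ ∀ a b : G, a * b = b * a) {M : Subgroup G}
    (hM : IsCoatom M) {z : G} (hzZ : z ∈ Subgroup.center G) (hz : z ∉ M) :
    ∃ w ∈ M, w ∈ Subgroup.center G ∧ w ^ p = 1 ∧ w ≠ 1 := by
  have : Fact p.Prime := ⟨hp⟩
  have : Nontrivial M := by
    rw [Subgroup.nontrivial_iff_ne_bot]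
    rintro rfl
    have hZ := hM.mem_of_le_of_mem hz bot_le hzZ
    exact hna fun a b => Subgroup.mem_center_iff.1 (hZ b) a
  have hpM := hpG.to_subgroup M
  have : Nontrivial (Subgroup.center M) := hpM.center_nontrivial
  have hdvd : p ∣ Nat.card (Subgroup.center M) :=
    (hpM.to_subgroup (Subgroup.center M)).card_eq_or_dvd.resolve_left
      Finite.one_lt_card.ne'
  obtain ⟨w, hw⟩ := exists_prime_orderOf_dvd_card' p hdvd
  refine ⟨w, w.1.2, ?_, ?_, ?_⟩
  · rw [Subgroup.mem_center_iff]
    intro x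
    refine (Subgroup.mem_centralizer_singleton_iff.1
      (hM.mem_of_le_of_mem (K := Subgroup.centralizer {((w : M) : G)}) hz (fun m hm => ?_) ?_ x))
    · rw [Subgroup.mem_centralizer_singleton_iff]
      exact congrArg Subtype.val (Subgroup.mem_center_iff.1 w.2 ⟨m, hm⟩)
    · rw [Subgroup.mem_centralizer_singleton_iff]
      exact (Subgroup.mem_center_iff.1 hzZ _).symm
  · have h := pow_orderOf_eq_one w
    rw [hw] at h
    simpa using congrArg (fun v : Subgroup.center M => ((v : M) : G)) h
  · intro h
    have h1 : w = 1 := Subtype.ext (Subtype.ext h)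
    rw [h1, orderOf_one] at hw
    exact hp.one_lt.ne hw

/-- If every order-`p` automorphism of a finite non-abelian `p`-group `G`
fixing `Φ(G)` elementwise is inner, then for every maximal subgroup `M`, every
`g ∉ M` and every `z ∈ Z(G)` with `z ^ p = 1`, we have `z = a⁻¹ * g⁻¹ * a * g`
for some `a ∈ Z(M)`. -/
theorem stmt0 {p : ℕ} (hp : p.Prime) (G : Type*) [Group G] [Finite G]
    (hpG : IsPGroup p G) (hna : ¬ ∀ a b : G, a * b = b * a)
    (hinner : ∀ α : MulAut G, orderOf α = p → (∀ x ∈ frattini G, α x = x) →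
      ∃ h : G, ∀ x : G, α x = h⁻¹ * x * h) :
    ∀ M : Subgroup G, IsCoatom M → ∀ g : G, g ∉ M →
      ∀ z ∈ Subgroup.center G, z ^ p = 1 →
        ∃ a : G, (a ∈ M ∧ ∀ m ∈ M, a * m = m * a) ∧ z = a⁻¹ * g⁻¹ * a * g := by
  intro M hM g hg z hzZ hz
  have key : ∀ x : G, x ∉ M → ∀ w ∈ M, w ∈ Subgroup.center G → w ^ p = 1 → w ≠ 1 →
      ∃ a : G, (∀ m ∈ M, m = a⁻¹ * m * a) ∧ x * w = a⁻¹ * x * a := by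
    intro x hx w hwM hwZ hw hw1
    obtain ⟨α, hα, hαM, hαx⟩ := hpG.exists_mulAut_of_isCoatom hp hM hx hwM hwZ hw hw1
    obtain ⟨a, ha⟩ := hinner α hα fun y hy => hαM y (frattini_le_coatom hM hy)
    exact ⟨a, fun m hm => (hαM m hm).symm.trans (ha m), hαx.symm.trans (ha x)⟩
  by_cases hz1 : z = 1
  · exact ⟨1, ⟨one_mem M, by simp⟩, by simp [hz1]⟩
  by_cases hzM : z ∈ M
  · obtain ⟨a, haM, hag⟩ := key g hg z⁻¹ (inv_mem hzM) (inv_mem hzZ) (by simp [hz]) (by simpa)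
    have hcomm : ∀ m ∈ M, a * m = m * a := fun m hm => by
      have h := haM m hm
      rw [mul_assoc, eq_inv_mul_iff_mul_eq] at h
      exact h
    have hza : z = a⁻¹ * g⁻¹ * a * g := by
      have h : z⁻¹ = g⁻¹ * (a⁻¹ * g * a) := by rw [← hag]; group
      rw [← inv_inv z, h]; group
    refine ⟨a, ⟨?_, hcomm⟩, hza⟩
    by_contra haM'
    have hga : g ∈ Subgroup.centralizer {a} := by
      refine hM.mem_of_le_of_mem haM' (fun m hm => ?_) ?_ g
      · exact Subgroup.mem_centralizer_singleton_iff.2 (hcomm m hm).symm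
      · exact Subgroup.mem_centralizer_singleton_iff.2 rfl
    have hga' := Subgroup.mem_centralizer_singleton_iff.1 hga
    refine hz1 (hza.trans ?_)
    rw [mul_assoc, ← hga']; group
  · obtain ⟨w, hwM, hwZ, hw, hw1⟩ := hpG.exists_central_mem_of_isCoatom hp hna hM hzZ hzM
    obtain ⟨a, -, ha⟩ := key z hzM w hwM hwZ hw hw1
    rw [Subgroup.mem_center_iff.1 hzZ a⁻¹, inv_mul_cancel_right] at ha
    exact absurd (mul_eq_left.1 ha) hw1
end

section
/- Let p be a prime and let G be a finite non-abelian p-group. Suppose that every automorphism of G of order p that fixes the Frattini subgroup Φ(G) elementwise is an inner automorphism. Then Ω₁(Z(G)) ≤ G', i.e., every element z of the center Z(G) with z^p = 1 lies in the derived (commutator) subgroup G' of G. -/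
open scoped commutatorElement

namespace Subgroup

variable {G : Type*} [Group G]

theorem isCoatom_of_index_prime {M : Subgroup G} (hM : M.index.Prime) : IsCoatom M := by
  refine ⟨fun h => hM.ne_one (index_eq_one.2 h), fun K hK => ?_⟩
  have hmul := relIndex_mul_index hK.le
  rcases (Nat.dvd_prime hM).1 ⟨_, hmul.symm⟩ with h | h
  · exact absurd (relIndex_eq_one.1 h) hK.not_ge
  · rw [h] at hmul
    exact index_eq_one.1 (Nat.eq_of_mul_eq_mul_left hM.pos (hmul.trans (mul_one _).symm))

end Subgroup

namespace IsPGroup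

variable {p : ℕ} {G : Type*} [Group G]

/-- In a finite non-abelian `p`-group, every element of order `p` lies in a normal subgroup
of index `p`. -/
theorem exists_normal_index_eq_of_orderOf_eq [Finite G] [Fact p.Prime] (hG : IsPGroup p G)
    (hna : ¬ ∀ a b : G, a * b = b * a) {z : G} (hz : orderOf z = p) :
    ∃ M : Subgroup G, M.Normal ∧ M.index = p ∧ z ∈ M := by
  have hp : p.Prime := Fact.out
  obtain ⟨n, hn⟩ := IsPGroup.iff_card.1 hG
  have hn2 : 1 < n := by
    by_contra! hle
    refine hna ?_
    interval_cases n
    · have := (Nat.card_eq_one_iff_unique.1 (hn.trans (pow_zero p))).1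
      exact fun a b => Subsingleton.elim _ _
    · have := isCyclic_of_prime_card (hn.trans (pow_one p))
      let := IsCyclic.commGroup (α := G)
      exact fun a b => mul_comm a b
  obtain ⟨m, rfl⟩ : ∃ m, n = m + 1 := ⟨n - 1, by omega⟩
  obtain ⟨M, hM, hzM⟩ := Sylow.exists_subgroup_card_pow_prime_le p (n := 1) (m := m)
    (hn ▸ pow_dvd_pow p m.le_succ) (Subgroup.zpowers z)
    (by rw [Nat.card_zpowers, hz, pow_one]) (by omega)
  have hidx : M.index = p := by
    have h := M.card_mul_index
    rw [hM, hn, pow_succ] at h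
    exact Nat.eq_of_mul_eq_mul_left (pow_pos hp.pos m) h
  refine ⟨M, Subgroup.normal_of_index_eq_minFac_card ?_, hidx, hzM (Subgroup.mem_zpowers z)⟩
  rw [hidx, hn, hp.pow_minFac m.succ_ne_zero]

end IsPGroup

namespace MonoidHom

variable {G : Type*} [Group G]

/-- The automorphism `x ↦ x * f x` attached to a homomorphism `f` into the center
that vanishes on its own range. -/
def centralAut (f : G →* Subgroup.center G) (hf : ∀ x, f (f x) = 1) : MulAut G where
  toFun x := x * f x
  invFun x := x * (f x)⁻¹
  left_inv x := by simp [hf]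
  right_inv x := by simp [hf]
  map_mul' x y := by
    have h : y * (f x : G) = f x * y := Subgroup.mem_center_iff.1 (f x).2 y
    simp only [map_mul, Subgroup.coe_mul]
    rw [mul_assoc, mul_assoc, ← mul_assoc y, h, mul_assoc]

theorem centralAut_apply (f : G →* Subgroup.center G) (hf : ∀ x, f (f x) = 1) (x : G) :
    f.centralAut hf x = x * f x := rfl

theorem centralAut_pow_apply (f : G →* Subgroup.center G) (hf : ∀ x, f (f x) = 1) (n : ℕ)
    (x : G) : (f.centralAut hf ^ n) x = x * (f x : G) ^ n := by
  induction n with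
  | zero => simp
  | succ n ih =>
    rw [pow_succ', MulAut.mul_apply, ih, centralAut_apply]
    simp [hf, pow_succ, mul_assoc]

end MonoidHom

/-- If every order-`p` automorphism of a finite non-abelian `p`-group `G`
fixing `Φ(G)` elementwise is inner, then every central element of order dividing `p`
lies in the derived subgroup, i.e. `Ω₁(Z(G)) ≤ G'`. -/
theorem stmt1 {p : ℕ} (hp : p.Prime) (G : Type*) [Group G] [Finite G]
    (hpG : IsPGroup p G) (hna : ¬ ∀ a b : G, a * b = b * a)
    (hinner : ∀ α : MulAut G, orderOf α = p → (∀ x ∈ frattini G, α x = x) →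
      ∃ h : G, ∀ x : G, α x = h⁻¹ * x * h) :
    ∀ z ∈ Subgroup.center G, z ^ p = 1 → z ∈ commutator G := by
  intro z hzc hzp
  have : Fact p.Prime := ⟨hp⟩
  by_cases hz1 : z = 1
  · exact hz1 ▸ one_mem _
  have hz : orderOf z = p := orderOf_eq_prime hzp hz1
  obtain ⟨M, hMn, hMi, hzM⟩ := hpG.exists_normal_index_eq_of_orderOf_eq hna hz
  let e : G ⧸ M ≃* Subgroup.zpowers z :=
    mulEquivOfPrimeCardEq (p := p) (M.index_eq_card.symm.trans hMi) (by rw [Nat.card_zpowers, hz])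
  let f : G →* Subgroup.center G :=
    (Subgroup.inclusion ((Subgroup.zpowers_le).2 hzc)).comp
      (e.toMonoidHom.comp (QuotientGroup.mk' M))
  have hfe (x : G) : (f x : G) = e (QuotientGroup.mk' M x) := rfl
  have hfM (x : G) (hx : x ∈ M) : f x = 1 := by
    refine Subtype.ext ?_
    have hq : QuotientGroup.mk' M x = 1 := (QuotientGroup.eq_one_iff x).2 hx
    simp [hfe, hq]
  have hff (x : G) : f (f x) = 1 :=
    hfM _ ((Subgroup.zpowers_le).2 hzM (e (QuotientGroup.mk' M x)).2)
  obtain ⟨g, hg⟩ : ∃ g, (f g : G) = z := by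
    obtain ⟨g, hg⟩ := QuotientGroup.mk'_surjective M (e.symm ⟨z, Subgroup.mem_zpowers z⟩)
    exact ⟨g, by rw [hfe, hg, e.apply_symm_apply]⟩
  have hpow : f.centralAut hff ^ p = 1 := by
    ext x
    have hx : (f x : G) ^ p = 1 := by
      rw [← orderOf_dvd_iff_pow_eq_one, hfe, ← hz, Subgroup.orderOf_coe, ← Nat.card_zpowers z]
      exact orderOf_dvd_natCard _
    rw [MonoidHom.centralAut_pow_apply, hx, mul_one, MulAut.one_apply]
  have hne : f.centralAut hff ≠ 1 := fun h => hz1 <| by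
    have hgg := DFunLike.congr_fun h g
    rwa [MonoidHom.centralAut_apply, hg, MulAut.one_apply, mul_eq_left] at hgg
  obtain ⟨h, hh⟩ := hinner (f.centralAut hff) (orderOf_eq_prime hpow hne) fun x hx => by
    have hxM := frattini_le_coatom (Subgroup.isCoatom_of_index_prime (hMi.symm ▸ hp)) hx
    rw [MonoidHom.centralAut_apply, hfM x hxM, Subgroup.coe_one, mul_one]
  have hgz := hh g
  rw [MonoidHom.centralAut_apply, hg] at hgz
  have hzcomm : z = ⁅g⁻¹, h⁻¹⁆ := by
    rw [commutatorElement_def, inv_inv, inv_inv, mul_assoc, mul_assoc, ← mul_assoc h⁻¹, ← hgz,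
      inv_mul_cancel_left]
  rw [hzcomm, commutator_def]
  exact Subgroup.commutator_mem_commutator (Subgroup.mem_top _) (Subgroup.mem_top _)
end

section
/- Let p be a prime and let G be a finite non-abelian p-group. Suppose that every automorphism of G of order p that fixes the Frattini subgroup Φ(G) elementwise is an inner automorphism, and let d = d(G) be the minimal number of generators of G. Then the group Ω₁(Z(G/Z(G))) = {x in the center of G/Z(G) : x^p = 1} is isomorphic (as a group) to the direct product of d copies of Ω₁(Z(G)) = {z ∈ Z(G) : z^p = 1}. (Note that the center of G/Z(G) is canonically isomorphic to Z₂(G)/Z(G), where Z₂(G) is the second term of the upper central series.) -/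
/-- `Ω₁` of the center: the subgroup of all central elements `x` with `x ^ p = 1`. -/
def Omega1Center (p : ℕ) (G : Type*) [Group G] : Subgroup G where
  carrier := {x | x ∈ Subgroup.center G ∧ x ^ p = 1}
  one_mem' := ⟨Subgroup.one_mem _, one_pow p⟩
  mul_mem' := by
    rintro a b ⟨ha, hap⟩ ⟨hb, hbp⟩
    refine ⟨Subgroup.mul_mem _ ha hb, ?_⟩
    have hc : Commute a b := (Subgroup.mem_center_iff.mp ha b).symm
    rw [hc.mul_pow, hap, hbp, one_mul]
  inv_mem' := by
    rintro a ⟨ha, hap⟩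
    exact ⟨Subgroup.inv_mem _ ha, by rw [inv_pow, hap, inv_one]⟩

open Subgroup

universe u

section ElementaryAbelian

/-- Subgroups of an elementary abelian `p`-group have complements. -/
theorem complementedLattice_subgroup_of_pow_eq_one {p : ℕ} (hp : p.Prime) {V : Type*}
    [CommGroup V] (hV : ∀ v : V, v ^ p = 1) : ComplementedLattice (Subgroup V) := by
  have : Fact p.Prime := ⟨hp⟩
  let : Module (ZMod p) (Additive V) := AddCommGroup.zmodModule (n := p) fun v => hV v.toMul
  let e : Subgroup V ≃o Submodule (ZMod p) (Additive V) :=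
    Subgroup.toAddSubgroup.trans (AddSubgroup.toZModSubmodule p)
  exact e.complementedLattice_iff.2 inferInstance

theorem frattini_eq_bot_of_pow_eq_one {p : ℕ} (hp : p.Prime) {V : Type*} [CommGroup V] [Finite V]
    (hV : ∀ v : V, v ^ p = 1) : frattini V = ⊥ := by
  have := complementedLattice_subgroup_of_pow_eq_one hp hV
  obtain ⟨K, hK⟩ := exists_isCompl (frattini V)
  have hKtop : K = ⊤ := frattini_nongenerating hK.symm.sup_eq_top
  simpa [hKtop] using hK.inf_eq_bot

/-- Homomorphisms into an elementary abelian `p`-group kill the Frattini subgroup. -/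
theorem map_eq_one_of_mem_frattini {p : ℕ} (hp : p.Prime) {G V : Type*} [Group G] [CommGroup V]
    [Finite V] (hV : ∀ v : V, v ^ p = 1) (f : G →* V) {x : G} (hx : x ∈ frattini G) :
    f x = 1 := by
  have h := frattini_le_comap_frattini_of_surjective f.rangeRestrict_surjective hx
  rw [frattini_eq_bot_of_pow_eq_one hp
    (fun v : f.range => Subtype.ext (by simpa using hV v.1))] at h
  exact congrArg Subtype.val (Subgroup.mem_bot.1 h)

end ElementaryAbelian

section PGroup

variable {p : ℕ} {G : Type*} [Group G] [Finite G]

theorem IsPGroup.normal_of_isCoatom (hp : p.Prime) (hG : IsPGroup p G) {M : Subgroup G}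
    (hM : IsCoatom M) : M.Normal := by
  have : Fact p.Prime := ⟨hp⟩
  have := hG.isNilpotent
  exact NormalizerCondition.normal_of_coatom M Group.normalizerCondition_of_isNilpotent hM

theorem IsPGroup.index_of_isCoatom (hp : p.Prime) (hG : IsPGroup p G) {M : Subgroup G}
    (hM : IsCoatom M) : M.index = p := by
  have : Fact p.Prime := ⟨hp⟩
  obtain ⟨k, hk⟩ := hG.index M
  obtain ⟨n, hn⟩ := IsPGroup.iff_card.1 (hG.to_subgroup M)
  have hcard : Nat.card G = p ^ n * p ^ k := by rw [← hn, ← hk, card_mul_index]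
  have hk0 : k ≠ 0 := by
    rintro rfl
    exact hM.1 (index_eq_one.1 (by simpa using hk))
  obtain ⟨K, hK, hMK⟩ := Sylow.exists_subgroup_card_pow_succ (p := p) (n := n) (G := G)
    (by rw [hcard, ← pow_add]; exact pow_dvd_pow p (by omega)) hn
  have hne : M ≠ K := by
    rintro rfl
    rw [hn] at hK
    exact absurd (Nat.pow_right_injective hp.two_le hK) (by omega)
  have htop : K = ⊤ := hM.2 K (lt_of_le_of_ne hMK hne)
  rw [htop, card_top, hcard, pow_succ] at hK
  rw [hk]
  exact Nat.eq_of_mul_eq_mul_left (pow_pos hp.pos n) hK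

theorem IsPGroup.pow_mem_frattini (hp : p.Prime) (hG : IsPGroup p G) (x : G) :
    x ^ p ∈ frattini G := by
  simp only [frattini, Order.radical, mem_iInf]
  intro M hM
  have := hG.normal_of_isCoatom hp hM
  exact hG.index_of_isCoatom hp hM ▸ M.pow_index_mem x

theorem IsPGroup.commutator_le_frattini (hp : p.Prime) (hG : IsPGroup p G) :
    commutator G ≤ frattini G := by
  simp only [frattini, Order.radical, le_iInf_iff]
  intro M hM
  have : Fact p.Prime := ⟨hp⟩
  have := hG.normal_of_isCoatom hp hM
  have : IsCyclic (G ⧸ M) := isCyclic_of_prime_card (hG.index_of_isCoatom hp hM)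
  exact Normal.quotient_commutative_iff_commutator_le.1 inferInstance

/-- If the quotient of `G` by its Frattini subgroup is a vector space over `ZMod p`, its dimension
is the rank of `G`. -/
theorem finrank_eq_rank_of_ker_eq_frattini [Fact p.Prime] {A : Type*} [AddCommGroup A]
    [Module (ZMod p) A] [Module.Finite (ZMod p) A] {π : G →* Multiplicative A}
    (hπ : Function.Surjective π) (hker : π.ker = frattini G) :
    Module.finrank (ZMod p) A = Group.rank G := by
  apply le_antisymm
  · obtain ⟨S, hS, hgen⟩ := Group.rank_spec G
    rw [← hS, ← Fintype.card_coe]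
    apply finrank_le_of_span_eq_top (v := fun x : S => (π x).toAdd)
    rw [eq_top_iff]
    rintro a -
    obtain ⟨x, hx⟩ := hπ (Multiplicative.ofAdd a)
    have hle : closure (S : Set G) ≤ (AddSubgroup.toSubgroup (Submodule.span (ZMod p)
        (Set.range fun x : S => (π x).toAdd)).toAddSubgroup).comap π := by
      rw [closure_le]
      intro y hy
      exact Submodule.subset_span ⟨⟨y, hy⟩, rfl⟩
    have := hle (hgen ▸ mem_top x)
    rw [mem_comap, hx] at this
    exact this
  · let b := Module.finBasis (ZMod p) A
    choose g hg using fun i => hπ (Multiplicative.ofAdd (b i))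
    have hmap : (closure (Set.range g)).map π = ⊤ := by
      let N := AddSubgroup.toZModSubmodule p
        (AddSubgroup.toSubgroup.symm ((closure (Set.range g)).map π))
      have hN : N = ⊤ := by
        rw [eq_top_iff, ← b.span_eq, Submodule.span_le]
        rintro _ ⟨i, rfl⟩
        exact ⟨g i, subset_closure ⟨i, rfl⟩, hg i⟩
      rw [eq_top_iff]
      intro a _
      have : a.toAdd ∈ N := hN ▸ Submodule.mem_top
      exact this
    have hgen : closure (Set.range g) = ⊤ := by
      apply frattini_nongenerating
      rw [← hker, ← comap_map_eq, hmap, comap_top]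
    classical
    refine (Group.rank_le (S := Finset.univ.image g) (by simpa using hgen)).trans ?_
    exact Finset.card_image_le.trans (by simp)

/-- The quotient of a finite `p`-group by its Frattini subgroup is a vector space over `ZMod p`. -/
theorem IsPGroup.exists_module_ker_eq_frattini {p : ℕ} (hp : p.Prime) {G : Type u} [Group G]
    [Finite G] (hG : IsPGroup p G) :
    ∃ (A : Type u) (_ : AddCommGroup A) (_ : Module (ZMod p) A) (π : G →* Multiplicative A),
      Function.Surjective π ∧ π.ker = frattini G := by
  let : CommGroup (G ⧸ frattini G) :=
    { (inferInstance : Group (G ⧸ frattini G)) with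
      mul_comm := (Normal.quotient_commutative_iff_commutator_le.2
        (hG.commutator_le_frattini hp)).is_comm.comm }
  refine ⟨Additive (G ⧸ frattini G), inferInstance, AddCommGroup.zmodModule (n := p) fun v => ?_,
    QuotientGroup.mk' (frattini G), QuotientGroup.mk'_surjective _, QuotientGroup.ker_mk' _⟩
  induction v using Additive.rec with | _ v
  induction v using QuotientGroup.induction_on with | _ x
  exact (QuotientGroup.eq_one_iff (x ^ p)).2 (hG.pow_mem_frattini hp x)

/-- Homomorphisms from a finite `p`-group to an elementary abelian `p`-group are determined by
arbitrary values on a minimal generating set. -/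
theorem IsPGroup.nonempty_monoidHom_mulEquiv (hp : p.Prime) (hG : IsPGroup p G) {V : Type*}
    [CommGroup V] [Finite V] (hV : ∀ v : V, v ^ p = 1) :
    Nonempty ((G →* V) ≃* (Fin (Group.rank G) → V)) := by
  have : Fact p.Prime := ⟨hp⟩
  let : Module (ZMod p) (Additive V) := AddCommGroup.zmodModule (n := p) fun v => hV v.toMul
  obtain ⟨A, _, _, π, hπ, hker⟩ := hG.exists_module_ker_eq_frattini hp
  have : Finite A := Finite.of_surjective (fun x => (π x).toAdd) hπ
  let b := Module.finBasisOfFinrankEq (ZMod p) A (finrank_eq_rank_of_ker_eq_frattini hπ hker)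
  choose g hg using fun i => hπ (Multiplicative.ofAdd (b i))
  let ev : (G →* V) →* (Fin (Group.rank G) → V) :=
    { toFun := fun f i => f (g i)
      map_one' := rfl
      map_mul' := fun _ _ => rfl }
  refine ⟨MulEquiv.ofBijective ev ⟨?_, fun v => ?_⟩⟩
  · rw [injective_iff_map_eq_one]
    intro f hf
    have hle : π.ker ≤ f.ker := fun x hx => map_eq_one_of_mem_frattini hp hV f (hker ▸ hx)
    let F : A →+ Additive V := MonoidHom.toAdditiveRight (π.liftOfSurjective hπ ⟨f, hle⟩)
    have hFπ : ∀ x, F (π x).toAdd = Additive.ofMul (f x) := fun x =>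
      congrArg Additive.ofMul (π.liftOfRightInverse_comp_apply _
        (Function.rightInverse_surjInv hπ) ⟨f, hle⟩ x)
    have hF : F.toZModLinearMap p = 0 := b.ext fun i => by
      have h : b i = (π (g i)).toAdd := by rw [hg]; rfl
      rw [h]
      exact (hFπ (g i)).trans (congrArg Additive.ofMul (congrFun hf i))
    ext x
    exact (hFπ x).symm.trans (DFunLike.congr_fun hF (π x).toAdd)
  · let L := b.constr (ZMod p) fun i => Additive.ofMul (v i)
    refine ⟨(AddMonoidHom.toMultiplicativeLeft L.toAddMonoidHom).comp π, ?_⟩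
    funext i
    change (L (π (g i)).toAdd).toMul = v i
    rw [hg]
    change (L (b i)).toMul = v i
    rw [Module.Basis.constr_basis]
    rfl

end PGroup

section CentralAutomorphisms

variable {p : ℕ} {G : Type*} [Group G]

instance Omega1Center.instCommGroup : CommGroup (Omega1Center p G) :=
  { (inferInstance : Group (Omega1Center p G)) with
    mul_comm := fun a b => Subtype.ext (mem_center_iff.1 b.2.1 a) }

theorem Omega1Center.pow_eq_one (v : Omega1Center p G) : v ^ p = 1 :=
  Subtype.ext v.2.2

theorem Omega1Center.commute (v : Omega1Center p G) (x : G) : Commute (v : G) x :=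
  (mem_center_iff.1 v.2.1 x).symm

/-- The automorphism `x ↦ x * f x` attached to a homomorphism `f` into `Ω₁(Z(G))` which vanishes on
its own image. -/
def centralAut (f : G →* Omega1Center p G) (hf : ∀ x, f (f x : G) = 1) : MulAut G where
  toFun x := x * f x
  invFun x := x * (f x)⁻¹
  left_inv x := by simp [hf]
  right_inv x := by simp [hf]
  map_mul' x y := by
    rw [map_mul, Subgroup.coe_mul, (Omega1Center.commute (f x) y).symm.mul_mul_mul_comm]

theorem centralAut_apply (f : G →* Omega1Center p G) (hf : ∀ x, f (f x : G) = 1) (x : G) :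
    centralAut f hf x = x * f x := rfl

theorem centralAut_pow_apply (f : G →* Omega1Center p G) (hf : ∀ x, f (f x : G) = 1) (n : ℕ)
    (x : G) : (centralAut f hf ^ n) x = x * (f x : G) ^ n := by
  induction n with
  | zero => simp
  | succ n ih =>
    rw [pow_succ', MulAut.mul_apply, ih, centralAut_apply, map_mul, map_pow, hf, one_pow, mul_one,
      mul_assoc, pow_succ]

theorem orderOf_centralAut (hp : p.Prime) (f : G →* Omega1Center p G)
    (hf : ∀ x, f (f x : G) = 1) (hne : f ≠ 1) : orderOf (centralAut f hf) = p := by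
  have : Fact p.Prime := ⟨hp⟩
  apply orderOf_eq_prime
  · ext x
    rw [centralAut_pow_apply, (f x).2.2, mul_one, MulAut.one_apply]
  · intro h
    apply hne
    ext x
    have := DFunLike.congr_fun h x
    rw [centralAut_apply, MulAut.one_apply] at this
    simpa using this

theorem exists_mul_eq_conj_of_inner [Finite G] (hp : p.Prime)
    (hinner : ∀ α : MulAut G, orderOf α = p → (∀ x ∈ frattini G, α x = x) →
      ∃ h : G, ∀ x : G, α x = h⁻¹ * x * h)
    (f : G →* Omega1Center p G) (hf : ∀ x, f (f x : G) = 1) :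
    ∃ h : G, ∀ x : G, x * f x = h⁻¹ * x * h := by
  by_cases hne : f = 1
  · exact ⟨1, fun x => by simp [hne]⟩
  · refine hinner (centralAut f hf) (orderOf_centralAut hp f hf hne) fun x hx => ?_
    rw [centralAut_apply, map_eq_one_of_mem_frattini hp Omega1Center.pow_eq_one f hx]
    simp

/-- In a nonabelian finite `p`-group, a maximal subgroup not containing the center contains a
nontrivial element of `Ω₁(Z(G))`. -/
theorem exists_mem_omega1Center_of_isCoatom [Finite G] (hp : p.Prime) (hG : IsPGroup p G)
    (hna : ¬ ∀ a b : G, a * b = b * a) {M : Subgroup G} (hM : IsCoatom M) {z : G}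
    (hz : z ∈ center G) (hzM : z ∉ M) : ∃ y : Omega1Center p G, y ≠ 1 ∧ (y : G) ∈ M := by
  have : Fact p.Prime := ⟨hp⟩
  have : Nontrivial M := by
    rw [nontrivial_iff_ne_bot]
    rintro rfl
    apply hna
    have hcard : Nat.card G = p := by rw [← index_bot, hG.index_of_isCoatom hp hM]
    have : IsCyclic G := isCyclic_of_prime_card hcard
    exact fun a b => mul_comm' a b
  have := (hG.to_subgroup M).center_nontrivial
  obtain ⟨y, hy⟩ := exists_prime_orderOf_dvd_card' (G := center M) p
    ((((hG.to_subgroup M).to_subgroup (center M)).card_eq_or_dvd).resolve_left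
      Finite.one_lt_card.ne')
  have hyp : y ^ p = 1 := by rw [← hy, pow_orderOf_eq_one]
  have hle : M ≤ centralizer {((y : M) : G)} := fun m hm => by
    rw [mem_centralizer_singleton_iff]
    exact congrArg Subtype.val (mem_center_iff.1 y.2 ⟨m, hm⟩)
  have hzc : z ∈ centralizer {((y : M) : G)} := by
    rw [mem_centralizer_singleton_iff]
    exact (mem_center_iff.1 hz _).symm
  have htop := hM.2 _ (lt_of_le_of_ne hle fun h => hzM (h ▸ hzc))
  refine ⟨⟨(y : M), mem_center_iff.2 fun x => ?_, ?_⟩, fun h => ?_, (y : M).2⟩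
  · exact mem_centralizer_singleton_iff.1 (htop ▸ mem_top x)
  · exact congrArg (fun w : center M => ((w : M) : G)) hyp
  · have hyG : ((y : M) : G) = 1 := congrArg Subtype.val h
    have hy1 : y = 1 := Subtype.ext (Subtype.ext hyG)
    rw [hy1, orderOf_one] at hy
    exact hp.one_lt.ne hy

theorem omega1Center_le_frattini_of_inner [Finite G] (hp : p.Prime) (hG : IsPGroup p G)
    (hna : ¬ ∀ a b : G, a * b = b * a)
    (hinner : ∀ α : MulAut G, orderOf α = p → (∀ x ∈ frattini G, α x = x) →
      ∃ h : G, ∀ x : G, α x = h⁻¹ * x * h) :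
    Omega1Center p G ≤ frattini G := by
  have : Fact p.Prime := ⟨hp⟩
  simp only [frattini, Order.radical, le_iInf_iff]
  intro M hM z hz
  by_contra hzM
  obtain ⟨y, hy1, hyM⟩ := exists_mem_omega1Center_of_isCoatom hp hG hna hM hz.1 hzM
  have := hG.normal_of_isCoatom hp hM
  have hcard : Nat.card (G ⧸ M) = p := hG.index_of_isCoatom hp hM
  have hz1 : (z : G ⧸ M) ≠ 1 := by rwa [ne_eq, QuotientGroup.eq_one_iff]
  have hgen : ∀ x : G ⧸ M, x ∈ zpowers (z : G ⧸ M) := fun _ => mem_zpowers_of_prime_card hcard hz1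
  have hord : orderOf y ∣ orderOf (z : G ⧸ M) := by
    rw [orderOf_eq_card_of_forall_mem_zpowers hgen, hcard]
    exact orderOf_dvd_of_pow_eq_one (Omega1Center.pow_eq_one y)
  let f : G →* Omega1Center p G :=
    (monoidHomOfForallMemZpowers hgen hord).comp (QuotientGroup.mk' M)
  have hfz : f z = y := monoidHomOfForallMemZpowers_apply_gen hgen hord
  have hfM : ∀ x ∈ M, f x = 1 := fun x hx => by
    change monoidHomOfForallMemZpowers hgen hord (x : G ⧸ M) = 1
    rw [(QuotientGroup.eq_one_iff x).2 hx, map_one]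
  have hf : ∀ x, f (f x : G) = 1 := fun x => by
    obtain ⟨n, hn⟩ := mem_zpowers_iff.1 (hgen (x : G ⧸ M))
    have hfx : f x = y ^ n := by
      change monoidHomOfForallMemZpowers hgen hord (x : G ⧸ M) = y ^ n
      rw [← hn, map_zpow, monoidHomOfForallMemZpowers_apply_gen]
    apply hfM
    rw [hfx]
    exact M.zpow_mem hyM n
  obtain ⟨h, hh⟩ := exists_mul_eq_conj_of_inner hp hinner f hf
  have hzh := hh z
  rw [hfz, mul_assoc, ← mem_center_iff.1 hz.1 h, inv_mul_cancel_left] at hzh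
  exact hy1 (Subtype.ext (by simpa using hzh))

theorem mem_comap_omega1Center_iff {h : G} :
    h ∈ (Omega1Center p (G ⧸ center G)).comap (QuotientGroup.mk' (center G)) ↔
      (∀ x, x⁻¹ * h⁻¹ * x * h ∈ center G) ∧ h ^ p ∈ center G := by
  have hcomm : ∀ x : G, (x : G ⧸ center G) * h = h * x ↔ x⁻¹ * h⁻¹ * x * h ∈ center G := by
    intro x
    rw [← QuotientGroup.mk_mul, ← QuotientGroup.mk_mul, eq_comm, QuotientGroup.eq]
    simp only [mul_inv_rev, mul_assoc]
  constructor
  · rintro ⟨h1, h2⟩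
    exact ⟨fun x => (hcomm x).1 (mem_center_iff.1 h1 x), (QuotientGroup.eq_one_iff _).1 h2⟩
  · rintro ⟨h1, h2⟩
    refine ⟨mem_center_iff.2 fun x => ?_, (QuotientGroup.eq_one_iff (h ^ p)).2 h2⟩
    induction x using QuotientGroup.induction_on with | _ x
    exact (hcomm x).2 (h1 x)

theorem conj_pow_eq_mul_pow {x h c : G} (hc : c ∈ center G) (hx : h⁻¹ * x * h = x * c) (n : ℕ) :
    (h ^ n)⁻¹ * x * h ^ n = x * c ^ n := by
  induction n with
  | zero => simp
  | succ n ih =>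
    calc (h ^ (n + 1))⁻¹ * x * h ^ (n + 1) = h⁻¹ * ((h ^ n)⁻¹ * x * h ^ n) * h := by
          rw [pow_succ]; group
      _ = h⁻¹ * x * (c ^ n * h) := by rw [ih]; group
      _ = h⁻¹ * x * h * c ^ n := by
          rw [← mem_center_iff.1 ((center G).pow_mem hc n) h]; group
      _ = x * c ^ (n + 1) := by rw [hx, pow_succ', mul_assoc]

/-- The homomorphism sending `h` to `x ↦ [x, h]`, for `h` in the preimage of `Ω₁(Z(G/Z(G)))`. -/
def commutatorHom (p : ℕ) (G : Type*) [Group G] :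
    (Omega1Center p (G ⧸ center G)).comap (QuotientGroup.mk' (center G)) →*
      (G →* Omega1Center p G) where
  toFun h :=
    { toFun := fun x => ⟨x⁻¹ * (h : G)⁻¹ * x * h, (mem_comap_omega1Center_iff.1 h.2).1 x, by
        have h1 := conj_pow_eq_mul_pow (x := x) (h := h)
          ((mem_comap_omega1Center_iff.1 h.2).1 x) (by group) p
        rw [mul_assoc, mem_center_iff.1 (mem_comap_omega1Center_iff.1 h.2).2 x,
          inv_mul_cancel_left] at h1
        simpa using h1⟩
      map_one' := Subtype.ext (by simp)
      map_mul' := fun x y => Subtype.ext (by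
        have hc := mem_center_iff.1 ((mem_comap_omega1Center_iff.1 h.2).1 x) y
        change (x * y)⁻¹ * (h : G)⁻¹ * (x * y) * h =
          (x⁻¹ * (h : G)⁻¹ * x * h) * (y⁻¹ * (h : G)⁻¹ * y * h)
        calc (x * y)⁻¹ * (h : G)⁻¹ * (x * y) * h =
              y⁻¹ * ((x⁻¹ * (h : G)⁻¹ * x * h) * y) * (y⁻¹ * (h : G)⁻¹ * y * h) := by group
          _ = _ := by rw [← hc, inv_mul_cancel_left]) }
  map_one' := by
    ext x
    simp
  map_mul' h k := by
    ext x
    have hc := mem_center_iff.1 ((mem_comap_omega1Center_iff.1 h.2).1 x) k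
    change x⁻¹ * ((h : G) * k)⁻¹ * x * (h * k) =
      (x⁻¹ * (h : G)⁻¹ * x * h) * (x⁻¹ * (k : G)⁻¹ * x * k)
    calc x⁻¹ * ((h : G) * k)⁻¹ * x * (h * k) =
          x⁻¹ * (k : G)⁻¹ * x * ((x⁻¹ * (h : G)⁻¹ * x * h) * k) := by group
      _ = x⁻¹ * (k : G)⁻¹ * x * k * (x⁻¹ * (h : G)⁻¹ * x * h) := by rw [← hc]; group
      _ = _ := mem_center_iff.1 ((mem_comap_omega1Center_iff.1 h.2).1 x) _

theorem coe_commutatorHom_apply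
    (h : (Omega1Center p (G ⧸ center G)).comap (QuotientGroup.mk' (center G))) (x : G) :
    (commutatorHom p G h x : G) = x⁻¹ * (h : G)⁻¹ * x * h := rfl

theorem commutatorHom_eq_one_iff
    (h : (Omega1Center p (G ⧸ center G)).comap (QuotientGroup.mk' (center G))) :
    commutatorHom p G h = 1 ↔ (h : G) ∈ center G := by
  simp only [MonoidHom.ext_iff, mem_center_iff, Subtype.ext_iff, coe_commutatorHom_apply]
  refine forall_congr' fun x => ?_
  change x⁻¹ * (h : G)⁻¹ * x * h = 1 ↔ _
  rw [mul_assoc, ← mul_inv_rev, inv_mul_eq_one, eq_comm]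

theorem commutatorHom_surjective_of_inner [Finite G] (hp : p.Prime) (hG : IsPGroup p G)
    (hna : ¬ ∀ a b : G, a * b = b * a)
    (hinner : ∀ α : MulAut G, orderOf α = p → (∀ x ∈ frattini G, α x = x) →
      ∃ h : G, ∀ x : G, α x = h⁻¹ * x * h) :
    Function.Surjective (commutatorHom p G) := by
  intro f
  have hf : ∀ x, f (f x : G) = 1 := fun x =>
    map_eq_one_of_mem_frattini hp Omega1Center.pow_eq_one f
      (omega1Center_le_frattini_of_inner hp hG hna hinner (f x).2)
  obtain ⟨h, hh⟩ := exists_mul_eq_conj_of_inner hp hinner f hf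
  have hfx : ∀ x, x⁻¹ * h⁻¹ * x * h = f x := fun x => by
    rw [mul_assoc, mul_assoc, ← mul_assoc h⁻¹, ← hh x, inv_mul_cancel_left]
  refine ⟨⟨h, mem_comap_omega1Center_iff.2 ⟨fun x => hfx x ▸ (f x).2.1, ?_⟩⟩, ?_⟩
  · rw [mem_center_iff]
    intro x
    have h1 := conj_pow_eq_mul_pow (f x).2.1 (hh x).symm p
    rw [(f x).2.2, mul_one, mul_assoc, inv_mul_eq_iff_eq_mul] at h1
    exact h1
  · ext x
    exact hfx x

end CentralAutomorphisms

/-- If every order-`p` automorphism of a finite non-abelian `p`-group `G`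
fixing `Φ(G)` elementwise is inner, then `Ω₁(Z(G/Z(G)))` is isomorphic to the direct
product of `d(G)` copies of `Ω₁(Z(G))`. -/
theorem stmt2 {p : ℕ} (hp : p.Prime) (G : Type*) [Group G] [Finite G]
    (hpG : IsPGroup p G) (hna : ¬ ∀ a b : G, a * b = b * a)
    (hinner : ∀ α : MulAut G, orderOf α = p → (∀ x ∈ frattini G, α x = x) →
      ∃ h : G, ∀ x : G, α x = h⁻¹ * x * h) :
    Nonempty ((Omega1Center p (G ⧸ Subgroup.center G)) ≃*
      (Fin (Group.rank G) → Omega1Center p G)) := by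
  have hV : ∀ v : Omega1Center p G, v ^ p = 1 := Omega1Center.pow_eq_one
  obtain ⟨e⟩ := hpG.nonempty_monoidHom_mulEquiv hp hV
  let q := (QuotientGroup.mk' (center G)).subgroupComap (Omega1Center p (G ⧸ center G))
  have hq : Function.Surjective q :=
    MonoidHom.subgroupComap_surjective_of_surjective _ _ (QuotientGroup.mk'_surjective _)
  have hker : q.ker = (commutatorHom p G).ker := by
    ext h
    rw [MonoidHom.mem_ker, MonoidHom.mem_ker, commutatorHom_eq_one_iff, Subtype.ext_iff]
    exact QuotientGroup.eq_one_iff (h : G)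
  exact ⟨(QuotientGroup.quotientKerEquivOfSurjective q hq).symm.trans
    ((QuotientGroup.quotientMulEquivOfEq hker).trans
      ((QuotientGroup.quotientKerEquivOfSurjective _
        (commutatorHom_surjective_of_inner hp hpG hna hinner)).trans e))⟩
end

section
/- Let p be a prime and let G be a finite non-abelian p-group of coclass 1, i.e., |G| = p^n with n > 2 and G has nilpotency class n − 1. Then G has a noninner automorphism of order p that fixes the Frattini subgroup Φ(G) elementwise. -/
open Subgroup
open scoped commutatorElement

lemma IsPGroup.mul_card_le_card_of_lt {p : ℕ} [Fact p.Prime] {G : Type*} [Group G] [Finite G]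
    (hG : IsPGroup p G) {H K : Subgroup G} (h : H < K) : p * Nat.card H ≤ Nat.card K := by
  obtain ⟨k, hk⟩ := (hG.to_subgroup K).index (H.subgroupOf K)
  have hcard := card_mul_index (H.subgroupOf K)
  rw [hk, Nat.card_congr (subgroupOfEquivOfLe h.le).toEquiv] at hcard
  have hk0 : k ≠ 0 := by
    rintro rfl
    rw [pow_zero, index_eq_one, subgroupOf_eq_top] at hk
    exact h.not_ge hk
  calc p * Nat.card H ≤ p ^ k * Nat.card H :=
        Nat.mul_le_mul_right _ (Nat.le_self_pow hk0 p)
    _ = Nat.card K := by rw [mul_comm, hcard]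

lemma IsPGroup.isCoatom_of_card_le_mul {p : ℕ} [Fact p.Prime] {G : Type*} [Group G] [Finite G]
    (hG : IsPGroup p G) {H : Subgroup G} (hH : H ≠ ⊤) (h : Nat.card G ≤ p * Nat.card H) :
    IsCoatom H := by
  refine ⟨hH, fun K hK ↦ eq_top_of_le_card K ?_⟩
  exact h.trans (hG.mul_card_le_card_of_lt hK)

/-- A proper term of the upper central series of positive index has index at least `p ^ 2`. -/
lemma IsPGroup.sq_mul_card_upperCentralSeries_le {p : ℕ} [Fact p.Prime] {G : Type*} [Group G]
    [Finite G] (hG : IsPGroup p G) {i : ℕ} (hi : Subgroup.upperCentralSeries G (i + 1) ≠ ⊤) :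
    p ^ 2 * Nat.card (Subgroup.upperCentralSeries G (i + 1)) ≤ Nat.card G := by
  obtain ⟨g, hg⟩ : ∃ g, g ∉ Subgroup.upperCentralSeries G (i + 1) := by
    by_contra! h
    exact hi (eq_top_iff' _ |>.mpr h)
  let q := QuotientGroup.mk' (Subgroup.upperCentralSeries G i)
  let K : Subgroup G := (centralizer {q g}).comap q
  have mem_K (h : G) : h ∈ K ↔ ⁅h, g⁆ ∈ Subgroup.upperCentralSeries G i := by
    rw [mem_comap, mem_centralizer_singleton_iff, ← commutatorElement_eq_one_iff_mul_comm,
      ← map_commutatorElement, QuotientGroup.mk'_apply, QuotientGroup.eq_one_iff]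
  have hK : Subgroup.upperCentralSeries G (i + 1) < K := by
    refine lt_of_le_of_ne (fun h hh ↦ (mem_K h).2 (hh g)) ?_
    rintro h
    exact hg (h ▸ (mem_K g).2 (by simp))
  have hK' : K < ⊤ := by
    refine lt_top_iff_ne_top.2 fun h ↦ hg fun y ↦ ?_
    rw [← commutatorElement_inv]
    exact inv_mem ((mem_K y).1 (h ▸ mem_top y))
  calc p ^ 2 * Nat.card (Subgroup.upperCentralSeries G (i + 1))
      = p * (p * Nat.card (Subgroup.upperCentralSeries G (i + 1))) := by ring
    _ ≤ p * Nat.card K := Nat.mul_le_mul_left _ (hG.mul_card_le_card_of_lt hK)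
    _ ≤ Nat.card (⊤ : Subgroup G) := hG.mul_card_le_card_of_lt hK'
    _ = Nat.card G := card_top

lemma IsPGroup.pow_mul_card_upperCentralSeries_le {p : ℕ} [Fact p.Prime] {G : Type*} [Group G]
    [Finite G] (hG : IsPGroup p G) (i k : ℕ) (h : i + k ≤ Group.nilpotencyClass G) :
    p ^ k * Nat.card (Subgroup.upperCentralSeries G i) ≤
      Nat.card (Subgroup.upperCentralSeries G (i + k)) := by
  induction k with
  | zero => simp
  | succ k ih =>
    calc p ^ (k + 1) * Nat.card (Subgroup.upperCentralSeries G i)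
        = p * (p ^ k * Nat.card (Subgroup.upperCentralSeries G i)) := by ring
      _ ≤ p * Nat.card (Subgroup.upperCentralSeries G (i + k)) :=
        Nat.mul_le_mul_left _ (ih (by omega))
      _ ≤ _ := hG.mul_card_le_card_of_lt <|
        Subgroup.upperCentralSeries.StrictMonoOn G (by simp; omega) (by simpa using h) (by omega)

/-- In a group of order `p ^ (c + 1)` and class `c ≥ 2`, the `i`-th term of the upper central series
has order `p ^ i` for `i < c`. -/
lemma IsPGroup.card_upperCentralSeries_of_coclass_one {p : ℕ} [Fact p.Prime] {G : Type*} [Group G]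
    [Finite G] [Group.IsNilpotent G] (hG : IsPGroup p G) {c : ℕ} (hcard : Nat.card G = p ^ (c + 1))
    (hclass : Group.nilpotencyClass G = c) (hc : 2 ≤ c) {i : ℕ} (hi : i < c) :
    Nat.card (Subgroup.upperCentralSeries G i) = p ^ i := by
  obtain ⟨d, rfl⟩ : ∃ d, c = i + d + 1 := ⟨c - 1 - i, by omega⟩
  have hp : 0 < p := (Fact.out : p.Prime).pos
  apply le_antisymm
  · have h1 := hG.pow_mul_card_upperCentralSeries_le i d (by omega)
    obtain ⟨e, he⟩ : ∃ e, i + d = e + 1 := ⟨i + d - 1, by omega⟩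
    have h2 := hG.sq_mul_card_upperCentralSeries_le (i := e) (by
      rw [Ne, Subgroup.upperCentralSeries_eq_top_iff_nilpotencyClass_le]; omega)
    rw [he] at h1
    refine Nat.le_of_mul_le_mul_left (?_ : p ^ (d + 2) * _ ≤ p ^ (d + 2) * _) (by positivity)
    calc p ^ (d + 2) * Nat.card (Subgroup.upperCentralSeries G i)
        = p ^ 2 * (p ^ d * Nat.card (Subgroup.upperCentralSeries G i)) := by ring
      _ ≤ Nat.card G := (Nat.mul_le_mul_left _ h1).trans h2
      _ = p ^ (d + 2) * p ^ i := by rw [hcard]; ring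
  · simpa using hG.pow_mul_card_upperCentralSeries_le 0 i (by omega)

lemma Subgroup.exists_mem_upperCentralSeries_succ {G : Type*} [Group G] [Group.IsNilpotent G]
    {N : Subgroup G} [N.Normal] {i : ℕ} (h : ¬ N ≤ Subgroup.upperCentralSeries G i) :
    ∃ x ∈ N, x ∈ Subgroup.upperCentralSeries G (i + 1) ∧ x ∉ Subgroup.upperCentralSeries G i := by
  classical
  have hex : ∃ j, ¬ N ⊓ Subgroup.upperCentralSeries G j ≤ Subgroup.upperCentralSeries G i :=
    ⟨Group.nilpotencyClass G, by simpa using h⟩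
  obtain ⟨x, hx, hxi⟩ := SetLike.not_le_iff_exists.1 (Nat.find_spec hex)
  obtain ⟨hxN, hxj⟩ := mem_inf.1 hx
  refine ⟨x, hxN, fun y ↦ ?_, hxi⟩
  cases hj : Nat.find hex with
  | zero => rw [hj] at hxj; exact absurd (mem_bot.1 hxj ▸ one_mem _) hxi
  | succ j =>
    have := not_not.1 (Nat.find_min hex (m := j) (by omega))
    rw [hj] at hxj
    refine this (mem_inf.2 ⟨?_, hxj y⟩)
    rw [commutatorElement_def, mul_assoc, mul_assoc, ← mul_assoc y]
    exact mul_mem hxN (Normal.conj_mem inferInstance _ (inv_mem hxN) y)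

lemma exists_mulAut_orderOf_eq_prime {p : ℕ} [Fact p.Prime] {G : Type*} [Group G] (f : G →* G)
    (hf : ∀ x, f^[p] x = x) (hfix : ∀ x ∈ frattini G, f x = x)
    (hinn : ¬ ∃ h : G, ∀ x : G, f x = h⁻¹ * x * h) :
    ∃ α : MulAut G, orderOf α = p ∧ (∀ x ∈ frattini G, α x = x) ∧
      ¬ ∃ h : G, ∀ x : G, α x = h⁻¹ * x * h := by
  have hp : p - 1 + 1 = p := Nat.sub_add_cancel (Fact.out : p.Prime).one_le
  have hbij : Function.Bijective f := by
    constructor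
    · intro a b hab
      rw [← hf a, ← hf b, ← hp, Function.iterate_succ_apply, Function.iterate_succ_apply, hab]
    · intro a
      exact ⟨f^[p - 1] a, by rw [← Function.iterate_succ_apply' f, Nat.succ_eq_add_one, hp, hf]⟩
  let α : MulAut G := MulEquiv.ofBijective f hbij
  have hα (k : ℕ) (x : G) : (α ^ k) x = f^[k] x := by
    induction k with
    | zero => rfl
    | succ k ih => rw [pow_succ', MulAut.mul_apply, ih, Function.iterate_succ_apply']; rfl
  refine ⟨α, orderOf_eq_prime (MulEquiv.ext fun x ↦ (hα p x).trans (hf x)) ?_, hfix, hinn⟩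
  intro h
  refine hinn ⟨1, fun x ↦ ?_⟩
  have hx : f x = x := DFunLike.congr_fun h x
  simpa using hx

lemma frattini_le_ker_of_card_range_eq_prime {p : ℕ} [Fact p.Prime] {G H : Type*} [Group G]
    [Finite G] [Group H] (hG : IsPGroup p G) (f : G →* H) (hf : Nat.card f.range = p) :
    frattini G ≤ f.ker := by
  refine frattini_le_coatom (hG.isCoatom_of_card_le_mul ?_ ?_)
  · rw [Ne, ← index_eq_one, index_ker, hf]
    exact (Fact.out : p.Prime).ne_one
  · rw [← card_mul_index f.ker, index_ker, hf, mul_comm]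

lemma center_le_of_normal_of_card_center_eq_prime {p : ℕ} [Fact p.Prime] {G : Type*} [Group G]
    [Group.IsNilpotent G] (hZ : Nat.card (center G) = p) {N : Subgroup G} [N.Normal]
    (hN : N ≠ ⊥) : center G ≤ N := by
  obtain ⟨x, hxN, hxZ, hx⟩ := exists_mem_upperCentralSeries_succ (N := N) (i := 0) (by simpa)
  rw [zero_add, Subgroup.upperCentralSeries_one] at hxZ
  intro z hz
  obtain ⟨k, hk⟩ := mem_zpowers_of_prime_card hZ (g := ⟨x, hxZ⟩) (g' := ⟨z, hz⟩)
    (fun h ↦ hx (by simpa using h))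
  have : x ^ k = z := congrArg Subtype.val hk
  exact this ▸ zpow_mem hxN k

/-- If the first two factors of the upper central series have order `p`, a normal subgroup with
noncentral elements contains the second centre. -/
lemma IsPGroup.upperCentralSeries_two_le {p : ℕ} [Fact p.Prime] {G : Type*} [Group G]
    [Finite G] [Group.IsNilpotent G] (hG : IsPGroup p G) (hZ : Nat.card (center G) = p)
    (hZ2 : Nat.card (Subgroup.upperCentralSeries G 2) = p ^ 2) {N : Subgroup G} [N.Normal]
    (hN : ¬ N ≤ center G) : Subgroup.upperCentralSeries G 2 ≤ N := by
  have hZN : center G ≤ N := center_le_of_normal_of_card_center_eq_prime hZ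
    (by rintro rfl; exact hN bot_le)
  rw [← Subgroup.upperCentralSeries_one] at hN hZN hZ
  obtain ⟨x, hxN, hx2, hx1⟩ := exists_mem_upperCentralSeries_succ hN
  have hlt : Subgroup.upperCentralSeries G 1 < N ⊓ Subgroup.upperCentralSeries G 2 :=
    lt_of_le_not_ge (le_inf hZN (Subgroup.upperCentralSeries_mono G one_le_two))
      fun h ↦ hx1 (h (mem_inf.2 ⟨hxN, hx2⟩))
  have hcard := hG.mul_card_le_card_of_lt hlt
  rw [hZ, ← sq, ← hZ2] at hcard
  exact inf_eq_right.1 (eq_of_le_of_card_ge inf_le_right hcard)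

/-- The case of order at least `p ^ 4`, where a central automorphism does the job. -/
lemma exists_noninner_of_card_upperCentralSeries_two {p : ℕ} [Fact p.Prime] {G : Type*} [Group G]
    [Finite G] [Group.IsNilpotent G] (hG : IsPGroup p G) (hZ : Nat.card (center G) = p)
    (hZ2 : Nat.card (Subgroup.upperCentralSeries G 2) = p ^ 2)
    (hna : ¬ ∀ a b : G, a * b = b * a) :
    ∃ α : MulAut G, orderOf α = p ∧ (∀ x ∈ frattini G, α x = x) ∧
      ¬ ∃ h : G, ∀ x : G, α x = h⁻¹ * x * h := by
  have hp : p.Prime := Fact.out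
  obtain ⟨n, hn⟩ := IsPGroup.iff_card.1 hG
  obtain ⟨g, hg⟩ : ∃ g, g ∉ centralizer (Subgroup.upperCentralSeries G 2 : Set G) := by
    by_contra! h
    have hle : Subgroup.upperCentralSeries G 2 ≤ center G := by
      rw [← centralizer_univ, ← coe_top, ← le_centralizer_iff]
      exact fun x _ ↦ h x
    have := Subgroup.card_le_of_le hle
    rw [hZ, hZ2] at this
    nlinarith [hp.two_le]
  have hg_top : zpowers g < ⊤ := by
    refine lt_top_iff_ne_top.2 fun h ↦ hna fun a b ↦ ?_
    obtain ⟨i, rfl⟩ := mem_zpowers_iff.1 (h ▸ mem_top a)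
    obtain ⟨j, rfl⟩ := mem_zpowers_iff.1 (h ▸ mem_top b)
    exact zpow_mul_comm g i j
  obtain ⟨m, hm⟩ := IsPGroup.iff_card.1 (hG.to_subgroup (zpowers g))
  have hmn : m + 1 ≤ n := by
    have := hG.mul_card_le_card_of_lt hg_top
    rw [card_top, hn, hm, ← pow_succ'] at this
    exact (Nat.pow_le_pow_iff_right hp.one_lt).1 this
  obtain ⟨k, rfl⟩ : ∃ k, n = k + 1 := ⟨n - 1, by omega⟩
  obtain ⟨M, hM, hgM⟩ := Sylow.exists_subgroup_card_pow_prime_le p (m := k)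
    (by rw [hn]; exact pow_dvd_pow p k.le_succ) (zpowers g) hm (by omega)
  have hMi : M.index = p := by
    have := M.card_mul_index
    rw [hM, hn, pow_succ] at this
    exact Nat.eq_of_mul_eq_mul_left (pow_pos hp.pos k) this
  have : M.Normal := normal_of_index_eq_minFac_card (by rw [hMi, hn, hp.pow_minFac k.succ_ne_zero])
  let χ : G →* center G :=
    (mulEquivOfPrimeCardEq (G := G ⧸ M) (p := p) hMi hZ).toMonoidHom.comp (QuotientGroup.mk' M)
  have hχM (x : G) : χ x = 1 ↔ x ∈ M := by simp [χ]
  have hcomm (x y : G) : (χ x : G) * y = y * χ x := (mem_center_iff.1 (χ x).2 y).symm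
  have hker : commutator G ≤ χ.ker := by
    refine commutator_le.2 fun a _ b _ ↦ ?_
    rw [MonoidHom.mem_ker, map_commutatorElement, commutatorElement_eq_one_iff_mul_comm]
    exact Subtype.ext (hcomm _ _)
  have hχZ (z : center G) : χ z = 1 := by
    refine hker
      (center_le_of_normal_of_card_center_eq_prime hZ (fun h ↦ hna fun a b ↦ ?_) z.2)
    rw [← commutatorElement_eq_one_iff_mul_comm, ← mem_bot, ← h]
    exact commutator_mem_commutator (mem_top a) (mem_top b)
  let f : G →* G :=
    { toFun x := x * χ x
      map_one' := by simp
      map_mul' x y := by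
        rw [map_mul, coe_mul]
        simp only [mul_assoc]
        rw [← mul_assoc (χ x : G) y, hcomm x y, mul_assoc] }
  have hf (x : G) : f x = x * χ x := rfl
  have hiter (k : ℕ) (x : G) : f^[k] x = x * χ x ^ k := by
    induction k with
    | zero => simp
    | succ k ih =>
      rw [Function.iterate_succ_apply', ih, hf, map_mul, ← coe_pow, hχZ, mul_one, coe_pow,
        pow_succ, mul_assoc]
  have hsurj : Function.Surjective χ :=
    (mulEquivOfPrimeCardEq (G := G ⧸ M) (p := p) hMi hZ).surjective.comp
      (QuotientGroup.mk'_surjective M)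
  refine exists_mulAut_orderOf_eq_prime f (fun x ↦ ?_) (fun x hx ↦ ?_) ?_
  · rw [hiter, ← coe_pow, ← hZ, pow_card_eq_one']
    simp
  · have := frattini_le_ker_of_card_range_eq_prime hG χ
      (by rw [MonoidHom.range_eq_top.2 hsurj, card_top, hZ]) hx
    rw [hf, MonoidHom.mem_ker.1 this]
    simp
  · rintro ⟨h, hh⟩
    have hhM : h ∈ centralizer (M : Set G) := by
      refine mem_centralizer_iff.2 fun x hx ↦ ?_
      have := hh x
      rw [hf, (hχM x).2 hx, coe_one, mul_one, mul_assoc, eq_inv_mul_iff_mul_eq] at this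
      exact this.symm
    have hhZ : h ∈ center G := by
      by_contra hhZ
      have hle := hG.upperCentralSeries_two_le hZ hZ2 (N := centralizer (M : Set G))
        fun hle ↦ hhZ (hle hhM)
      exact hg (le_centralizer_iff.1 hle (hgM (mem_zpowers g)))
    have hχ1 (x : G) : χ x = 1 := by
      have := hh x
      rw [mul_assoc, ← mem_center_iff.1 hhZ x |>.symm, hf] at this
      simpa using this
    refine hp.ne_one (hZ ▸ card_eq_one.2 ((eq_bot_iff_forall _).2 fun z hz ↦ ?_))
    obtain ⟨x, hx⟩ := hsurj ⟨z, hz⟩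
    simpa [hχ1] using congrArg Subtype.val hx.symm

lemma zpow_mul_zpow_of_mul_eq {G : Type*} [Group G] {x y z : G} (hz : z ∈ center G)
    (h : y * x = x * y * z) (i j : ℤ) : y ^ j * x ^ i = x ^ i * y ^ j * z ^ (j * i) := by
  have hcomm (g : G) : Commute g z := mem_center_iff.1 hz g
  have h1 : y * x ^ i * y⁻¹ = x ^ i * z ^ i := by
    rw [← conj_zpow, ← (hcomm x).mul_zpow, h, mul_assoc, ((hcomm y⁻¹).eq).symm]
    group
  have h2 : (x ^ i)⁻¹ * y * (x ^ i)⁻¹⁻¹ = y * z ^ i := by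
    rw [inv_inv, mul_assoc, mul_inv_eq_iff_eq_mul.1 h1, mul_assoc,
      (((hcomm y).zpow_right i).eq).symm]
    group
  have h3 : (x ^ i)⁻¹ * y ^ j * (x ^ i)⁻¹⁻¹ = y ^ j * z ^ (j * i) := by
    rw [← conj_zpow, h2, ((hcomm y).zpow_right i).mul_zpow, ← zpow_mul, mul_comm i]
  rw [mul_assoc, ← h3]
  group

lemma zpow_eq_one_of_zpow_mul_zpow_mem_center {G : Type*} [Group G] {x y z : G} (hz : z ∈ center G)
    (h : y * x = x * y * z) {i j : ℤ} (hc : x ^ i * y ^ j ∈ center G) :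
    z ^ i = 1 ∧ z ^ j = 1 := by
  have hx := zpow_mul_zpow_of_mul_eq hz h 1 j
  have hy := zpow_mul_zpow_of_mul_eq hz h i 1
  simp only [zpow_one, one_mul, mul_one] at hx hy
  constructor
  · have h1 := mem_center_iff.1 hc y
    rw [← mul_assoc, hy, mul_assoc, ← mem_center_iff.1 (zpow_mem hz i), ← mul_assoc,
      mul_assoc (x ^ i), ← zpow_one_add, add_comm, zpow_add_one, mul_assoc, mul_assoc] at h1
    simpa [mul_assoc] using h1
  · have h1 := mem_center_iff.1 hc x
    rw [mul_assoc, hx] at h1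
    simp only [← mul_assoc, (Commute.refl x).zpow_left i |>.eq] at h1
    simpa using h1

/-- The normal forms `x ^ i * y ^ j * z ^ k` in two pairs of generators satisfying the same
relations agree. -/
lemma normalForm_eq_of_eq {p : ℕ} {G : Type*} [Group G] {x y x' y' z : G}
    (hz : z ∈ center G) (hzp : orderOf z = p) (h : y * x = x * y * z)
    (hx : x ^ p = x' ^ p) (hy : y ^ p = y' ^ p) {i j k i' j' k' : ℤ}
    (heq : x ^ i * y ^ j * z ^ k = x ^ i' * y ^ j' * z ^ k') :
    x' ^ i * y' ^ j * z ^ k = x' ^ i' * y' ^ j' * z ^ k' := by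
  have hzc (g : G) (k : ℤ) : g * z ^ k = z ^ k * g := mem_center_iff.1 (zpow_mem hz k) g
  have of_zpow (a : ℤ) (ha : z ^ a = 1) : ∃ b, a = p * b := by
    rw [← hzp]; exact orderOf_dvd_iff_zpow_eq_one.2 ha
  have heq' : x ^ (i - i') * y ^ (j - j') = z ^ (k' - k) := by
    have : x ^ (-i') * (x ^ i * y ^ j * z ^ k) * (y ^ (-j') * z ^ (-k)) =
      x ^ (-i') * (x ^ i' * y ^ j' * z ^ k') * (y ^ (-j') * z ^ (-k)) := by rw [heq]
    calc x ^ (i - i') * y ^ (j - j')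
        = x ^ (-i') * x ^ i * y ^ j * (y ^ (-j') * z ^ k) * z ^ (-k) := by group
      _ = x ^ (-i') * x ^ i' * (y ^ j' * (z ^ k' * y ^ (-j'))) * z ^ (-k) := by
        rw [hzc _ k, mul_assoc _ (z ^ k * _), mul_assoc (z ^ k)]
        simpa only [mul_assoc] using this
      _ = z ^ (k' - k) := by rw [← hzc _ k']; group
  obtain ⟨hza, hzb⟩ := zpow_eq_one_of_zpow_mul_zpow_mem_center hz h
    (heq' ▸ zpow_mem hz _ : x ^ (i - i') * y ^ (j - j') ∈ center G)
  obtain ⟨a, ha⟩ := of_zpow _ hza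
  obtain ⟨b, hb⟩ := of_zpow _ hzb
  have hx' : x ^ (i - i') = x' ^ (i - i') := by
    rw [ha, zpow_mul, zpow_mul, zpow_natCast, zpow_natCast, hx]
  have hy' : y ^ (j - j') = y' ^ (j - j') := by
    rw [hb, zpow_mul, zpow_mul, zpow_natCast, zpow_natCast, hy]
  rw [hx', hy'] at heq'
  calc x' ^ i * y' ^ j * z ^ k
      = x' ^ i' * (x' ^ (i - i') * y' ^ (j - j')) * y' ^ j' * z ^ k := by group
    _ = x' ^ i' * y' ^ j' * z ^ k' := by rw [heq', mul_assoc (x' ^ i'), ← hzc]; group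

lemma exists_monoidHom_of_generators {p : ℕ} {G : Type*} [Group G] {x y x' y' z : G}
    (hz : z ∈ center G) (hzp : orderOf z = p) (h : y * x = x * y * z)
    (h' : y' * x' = x' * y' * z) (hx : x ^ p = x' ^ p) (hy : y ^ p = y' ^ p)
    (hgen : ∀ g : G, ∃ i j k : ℤ, x ^ i * y ^ j * z ^ k = g) :
    ∃ f : G →* G, f x = x' ∧ f y = y' ∧ f z = z := by
  have hmul {a b : G} (hab : b * a = a * b * z) (i j k i' j' k' : ℤ) :
      a ^ i * b ^ j * z ^ k * (a ^ i' * b ^ j' * z ^ k') =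
        a ^ (i + i') * b ^ (j + j') * z ^ (j * i' + k + k') := by
    have hzc (g : G) (k : ℤ) : g * z ^ k = z ^ k * g := mem_center_iff.1 (zpow_mem hz k) g
    calc a ^ i * b ^ j * z ^ k * (a ^ i' * b ^ j' * z ^ k')
        = a ^ i * b ^ j * (z ^ k * (a ^ i' * b ^ j')) * z ^ k' := by group
      _ = a ^ i * (b ^ j * a ^ i') * b ^ j' * z ^ (k + k') := by rw [← hzc]; group
      _ = a ^ (i + i') * b ^ j * (z ^ (j * i') * b ^ j') * z ^ (k + k') := by
        rw [zpow_mul_zpow_of_mul_eq hz hab]; group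
      _ = _ := by rw [← hzc]; group
  choose i j k hijk using hgen
  have hf {g : G} {a b c : ℤ} (hg : x ^ a * y ^ b * z ^ c = g) :
      x' ^ i g * y' ^ j g * z ^ k g = x' ^ a * y' ^ b * z ^ c :=
    normalForm_eq_of_eq hz hzp h hx hy ((hijk g).trans hg.symm)
  refine ⟨MonoidHom.mk' (fun g ↦ x' ^ i g * y' ^ j g * z ^ k g) fun g g' ↦ ?_, ?_, ?_, ?_⟩
  · rw [hmul h', hf]
    rw [← hmul h, hijk, hijk]
  · simpa using hf (a := 1) (b := 0) (c := 0) (by simp)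
  · simpa using hf (a := 0) (b := 1) (c := 0) (by simp)
  · simpa using hf (a := 0) (b := 0) (c := 1) (by simp)

lemma mul_eq_mul_mul_commutator {G : Type*} [Group G] (a b : G) : b * a = a * b * ⁅b⁻¹, a⁻¹⁆ := by
  rw [commutatorElement_def]
  group

lemma mul_pow_of_mul_eq {G : Type*} [Group G] {a b c : G} (hc : c ∈ center G)
    (h : b * a = a * b * c) (n : ℕ) : (a * b) ^ n = a ^ n * b ^ n * c ^ n.choose 2 := by
  induction n with
  | zero => simp
  | succ n ih =>
    have hcc (g : G) (k : ℕ) : g * c ^ k = c ^ k * g := mem_center_iff.1 (pow_mem hc k) g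
    have hba := zpow_mul_zpow_of_mul_eq hc h 1 n
    rw [mul_one, zpow_one, zpow_natCast, zpow_natCast] at hba
    calc (a * b) ^ (n + 1) = a ^ n * b ^ n * (c ^ n.choose 2 * (a * b)) := by
          rw [pow_succ, ih]; group
      _ = a ^ n * (b ^ n * a) * b * c ^ n.choose 2 := by rw [← hcc]; group
      _ = a ^ n * a * b ^ n * (c ^ n * b) * c ^ n.choose 2 := by rw [hba]; group
      _ = a ^ (n + 1) * b ^ (n + 1) * c ^ (n + n.choose 2) := by
        rw [← hcc, pow_add, pow_succ, pow_succ]; group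
      _ = _ := by rw [Nat.choose_succ_succ' n 1, Nat.choose_one_right]

lemma pow_eq_one_of_mem_center {p : ℕ} {G : Type*} [Group G] (hZ : Nat.card (center G) = p) {c : G}
    (hc : c ∈ center G) : c ^ p = 1 :=
  congrArg Subtype.val (hZ ▸ pow_card_eq_one' : (⟨c, hc⟩ : center G) ^ p = 1)

lemma pow_mem_center_of_commutator_mem_center {p : ℕ} {G : Type*} [Group G]
    (hZ : Nat.card (center G) = p)
    (hcomm : ∀ a b : G, ⁅a, b⁆ ∈ center G) (a : G) : a ^ p ∈ center G := by
  refine mem_center_iff.2 fun b ↦ ?_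
  have := zpow_mul_zpow_of_mul_eq (hcomm b⁻¹ a⁻¹) (mul_eq_mul_mul_commutator a b) p 1
  rwa [zpow_one, one_mul, zpow_natCast, zpow_natCast, pow_eq_one_of_mem_center hZ (hcomm _ _),
    mul_one] at this

lemma mul_pow_prime_of_commutator_mem_center {p : ℕ} [Fact p.Prime] {G : Type*} [Group G]
    (hp2 : p ≠ 2) (hZ : Nat.card (center G) = p)
    (hcomm : ∀ a b : G, ⁅a, b⁆ ∈ center G) (a b : G) :
    (a * b) ^ p = a ^ p * b ^ p := by
  have hp : p.Prime := Fact.out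
  obtain ⟨m, hm⟩ := hp.dvd_choose_self two_ne_zero (hp.two_le.lt_of_ne' hp2)
  rw [mul_pow_of_mul_eq (hcomm b⁻¹ a⁻¹) (mul_eq_mul_mul_commutator a b), hm, pow_mul,
    pow_eq_one_of_mem_center hZ (hcomm _ _), one_pow, mul_one]

lemma exists_noncommuting_sq_eq_sq {G : Type*} [Group G] (hZ : Nat.card (center G) = 2)
    (hcomm : ∀ a b : G, ⁅a, b⁆ ∈ center G) (hna : ¬ ∀ a b : G, a * b = b * a) :
    ∃ x y : G, x * y ≠ y * x ∧ x ^ 2 = y ^ 2 := by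
  push Not at hna
  obtain ⟨a, b, hab⟩ := hna
  have hsq (g : G) : g ^ 2 ∈ center G := pow_mem_center_of_commutator_mem_center hZ hcomm g
  have ha : a * (a * b) ≠ a * b * a := by simpa [mul_assoc] using hab
  have hb : b * (a * b) ≠ a * b * b := by simpa [← mul_assoc] using hab.symm
  obtain ⟨u, v, -, huv⟩ := Nat.card_eq_two_iff.1 hZ
  have key (g : G) : g ^ 2 = u ∨ g ^ 2 = v := by
    have : (⟨g ^ 2, hsq g⟩ : center G) ∈ ({u, v} : Set (center G)) := huv ▸ Set.mem_univ _
    exact this.imp (congrArg Subtype.val) (congrArg Subtype.val)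
  by_contra! hne
  have h1 := hne a b hab
  have h2 := hne a (a * b) ha
  have h3 := hne b (a * b) hb
  rcases key a with h | h <;> rcases key b with h' | h' <;> rcases key (a * b) with h'' | h'' <;>
    first
      | exact h1 (h.trans h'.symm)
      | exact h2 (h.trans h''.symm)
      | exact h3 (h'.trans h''.symm)

section OrderPrimeCubed

variable {p : ℕ} [Fact p.Prime] {G : Type*} [Group G] [Finite G]

lemma isCoatom_centralizer_of_card_eq_prime_cubed (hG : Nat.card G = p ^ 3)
    (hZ : Nat.card (center G) = p) {a : G} (ha : a ∉ center G) :
    IsCoatom (centralizer {a}) := by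
  have hpG : IsPGroup p G := IsPGroup.of_card hG
  have hlt : center G < centralizer {a} := by
    refine lt_of_le_not_ge (center_le_centralizer _) fun h ↦ ha (h ?_)
    exact mem_centralizer_singleton_iff.2 rfl
  refine hpG.isCoatom_of_card_le_mul (fun h ↦ ha ?_) ?_
  · refine mem_center_iff.2 fun g ↦ mem_centralizer_singleton_iff.1 (h ▸ mem_top g)
  · calc Nat.card G = p * (p * Nat.card (center G)) := by rw [hG, hZ]; ring
      _ ≤ _ := Nat.mul_le_mul_left _ (hpG.mul_card_le_card_of_lt hlt)

lemma frattini_le_center_of_card_eq_prime_cubed (hG : Nat.card G = p ^ 3)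
    (hZ : Nat.card (center G) = p) : frattini G ≤ center G := by
  refine fun x hx ↦ mem_center_iff.2 fun a ↦ ?_
  by_cases ha : a ∈ center G
  · exact (mem_center_iff.1 ha x).symm
  · exact (mem_centralizer_singleton_iff.1
      (frattini_le_coatom (isCoatom_centralizer_of_card_eq_prime_cubed hG hZ ha) hx)).symm

lemma mem_center_of_commute_of_card_eq_prime_cubed (hG : Nat.card G = p ^ 3)
    (hZ : Nat.card (center G) = p) {a b g : G} (hab : a * b ≠ b * a)
    (ha : g * a = a * g) (hb : g * b = b * g) : g ∈ center G := by
  have hpG : IsPGroup p G := IsPGroup.of_card hG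
  have hlt : centralizer {a} ⊓ centralizer {b} < centralizer {a} := by
    refine lt_of_le_not_ge inf_le_left fun h ↦ hab ?_
    exact mem_centralizer_singleton_iff.1 (h (mem_centralizer_singleton_iff.2 rfl)).2
  have htop : centralizer {a} < ⊤ := by
    refine lt_top_iff_ne_top.2 fun h ↦ hab ?_
    exact (mem_centralizer_singleton_iff.1 (h ▸ mem_top b)).symm
  have hle : center G ≤ centralizer {a} ⊓ centralizer {b} :=
    le_inf (center_le_centralizer _) (center_le_centralizer _)
  rw [eq_of_le_of_card_ge hle]
  · exact ⟨mem_centralizer_singleton_iff.2 ha, mem_centralizer_singleton_iff.2 hb⟩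
  · have h1 := hpG.mul_card_le_card_of_lt hlt
    have h2 := hpG.mul_card_le_card_of_lt htop
    have hp : 0 < p := (Fact.out : p.Prime).pos
    rw [card_top, hG] at h2
    rw [hZ]
    refine Nat.le_of_mul_le_mul_left (?_ : p ^ 2 * _ ≤ p ^ 2 * _) (by positivity)
    nlinarith

/-- Every element has a normal form in terms of two noncommuting ones. -/
lemma exists_normalForm_of_card_eq_prime_cubed (hG : Nat.card G = p ^ 3)
    (hZ : Nat.card (center G) = p) (hcomm : ∀ a b : G, ⁅a, b⁆ ∈ center G)
    {x y z : G} (hz : z ∈ center G) (hz1 : z ≠ 1) (h : y * x = x * y * z) (g : G) :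
    ∃ i j k : ℤ, x ^ i * y ^ j * z ^ k = g := by
  have hzc (g : G) (k : ℤ) : g * z ^ k = z ^ k * g := mem_center_iff.1 (zpow_mem hz k) g
  have hzpow {c : G} (hc : c ∈ center G) : ∃ k : ℤ, z ^ k = c := by
    obtain ⟨k, hk⟩ := mem_zpowers_of_prime_card hZ (g := ⟨z, hz⟩) (g' := ⟨c, hc⟩)
      (fun h ↦ hz1 (congrArg Subtype.val h))
    exact ⟨k, congrArg Subtype.val hk⟩
  obtain ⟨t, ht⟩ := hzpow (hcomm g⁻¹ x⁻¹)
  obtain ⟨s, hs⟩ := hzpow (hcomm g⁻¹ y⁻¹)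
  have ht' : g * x = x * g * z ^ t := ht ▸ mul_eq_mul_mul_commutator x g
  have hs' : g * y = y * g * z ^ s := hs ▸ mul_eq_mul_mul_commutator y g
  have hxs := zpow_mul_zpow_of_mul_eq hz h s 1
  have hyt := zpow_mul_zpow_of_mul_eq hz h 1 (-t)
  simp only [zpow_one, one_mul, mul_one] at hxs hyt
  have hyx : y * x ≠ x * y := by rw [h]; simpa
  obtain ⟨k, hk⟩ := hzpow <| mem_center_of_commute_of_card_eq_prime_cubed hG hZ
    (a := x) (b := y) (g := x ^ s * g * y ^ (-t)) hyx.symm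
    (by
      calc x ^ s * g * y ^ (-t) * x = x ^ s * (g * x) * y ^ (-t) * z ^ (-t) := by
            rw [mul_assoc, hyt]; group
        _ = x ^ s * x * g * (z ^ t * y ^ (-t)) * z ^ (-t) := by rw [ht']; group
        _ = x * (x ^ s * g * y ^ (-t)) := by rw [← hzc]; group)
    (by
      calc x ^ s * g * y ^ (-t) * y = x ^ s * (g * y) * y ^ (-t) := by group
        _ = x ^ s * y * g * (z ^ s * y ^ (-t)) := by rw [hs']; group
        _ = x ^ s * y * (g * y ^ (-t) * z ^ s) := by rw [← hzc]; group
        _ = x ^ s * y * z ^ s * (g * y ^ (-t)) := by rw [hzc]; group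
        _ = y * (x ^ s * g * y ^ (-t)) := by rw [← hxs]; group)
  refine ⟨-s, t, k, ?_⟩
  rw [mul_assoc, hzc, hk]
  group

/-- Replacing a pair of generators by another one satisfying the same relations yields a noninner
automorphism as soon as the first generator changes by a noncentral factor. -/
lemma exists_noninner_of_generators (hG : Nat.card G = p ^ 3) (hZ : Nat.card (center G) = p)
    (hcomm : ∀ a b : G, ⁅a, b⁆ ∈ center G) {x y x' y' z : G} (hz : z ∈ center G) (hz1 : z ≠ 1)
    (h : y * x = x * y * z) (h' : y' * x' = x' * y' * z) (hx : x ^ p = x' ^ p) (hy : y ^ p = y' ^ p)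
    (hiter : ∀ f : G →* G, f x = x' → f y = y' → f^[p] x = x ∧ f^[p] y = y)
    (hxx' : x⁻¹ * x' ∉ center G) :
    ∃ α : MulAut G, orderOf α = p ∧ (∀ x ∈ frattini G, α x = x) ∧
      ¬ ∃ h : G, ∀ x : G, α x = h⁻¹ * x * h := by
  have hgen := exists_normalForm_of_card_eq_prime_cubed hG hZ hcomm hz hz1 h
  have hzp : orderOf (⟨z, hz⟩ : center G) = p :=
    orderOf_eq_prime (hZ ▸ pow_card_eq_one') fun h ↦ hz1 (congrArg Subtype.val h)
  obtain ⟨f, hfx, hfy, hfz⟩ := exists_monoidHom_of_generators hz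
    ((Subgroup.orderOf_mk z hz).symm.trans hzp) h h' hx hy hgen
  obtain ⟨hix, hiy⟩ := hiter f hfx hfy
  refine exists_mulAut_orderOf_eq_prime f (fun g ↦ ?_) (fun g hg ↦ ?_) ?_
  · obtain ⟨i, j, k, rfl⟩ := hgen g
    simp only [iterate_map_mul, iterate_map_zpow, hix, hiy, Function.iterate_fixed hfz]
  · obtain ⟨k, hk⟩ := mem_zpowers_of_prime_card hZ (g := ⟨z, hz⟩)
      (g' := ⟨g, frattini_le_center_of_card_eq_prime_cubed hG hZ hg⟩)
      (fun h ↦ hz1 (congrArg Subtype.val h))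
    have : z ^ k = g := congrArg Subtype.val hk
    rw [← this, map_zpow, hfz]
  · rintro ⟨u, hu⟩
    refine hxx' ?_
    rw [← hfx, hu]
    convert hcomm x⁻¹ u⁻¹ using 1
    rw [commutatorElement_def]
    group

lemma exists_notMem_center_pow_eq_one (hp2 : p ≠ 2) (hG : Nat.card G = p ^ 3)
    (hZ : Nat.card (center G) = p) (hcomm : ∀ a b : G, ⁅a, b⁆ ∈ center G) :
    ∃ w ∉ center G, w ^ p = 1 := by
  have hp : p.Prime := Fact.out
  let f : G →* G := MonoidHom.mk' (· ^ p) (mul_pow_prime_of_commutator_mem_center hp2 hZ hcomm)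
  have hf : f.range ≤ center G := by
    rintro _ ⟨a, rfl⟩
    exact pow_mem_center_of_commutator_mem_center hZ hcomm a
  by_contra! hw
  have hker : f.ker ≤ center G := fun w hwf ↦ by_contra fun hwc ↦ hw w hwc hwf
  have hcard := card_mul_index f.ker
  rw [index_ker, hG] at hcard
  have h1 := Subgroup.card_le_of_le hf
  have h2 := Subgroup.card_le_of_le hker
  rw [hZ] at h1 h2
  have := hcard ▸ Nat.mul_le_mul h2 h1
  nlinarith [hp.two_le, pow_pos hp.pos 2]

lemma exists_noninner_of_card_eq_prime_cubed (hG : Nat.card G = p ^ 3)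
    (hZ : Nat.card (center G) = p) (hcomm : ∀ a b : G, ⁅a, b⁆ ∈ center G)
    (hna : ¬ ∀ a b : G, a * b = b * a) :
    ∃ α : MulAut G, orderOf α = p ∧ (∀ x ∈ frattini G, α x = x) ∧
      ¬ ∃ h : G, ∀ x : G, α x = h⁻¹ * x * h := by
  have hz1 {x y : G} (hxy : x * y ≠ y * x) : ⁅y⁻¹, x⁻¹⁆ ≠ 1 := fun h ↦
    hxy (by rw [mul_eq_mul_mul_commutator x y, h, mul_one])
  rcases eq_or_ne p 2 with rfl | hp2
  · obtain ⟨x, y, hxy, hsq⟩ := exists_noncommuting_sq_eq_sq hZ hcomm hna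
    have h := mul_eq_mul_mul_commutator x y
    refine exists_noninner_of_generators hG hZ hcomm (x' := y) (y' := x) (hcomm _ _) (hz1 hxy) h
      ?_ hsq hsq.symm (fun f hfx hfy ↦ by simp [hfx, hfy]) fun hc ↦ hxy ?_
    · rw [h, mul_assoc, ← sq, pow_eq_one_of_mem_center hZ (hcomm _ _), mul_one]
    · have := mem_center_iff.1 hc x
      rw [← mul_assoc, mul_inv_cancel, one_mul, mul_assoc, eq_inv_mul_iff_mul_eq] at this
      exact this
  · obtain ⟨w, hw, hwp⟩ := exists_notMem_center_pow_eq_one hp2 hG hZ hcomm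
    obtain ⟨g, hg⟩ : ∃ g, g * w ≠ w * g := by
      by_contra! h
      exact hw (mem_center_iff.2 h)
    have h := mul_eq_mul_mul_commutator g w
    refine exists_noninner_of_generators hG hZ hcomm (x' := g * w) (y' := w) (hcomm _ _) (hz1 hg) h
      ?_ ?_ rfl (fun f hfg hfw ↦ ⟨?_, Function.iterate_fixed hfw p⟩) (by simpa)
    · rw [← mul_assoc, h, mul_assoc _ _ w, ← mem_center_iff.1 (hcomm _ _) w, mul_assoc (g * w)]
    · rw [mul_pow_prime_of_commutator_mem_center hp2 hZ hcomm, hwp, mul_one]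
    · have hiter (k : ℕ) : f^[k] g = g * w ^ k := by
        induction k with
        | zero => simp
        | succ k ih =>
          rw [Function.iterate_succ_apply', ih, map_mul, map_pow, hfg, hfw, mul_assoc, pow_succ']
      rw [hiter, hwp, mul_one]

end OrderPrimeCubed

/-- A finite non-abelian `p`-group of coclass 1 (i.e. `|G| = p ^ n`,
`n > 2`, of nilpotency class `n - 1`) has a noninner automorphism of order `p`
fixing the Frattini subgroup elementwise. -/
theorem stmt4 {p : ℕ} (hp : p.Prime) (G : Type*) [Group G] [Finite G]
    [Group.IsNilpotent G] (hpG : IsPGroup p G) (hna : ¬ ∀ a b : G, a * b = b * a)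
    {n : ℕ} (hn : 2 < n) (hcard : Nat.card G = p ^ n)
    (hclass : Group.nilpotencyClass G = n - 1) :
    ∃ α : MulAut G, orderOf α = p ∧ (∀ x ∈ frattini G, α x = x) ∧
      ¬ ∃ h : G, ∀ x : G, α x = h⁻¹ * x * h := by
  have : Fact p.Prime := ⟨hp⟩
  obtain ⟨c, rfl⟩ : ∃ c, n = c + 1 := ⟨n - 1, by omega⟩
  rw [Nat.add_sub_cancel] at hclass
  have hupper {i : ℕ} (hi : i < c) : Nat.card (Subgroup.upperCentralSeries G i) = p ^ i :=
    hpG.card_upperCentralSeries_of_coclass_one hcard hclass (by omega) hi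
  have hZ : Nat.card (center G) = p := by
    rw [← Subgroup.upperCentralSeries_one, hupper (by omega), pow_one]
  rcases (show 2 ≤ c by omega).eq_or_lt with rfl | hc
  · refine exists_noninner_of_card_eq_prime_cubed hcard hZ (fun a b ↦ ?_) hna
    rw [← Subgroup.upperCentralSeries_one]
    have htop := Subgroup.upperCentralSeries_eq_top_iff_nilpotencyClass_le.2 hclass.le
    exact (htop ▸ mem_top a : a ∈ Subgroup.upperCentralSeries G 2) b
  · exact exists_noninner_of_card_upperCentralSeries_two hpG hZ (hupper hc) hna
end

section
/- Let p be a prime and let G be a finite non-abelian p-group of coclass c, i.e., |G| = p^n with n > 2 and G has nilpotency class n − c. If every automorphism of G of order p that fixes the Frattini subgroup Φ(G) elementwise is an inner automorphism, then d(Z(G)) · (d(G) + 1) ≤ c + 1. -/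
namespace IsPGroup

variable {p : ℕ} {G : Type*} [Group G]

theorem card_quotient_of_isCoatom [Finite G] (hp : p.Prime) (hG : IsPGroup p G) {M : Subgroup G}
    [M.Normal] (hM : IsCoatom M) : Nat.card (G ⧸ M) = p := by
  have := Fact.mk hp
  have : Nontrivial (G ⧸ M) := QuotientGroup.nontrivial_iff.2 hM.1
  obtain ⟨k, hk, hcard⟩ := (nontrivial_iff_card (hG.to_quotient M)).1 inferInstance
  obtain ⟨y, hy⟩ := exists_prime_orderOf_dvd_card' (G := G ⧸ M) p
    (hcard ▸ dvd_pow_self p hk.ne')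
  have hle : M ≤ (Subgroup.zpowers y).comap (QuotientGroup.mk' M) := fun x hx => by
    rw [Subgroup.mem_comap, QuotientGroup.mk'_apply, (QuotientGroup.eq_one_iff x).2 hx]
    exact one_mem _
  rcases hM.le_iff.1 hle with h | h
  · have : Subgroup.zpowers y = ⊤ := by
      rw [← Subgroup.comap_top (QuotientGroup.mk' M)] at h
      exact Subgroup.comap_injective (QuotientGroup.mk'_surjective M) h
    rw [← Subgroup.card_top, ← this, Nat.card_zpowers, hy]
  · exfalso
    have h1 : y = 1 := by
      obtain ⟨g, rfl⟩ := QuotientGroup.mk'_surjective M y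
      have : g ∈ M := by
        rw [← h]
        exact Subgroup.mem_zpowers _
      exact (QuotientGroup.eq_one_iff g).2 this
    rw [h1, orderOf_one] at hy
    exact hp.one_lt.ne hy

theorem normal_of_isCoatom_s5 [Finite G] (hp : p.Prime) (hG : IsPGroup p G) {M : Subgroup G}
    (hM : IsCoatom M) : M.Normal := by
  have := Fact.mk hp
  have := hG.isNilpotent
  exact Subgroup.NormalizerCondition.normal_of_coatom M Group.normalizerCondition_of_isNilpotent hM

theorem mem_frattini_of_forall [Finite G] {x : G}
    (h : ∀ M : Subgroup G, IsCoatom M → x ∈ M) : x ∈ frattini G := by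
  simpa [frattini, Order.radical, Subgroup.mem_iInf] using h

theorem pow_mem_frattini_s5 [Finite G] (hp : p.Prime) (hG : IsPGroup p G) (x : G) :
    x ^ p ∈ frattini G := by
  refine mem_frattini_of_forall fun M hM => ?_
  have := hG.normal_of_isCoatom_s5 hp hM
  rw [← QuotientGroup.eq_one_iff, QuotientGroup.mk_pow, ← hG.card_quotient_of_isCoatom hp hM,
    pow_card_eq_one']

theorem commutator_mem_frattini [Finite G] (hp : p.Prime) (hG : IsPGroup p G) (x y : G) :
    (x * y)⁻¹ * (y * x) ∈ frattini G := by
  refine mem_frattini_of_forall fun M hM => ?_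
  have := hG.normal_of_isCoatom_s5 hp hM
  have := Fact.mk hp
  have := isCyclic_of_prime_card (hG.card_quotient_of_isCoatom hp hM)
  let _ := IsCyclic.commGroup (α := G ⧸ M)
  rw [← QuotientGroup.eq, QuotientGroup.mk_mul, QuotientGroup.mk_mul]
  exact mul_comm _ _

/-- The quotient of a finite `p`-group by its Frattini subgroup is abelian. -/
abbrev commGroupQuotientFrattini [Finite G] (hp : p.Prime) (hG : IsPGroup p G) :
    CommGroup (G ⧸ frattini G) where
  mul_comm a b := by
    obtain ⟨a, rfl⟩ := QuotientGroup.mk_surjective a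
    obtain ⟨b, rfl⟩ := QuotientGroup.mk_surjective b
    exact QuotientGroup.eq.2 (hG.commutator_mem_frattini hp a b)

theorem pow_eq_one_quotient_frattini [Finite G] (hp : p.Prime) (hG : IsPGroup p G)
    (a : G ⧸ frattini G) : a ^ p = 1 := by
  obtain ⟨a, rfl⟩ := QuotientGroup.mk'_surjective _ a
  rw [← map_pow]
  exact (QuotientGroup.eq_one_iff _).2 (hG.pow_mem_frattini_s5 hp a)

theorem rank_le_rank_quotient_frattini [Finite G] :
    Group.rank G ≤ Group.rank (G ⧸ frattini G) := by
  classical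
  obtain ⟨S, hS, hcl⟩ := Group.rank_spec (G ⧸ frattini G)
  have htop : Subgroup.closure ((S.image Quotient.out : Finset G) : Set G) = ⊤ := by
    refine frattini_nongenerating ?_
    have hker : ∀ K : Subgroup G, K ⊔ frattini G =
        (K.map (QuotientGroup.mk' (frattini G))).comap (QuotientGroup.mk' (frattini G)) := by
      simp [Subgroup.comap_map_eq]
    rw [hker, MonoidHom.map_closure, Finset.coe_image, Set.image_image]
    simp [hcl]
  rw [← hS]
  exact (Group.rank_le htop).trans Finset.card_image_le

end IsPGroup

theorem CommGroup.rank_le_finrank {p : ℕ} [Fact p.Prime] {V : Type*} [CommGroup V] [Finite V]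
    [Module (ZMod p) (Additive V)] : Group.rank V ≤ Module.finrank (ZMod p) (Additive V) := by
  classical
  let b := Module.finBasis (ZMod p) (Additive V)
  have h : Subgroup.closure
      ((Finset.univ.image fun i => (b i).toMul : Finset V) : Set V) = ⊤ := by
    rw [eq_top_iff]
    intro v _
    have hs := b.sum_repr (Additive.ofMul v)
    rw [← toMul_ofMul v, ← hs, toMul_sum]
    refine Subgroup.prod_mem _ fun i _ => ?_
    have : (b.repr (Additive.ofMul v) i) • b i = (b.repr (Additive.ofMul v) i).val • b i := by
      rw [← Nat.cast_smul_eq_nsmul (ZMod p), ZMod.natCast_zmod_val]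
    rw [this, toMul_nsmul]
    exact Subgroup.pow_mem _ (Subgroup.subset_closure (by simp)) _
  refine (Group.rank_le h).trans (Finset.card_image_le.trans ?_)
  simp

theorem ZMod.natCard_eq_pow_finrank {p : ℕ} [Fact p.Prime] (V : Type*) [AddCommGroup V] [Finite V]
    [Module (ZMod p) V] : Nat.card V = p ^ Module.finrank (ZMod p) V := by
  rw [Module.natCard_eq_pow_finrank (K := ZMod p), Nat.card_zmod]

theorem ZMod.natCard_linearMap {p : ℕ} [Fact p.Prime] (V W : Type*) [AddCommGroup V] [Finite V]
    [Module (ZMod p) V] [AddCommGroup W] [Finite W] [Module (ZMod p) W] :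
    Nat.card (V →ₗ[ZMod p] W) =
      p ^ (Module.finrank (ZMod p) V * Module.finrank (ZMod p) W) := by
  have : Finite (V →ₗ[ZMod p] W) := Module.finite_of_finite (ZMod p)
  rw [ZMod.natCard_eq_pow_finrank (p := p), Module.finrank_linearMap]

theorem CommGroup.rank_le_of_card_eq_pow {p : ℕ} (hp : p.Prime) {V : Type*} [CommGroup V] [Finite V]
    (hV : ∀ v : V, v ^ p = 1) {a : ℕ} (ha : Nat.card V = p ^ a) : Group.rank V ≤ a := by
  have := Fact.mk hp
  let _ : Module (ZMod p) (Additive V) := AddCommGroup.zmodModule hV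
  have h := ZMod.natCard_eq_pow_finrank (p := p) (Additive V)
  rw [show Nat.card (Additive V) = Nat.card V from rfl, ha] at h
  rw [Nat.pow_right_injective hp.two_le h]
  exact CommGroup.rank_le_finrank

theorem CommGroup.card_monoidHom_eq_pow {p : ℕ} (hp : p.Prime) {V W : Type*} [CommGroup V]
    [Finite V] [CommGroup W] [Finite W] (hV : ∀ v : V, v ^ p = 1) (hW : ∀ w : W, w ^ p = 1)
    {a b : ℕ} (ha : Nat.card V = p ^ a) (hb : Nat.card W = p ^ b) :
    Nat.card (V →* W) = p ^ (a * b) := by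
  have := Fact.mk hp
  let _ : Module (ZMod p) (Additive V) := AddCommGroup.zmodModule hV
  let _ : Module (ZMod p) (Additive W) := AddCommGroup.zmodModule hW
  have h1 := ZMod.natCard_eq_pow_finrank (p := p) (Additive V)
  rw [show Nat.card (Additive V) = Nat.card V from rfl, ha] at h1
  have h2 := ZMod.natCard_eq_pow_finrank (p := p) (Additive W)
  rw [show Nat.card (Additive W) = Nat.card W from rfl, hb] at h2
  have h3 := ZMod.natCard_linearMap (p := p) (Additive V) (Additive W)
  rw [← Nat.pow_right_injective hp.two_le h1,
    ← Nat.pow_right_injective hp.two_le h2] at h3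
  rw [← h3]
  exact Nat.card_congr (MonoidHom.toAdditive.trans
    { toFun := AddMonoidHom.toZModLinearMap p
      invFun := LinearMap.toAddMonoidHom
      left_inv := fun _ => rfl
      right_inv := fun _ => rfl })

namespace IsPGroup

theorem rank_le_of_card_quotient_frattini {p : ℕ} {G : Type*} [Group G] [Finite G] (hp : p.Prime)
    (hG : IsPGroup p G) {a : ℕ} (ha : Nat.card (G ⧸ frattini G) = p ^ a) : Group.rank G ≤ a := by
  let _ := hG.commGroupQuotientFrattini hp
  exact rank_le_rank_quotient_frattini.trans
    (CommGroup.rank_le_of_card_eq_pow hp (hG.pow_eq_one_quotient_frattini hp) ha)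

theorem rank_le_of_card_ker_pow {p : ℕ} {A : Type*} [CommGroup A] [Finite A] (hp : p.Prime)
    (hA : IsPGroup p A) {b : ℕ} (hb : Nat.card (powMonoidHom p : A →* A).ker = p ^ b) :
    Group.rank A ≤ b := by
  have := Fact.mk hp
  obtain ⟨a, ha⟩ := iff_card.1 (hA.to_quotient (frattini A))
  refine (hA.rank_le_of_card_quotient_frattini hp ha).trans ?_
  have hle : (powMonoidHom p : A →* A).range ≤ frattini A := by
    rintro _ ⟨x, rfl⟩
    exact hA.pow_mem_frattini_s5 hp x
  have h1 : (frattini A).index ≤ (powMonoidHom p : A →* A).range.index :=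
    Nat.le_of_dvd (Nat.pos_of_ne_zero Subgroup.index_ne_zero_of_finite)
      (Subgroup.index_dvd_of_le hle)
  have h2 := (powMonoidHom p : A →* A).ker.card_mul_index
  rw [Subgroup.index_ker] at h2
  have h3 := (powMonoidHom p : A →* A).range.card_mul_index
  have h4 : (powMonoidHom p : A →* A).range.index = Nat.card (powMonoidHom p : A →* A).ker :=
    Nat.eq_of_mul_eq_mul_left Nat.card_pos (h3.trans (h2.symm.trans (mul_comm _ _)))
  rw [h4, hb, Subgroup.index_eq_card, ha] at h1
  exact (Nat.pow_le_pow_iff_right hp.one_lt).1 h1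

theorem pow_nilpotencyClass_le {p : ℕ} (hp : p.Prime) (G : Type*) [Group G]
    [Group.IsNilpotent G] : Finite G → IsPGroup p G → (¬ ∀ a b : G, a * b = b * a) →
    p ^ Group.nilpotencyClass G ≤ Nat.card (G ⧸ Subgroup.center G) := by
  have := Fact.mk hp
  refine Group.nilpotent_center_quotient_ind
    (P := fun G _ _ => Finite G → IsPGroup p G → (¬ ∀ a b : G, a * b = b * a) →
      p ^ Group.nilpotencyClass G ≤ Nat.card (G ⧸ Subgroup.center G)) G ?_ ?_
  · intro G _ _ _ _ h
    exact absurd (fun a b => Subsingleton.elim _ _) h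
  · intro G _ _ ih _ hG hna
    have hncyc : ¬ IsCyclic (G ⧸ Subgroup.center G) := fun h =>
      hna (MonoidHom.isMulCommutative_of_isCyclic_of_ker_le_center
        (QuotientGroup.mk' (Subgroup.center G)) (QuotientGroup.ker_mk' _).le).is_comm.comm
    have hnt : Nontrivial (G ⧸ Subgroup.center G) := by
      by_contra h
      have := not_nontrivial_iff_subsingleton.1 h
      exact hncyc inferInstance
    have hntG : Nontrivial G := (QuotientGroup.mk'_surjective (Subgroup.center G)).nontrivial
    have hQ := hG.to_quotient (Subgroup.center G)
    rw [Group.nilpotencyClass_eq_quotient_center_plus_one]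
    by_cases hc : ∀ a b : G ⧸ Subgroup.center G, a * b = b * a
    · let _ : CommGroup (G ⧸ Subgroup.center G) := { mul_comm := hc }
      have h1 := CommGroup.nilpotencyClass_le_one (G := G ⧸ Subgroup.center G)
      obtain ⟨k, hk⟩ := iff_card.1 hQ
      rw [hk]
      refine Nat.pow_le_pow_right hp.pos ?_
      by_contra! hlt
      have : k ≤ 1 := by omega
      interval_cases k
      · rw [pow_zero] at hk
        have := (Nat.card_eq_one_iff_unique.1 hk).1
        exact hncyc inferInstance
      · rw [pow_one] at hk
        exact hncyc (isCyclic_of_prime_card hk)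
    · have h1 := ih inferInstance hQ hc
      rw [pow_succ',
        (Subgroup.center (G ⧸ Subgroup.center G)).card_eq_card_quotient_mul_card_subgroup,
        mul_comm (Nat.card ((G ⧸ Subgroup.center G) ⧸ _))]
      refine Nat.mul_le_mul ?_ h1
      obtain ⟨k, hk, hcard⟩ := (nontrivial_iff_card (hQ.to_subgroup _)).1 hQ.center_nontrivial
      rw [hcard]
      exact Nat.le_self_pow hk.ne' p

end IsPGroup

namespace MulAut

variable {G : Type*} [Group G]

/-- The automorphism `x ↦ x * s x` attached to a map `s` invariant under right translation by its
own values. -/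
def ofMulRight (s : G → G) (hmul : ∀ x y, x * y * s (x * y) = x * s x * (y * s y))
    (hs : ∀ x y, s (x * s y) = s x) : MulAut G where
  toFun x := x * s x
  invFun x := x * (s x)⁻¹
  left_inv x := by simp [hs]
  right_inv x := by
    have h : s (x * (s x)⁻¹) = s x := by simpa using (hs (x * (s x)⁻¹) x).symm
    simp [h]
  map_mul' := hmul

variable (s : G → G) (hmul : ∀ x y, x * y * s (x * y) = x * s x * (y * s y))
    (hs : ∀ x y, s (x * s y) = s x)

@[simp]
theorem ofMulRight_apply (x : G) : ofMulRight s hmul hs x = x * s x := rfl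

theorem ofMulRight_pow_apply (n : ℕ) (x : G) : (ofMulRight s hmul hs ^ n) x = x * s x ^ n := by
  induction n generalizing x with
  | zero => simp
  | succ n ih => rw [pow_succ, MulAut.mul_apply, ih, ofMulRight_apply, hs, mul_assoc, pow_succ']

theorem orderOf_ofMulRight {p : ℕ} (hp : p.Prime) (hsp : ∀ x, s x ^ p = 1) (h1 : ∃ x, s x ≠ 1) :
    orderOf (ofMulRight s hmul hs) = p := by
  have := Fact.mk hp
  refine orderOf_eq_prime (MulEquiv.ext fun x => ?_) fun h => ?_
  · rw [ofMulRight_pow_apply, hsp, mul_one, MulAut.one_apply]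
  · obtain ⟨x, hx⟩ := h1
    exact hx (by simpa using DFunLike.congr_fun h x)

end MulAut

namespace IsPGroup

open Subgroup

open scoped IsMulCommutative

variable {p : ℕ} {G : Type*} [Group G]

theorem exists_orderOf_eq_mem_center_of_isCoatom [Finite G] (hp : p.Prime) (hG : IsPGroup p G)
    {M : Subgroup G} (hM : IsCoatom M) (hbot : M ≠ ⊥) {g : G} (hg : g ∈ center G) (hgM : g ∉ M) :
    ∃ z ∈ center G, z ∈ M ∧ orderOf z = p := by
  have := Fact.mk hp
  have : Nontrivial M := (nontrivial_iff_ne_bot M).2 hbot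
  have hMp := hG.to_subgroup M
  obtain ⟨k, hk, hcard⟩ := (nontrivial_iff_card (hMp.to_subgroup (center M))).1
    hMp.center_nontrivial
  obtain ⟨w, hw⟩ := exists_prime_orderOf_dvd_card' (G := center M) p
    (hcard ▸ dvd_pow_self p hk.ne')
  refine ⟨w, ?_, w.1.2, by rw [orderOf_coe, orderOf_coe, hw]⟩
  have hle : M ≤ centralizer {(w : G)} := fun x hx => mem_centralizer_singleton_iff.2
    (congrArg Subtype.val (mem_center_iff.1 w.2 ⟨x, hx⟩))
  rcases hM.le_iff.1 hle with h | h
  · exact centralizer_eq_top_iff_subset.1 h rfl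
  · exact absurd (h ▸ mem_centralizer_singleton_iff.2 (mem_center_iff.1 hg _).symm) hgM

theorem center_le_frattini [Finite G] (hp : p.Prime) (hG : IsPGroup p G)
    (hna : ¬ ∀ a b : G, a * b = b * a)
    (hinner : ∀ α : MulAut G, orderOf α = p → (∀ x ∈ frattini G, α x = x) →
      ∃ h : G, ∀ x : G, α x = h⁻¹ * x * h) : center G ≤ frattini G := by
  have := Fact.mk hp
  intro g hg
  refine mem_frattini_of_forall fun M hM => ?_
  by_contra hgM
  have := hG.normal_of_isCoatom_s5 hp hM
  have hbot : M ≠ ⊥ := by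
    rintro rfl
    refine hna fun a b => ?_
    rcases hM.le_iff.1 (bot_le (a := center G)) with h | h
    · exact mem_center_iff.1 (h ▸ mem_top b) a
    · exact absurd (h ▸ hg) hgM
  obtain ⟨z, hzc, hzM, hz⟩ := hG.exists_orderOf_eq_mem_center_of_isCoatom hp hM hbot hg hgM
  let e : G ⧸ M ≃* zpowers z :=
    mulEquivOfPrimeCardEq (hG.card_quotient_of_isCoatom hp hM) (by rw [Nat.card_zpowers, hz])
  let f : G →* G := (zpowers z).subtype.comp (e.toMonoidHom.comp (QuotientGroup.mk' M))
  have hfz : ∀ x, f x ∈ zpowers z := fun x => (e (x : G ⧸ M)).2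
  have hfc : ∀ x, f x ∈ center G := fun x => (zpowers_le.2 hzc) (hfz x)
  have hf1 : ∀ x, f x = 1 ↔ x ∈ M := fun x => by
    rw [← QuotientGroup.eq_one_iff, ← map_eq_one_iff e e.injective, ← OneMemClass.coe_eq_one]
    rfl
  have hff : ∀ x, f (f x) = 1 := fun x => (hf1 _).2 ((zpowers_le.2 hzM) (hfz x))
  have hmul : ∀ x y, x * y * f (x * y) = x * f x * (y * f y) := fun x y => by
    rw [map_mul, mul_assoc x (f x), ← mul_assoc (f x) y, ← mem_center_iff.1 (hfc x) y]
    group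
  have hs : ∀ x y, f (x * f y) = f x := fun x y => by rw [map_mul, hff, mul_one]
  obtain ⟨h, hh⟩ := hinner (MulAut.ofMulRight f hmul hs)
    (MulAut.orderOf_ofMulRight f hmul hs hp (fun x => by
      obtain ⟨k, hk⟩ := mem_zpowers_iff.1 (hfz x)
      rw [← hk, ← zpow_natCast, zpow_comm, zpow_natCast, ← hz, pow_orderOf_eq_one, one_zpow])
      ⟨g, fun h => hgM ((hf1 g).1 h)⟩)
    (fun x hx => by
      rw [MulAut.ofMulRight_apply, (hf1 x).2 (frattini_le_coatom hM hx), mul_one])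
  refine hgM ((hf1 g).1 ?_)
  have := hh g
  rw [MulAut.ofMulRight_apply, mem_center_iff.1 hg h⁻¹, inv_mul_cancel_right] at this
  simpa using this

/-- Homomorphisms `f` from `G ⧸ Φ(G)` to the elements of `Z(G)` killed by `p` give rise to the
automorphisms `x ↦ x * f x`. -/
theorem exists_conj_eq_mul_monoidHom (hp : p.Prime) (hZ : center G ≤ frattini G)
    (hinner : ∀ α : MulAut G, orderOf α = p → (∀ x ∈ frattini G, α x = x) →
      ∃ h : G, ∀ x : G, α x = h⁻¹ * x * h)
    (f : G ⧸ frattini G →* (powMonoidHom p : center G →* center G).ker) :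
    ∃ h : G, ∀ x : G, x * (f (x : G ⧸ frattini G) : center G) = h⁻¹ * x * h := by
  by_cases hf : ∀ x : G, f (x : G ⧸ frattini G) = 1
  · exact ⟨1, fun x => by simp [hf]⟩
  push Not at hf
  let s : G → G := fun x => (f (x : G ⧸ frattini G) : center G)
  have hsc : ∀ x, s x ∈ center G := fun x => (f (x : G ⧸ frattini G) : center G).2
  have hmul : ∀ x y, x * y * s (x * y) = x * s x * (y * s y) := fun x y => by
    have h1 : s (x * y) = s x * s y := by simp [s]
    rw [h1, mul_assoc x (s x), ← mul_assoc (s x) y, ← mem_center_iff.1 (hsc x) y]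
    group
  have hs : ∀ x y, s (x * s y) = s x := fun x y => by
    have : ((s y : G) : G ⧸ frattini G) = 1 := (QuotientGroup.eq_one_iff _).2 (hZ (hsc y))
    simp only [s] at this ⊢
    rw [QuotientGroup.mk_mul, this, mul_one]
  refine hinner (MulAut.ofMulRight s hmul hs) (MulAut.orderOf_ofMulRight s hmul hs hp
    (fun x => ?_) ?_) fun x hx => ?_
  · have := (f (x : G ⧸ frattini G)).2
    rw [MonoidHom.mem_ker, powMonoidHom_apply] at this
    simpa [s] using congrArg Subtype.val this
  · obtain ⟨x, hx⟩ := hf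
    exact ⟨x, fun h => hx (Subtype.ext (Subtype.ext h))⟩
  · simp [s, (QuotientGroup.eq_one_iff x).2 hx]

theorem exists_injective_monoidHom_center_quotient (hp : p.Prime) (hZ : center G ≤ frattini G)
    (hinner : ∀ α : MulAut G, orderOf α = p → (∀ x ∈ frattini G, α x = x) →
      ∃ h : G, ∀ x : G, α x = h⁻¹ * x * h) :
    ∃ t : (G ⧸ frattini G →* (powMonoidHom p : center G →* center G).ker) →
        center (G ⧸ center G),
      Function.Injective t ∧
        ∀ f (g : G), (t f : G ⧸ center G) = g → ∀ x ∈ frattini G, g * x = x * g := by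
  choose t ht using exists_conj_eq_mul_monoidHom hp hZ hinner
  refine ⟨fun f => ⟨(t f : G ⧸ center G), mem_center_iff.2 fun x => ?_⟩, fun f f' hff => ?_,
    fun f g hg x hx => ?_⟩
  · obtain ⟨x, rfl⟩ := QuotientGroup.mk_surjective x
    refine (QuotientGroup.eq.2 ?_).symm
    have : (t f * x)⁻¹ * (x * t f) = (f (x : G ⧸ frattini G) : center G) := by
      rw [← mul_right_inj x, ht]
      group
    rw [this]
    exact (f (x : G ⧸ frattini G) : center G).2
  · have hc := mem_center_iff.1 (QuotientGroup.eq.1 (congrArg Subtype.val hff))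
    refine MonoidHom.ext fun x => ?_
    obtain ⟨x, rfl⟩ := QuotientGroup.mk_surjective x
    refine Subtype.ext (Subtype.ext (mul_left_cancel (a := x) ?_))
    rw [ht, ht]
    obtain ⟨w, hw⟩ : ∃ w, w = (t f)⁻¹ * t f' := ⟨_, rfl⟩
    rw [← hw] at hc
    rw [eq_inv_mul_iff_mul_eq.1 hw.symm.symm |>.symm, ← mul_assoc, hc]
    group
  · have hc := mem_center_iff.1 (QuotientGroup.eq.1 hg)
    have h1 := ht f x
    rw [(QuotientGroup.eq_one_iff x).2 hx, map_one, OneMemClass.coe_one, OneMemClass.coe_one,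
      mul_one] at h1
    have h2 : t f * x = x * t f := by
      nth_rewrite 1 [h1]
      group
    have h3 : g = t f * ((t f)⁻¹ * g) := by group
    rw [h3, mul_assoc, ← hc x, ← mul_assoc, h2, mul_assoc]

end IsPGroup

theorem mul_pow_eq_pow_mul_pow_mul_pow_choose_two {G : Type*} [Group G] {x y c : G}
    (hc : c ∈ Subgroup.center G) (h : y * x = x * y * c) (n : ℕ) :
    (x * y) ^ n = x ^ n * y ^ n * c ^ n.choose 2 := by
  have hcn : ∀ (k : ℕ) (g : G), c ^ k * g = g * c ^ k := fun k g =>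
    (Subgroup.mem_center_iff.1 (pow_mem hc k) g).symm
  have hx : ∀ k : ℕ, y * x ^ k = x ^ k * y * c ^ k := fun k => by
    induction k with
    | zero => simp
    | succ k ih =>
      rw [pow_succ x, ← mul_assoc, ih, mul_assoc, hcn, ← mul_assoc, mul_assoc (x ^ k) y x, h,
        pow_succ' c]
      simp only [mul_assoc]
  induction n with
  | zero => simp
  | succ n ih =>
    rw [pow_succ' (x * y), ih, Nat.choose_succ_succ' n 1, Nat.choose_one_right, pow_add c]
    calc x * y * (x ^ n * y ^ n * c ^ n.choose 2)
        = x * (y * x ^ n) * y ^ n * c ^ n.choose 2 := by simp only [mul_assoc]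
      _ = x * (x ^ n * y * (c ^ n * y ^ n)) * c ^ n.choose 2 := by
        rw [hx]; simp only [mul_assoc]
      _ = x ^ (n + 1) * y ^ (n + 1) * (c ^ n * c ^ n.choose 2) := by
        rw [hcn, pow_succ' x, pow_succ' y]; simp only [mul_assoc]

theorem pow_val_add {G : Type*} [Monoid G] {p : ℕ} [NeZero p] {g : G} (hg : g ^ p = 1)
    (i j : ZMod p) : g ^ (i + j).val = g ^ i.val * g ^ j.val := by
  rw [ZMod.val_add, ← pow_add, ← pow_eq_pow_mod _ hg]

namespace Subgroup

variable {p : ℕ} {G : Type*} [Group G]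

theorem exists_notMem_center_pow_eq_one (hp : p.Prime) (hodd : p ≠ 2)
    (hcard : Nat.card (center G) = p) (hpow : ∀ x : G, x ^ p ∈ center G)
    (hcomm : ∀ x y : G, (x * y)⁻¹ * (y * x) ∈ center G) (hna : ¬ ∀ a b : G, a * b = b * a) :
    ∃ u : G, u ∉ center G ∧ u ^ p = 1 := by
  have := Fact.mk hp
  push Not at hna
  obtain ⟨a, b, hab⟩ := hna
  have hcp : ∀ c ∈ center G, c ^ p = 1 := fun c hc => by
    have := pow_card_eq_one' (x := (⟨c, hc⟩ : center G))
    rw [hcard] at this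
    exact congrArg Subtype.val this
  by_cases ha : a ^ p = 1
  · exact ⟨a, fun h => hab (mem_center_iff.1 h b).symm, ha⟩
  obtain ⟨k, hk⟩ : ∃ k : ℕ, (⟨a ^ p, hpow a⟩ : center G) ^ k = ⟨b ^ p, hpow b⟩ :=
    mem_powers_of_prime_card hcard (by simpa [Subtype.ext_iff] using ha)
  have hk' : (a ^ p) ^ k = b ^ p := congrArg Subtype.val hk
  refine ⟨(a ^ k)⁻¹ * b, fun h => hab ?_, ?_⟩
  · have h1 := mem_center_iff.1 h a
    have h2 : a ^ k * (a * ((a ^ k)⁻¹ * b)) = a * b := by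
      rw [← mul_assoc, ← mul_assoc, ← pow_succ, pow_succ', mul_inv_cancel_right]
    rw [← h2, h1]
    group
  · rw [mul_pow_eq_pow_mul_pow_mul_pow_choose_two (hcomm (a ^ k)⁻¹ b) (by group), inv_pow,
      ← pow_mul, mul_comm k p, pow_mul, hk', inv_mul_cancel, one_mul]
    obtain ⟨m, hm⟩ := hp.dvd_choose_self (k := 2) two_ne_zero
      (lt_of_le_of_ne hp.two_le hodd.symm)
    rw [hm, pow_mul, hcp _ (hcomm _ _), one_pow]

theorem commutative_of_card_center_of_ne_two (hp : p.Prime) (hodd : p ≠ 2)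
    (hcard : Nat.card (center G) = p) (hpow : ∀ x : G, x ^ p ∈ center G)
    (hcomm : ∀ x y : G, (x * y)⁻¹ * (y * x) ∈ center G)
    (hinner : ∀ α : MulAut G, orderOf α = p → (∀ x ∈ center G, α x = x) →
      ∃ h : G, ∀ x : G, α x = h⁻¹ * x * h) : ∀ a b : G, a * b = b * a := by
  have := Fact.mk hp
  by_contra hna
  obtain ⟨u, huc, hup⟩ := exists_notMem_center_pow_eq_one hp hodd hcard hpow hcomm hna
  obtain ⟨y, hy⟩ : ∃ y, y * u ≠ u * y := by simpa [mem_center_iff] using huc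
  obtain ⟨z, hz⟩ : ∃ z, z = (u * y)⁻¹ * (y * u) := ⟨_, rfl⟩
  have hzc : z ∈ center G := hz ▸ hcomm u y
  have hz1 : z ≠ 1 := fun h => hy (inv_mul_eq_one.1 (hz ▸ h)).symm
  have hzp : z ^ p = 1 := by
    have := pow_card_eq_one' (x := (⟨z, hzc⟩ : center G))
    rw [hcard] at this
    exact congrArg Subtype.val this
  have hzo : orderOf z = p := orderOf_eq_prime hzp hz1
  have hzn : ∀ (n : ℕ) (g : G), z ^ n * g = g * z ^ n := fun n g =>
    (mem_center_iff.1 (pow_mem hzc n) g).symm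
  have hinj : ∀ i j : ZMod p, z ^ i.val = z ^ j.val → i = j := fun i j h => by
    rw [pow_inj_mod, hzo, Nat.mod_eq_of_lt (ZMod.val_lt i), Nat.mod_eq_of_lt (ZMod.val_lt j)] at h
    exact ZMod.val_injective p h
  have hex : ∀ x, ∃ k : ZMod p, x * u = u * x * z ^ k.val := fun x => by
    obtain ⟨m, hm⟩ : ∃ m : ℕ, (⟨z, hzc⟩ : center G) ^ m = ⟨_, hcomm u x⟩ :=
      mem_powers_of_prime_card hcard (by simpa [Subtype.ext_iff] using hz1)
    refine ⟨m, ?_⟩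
    have hm' : z ^ m = (u * x)⁻¹ * (x * u) := congrArg Subtype.val hm
    rw [ZMod.val_natCast, ← pow_eq_pow_mod _ hzp, hm']
    group
  choose k hk using hex
  have hkeq : ∀ x (i : ZMod p), x * u = u * x * z ^ i.val → k x = i := fun x i h =>
    hinj _ _ (mul_left_cancel ((hk x).symm.trans h))
  have hkmul : ∀ x w, k (x * w) = k x + k w := fun x w => hkeq _ _ <| by
    rw [mul_assoc, hk, ← mul_assoc, ← mul_assoc, hk, pow_val_add hzp, mul_assoc (u * x), hzn]
    simp only [mul_assoc]
  have hkc : ∀ x ∈ center G, k x = 0 := fun x hx => hkeq _ _ <| by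
    rw [ZMod.val_zero, pow_zero, mul_one, mem_center_iff.1 hx]
  have hku : k u = 0 := hkeq _ _ (by simp)
  have hky : k y = 1 := hkeq _ _ <| by
    rw [ZMod.val_one, pow_one, hz]
    group
  have hkpow : ∀ w, k w = 0 → ∀ n : ℕ, k (w ^ n) = 0 := fun w hw n => by
    induction n with
    | zero => exact hkc _ (by rw [pow_zero]; exact one_mem _)
    | succ n ih => rw [pow_succ, hkmul, ih, hw, add_zero]
  have hupow : ∀ x (n : ℕ), x * u ^ n = u ^ n * x * z ^ ((k x).val * n) := fun x n => by
    induction n with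
    | zero => simp
    | succ n ih =>
      rw [pow_succ, ← mul_assoc, ih, mul_assoc, hzn, ← mul_assoc, mul_assoc _ x u, hk,
        mul_add, add_comm ((k x).val * n), pow_add, mul_one]
      simp only [mul_assoc]
  have hupow' : ∀ x w, w * u ^ (k x).val = u ^ (k x).val * w * z ^ (k w * k x).val := fun x w => by
    rw [hupow, ZMod.val_mul, ← pow_eq_pow_mod _ hzp]
  have h2 : (2 : ZMod p) ≠ 0 := by
    intro h
    have : ((2 : ℕ) : ZMod p) = 0 := by exact_mod_cast h
    rw [ZMod.natCast_eq_zero_iff] at this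
    exact hodd ((Nat.prime_dvd_prime_iff_eq hp Nat.prime_two).1 this)
  let q : ZMod p → ZMod p := fun i => -(i ^ 2 / 2)
  have hq : ∀ i j : ZMod p, j * i + q (i + j) = q i + q j := fun i j => by
    simp only [q]
    field_simp
    ring
  let s : G → G := fun x => u ^ (k x).val * z ^ (q (k x)).val
  have hks : ∀ x, k (s x) = 0 := fun x => by
    rw [hkmul, hkpow u hku, hkpow z (hkc z hzc), add_zero]
  have hmul : ∀ x w, x * w * s (x * w) = x * s x * (w * s w) := fun x w => by
    simp only [s]
    calc x * w * (u ^ (k (x * w)).val * z ^ (q (k (x * w))).val)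
        = x * (w * u ^ (k x).val) * u ^ (k w).val * z ^ (q (k x + k w)).val := by
          rw [hkmul, pow_val_add hup]; simp only [mul_assoc]
      _ = x * u ^ (k x).val * w * (z ^ (k w * k x).val * u ^ (k w).val) *
            z ^ (q (k x + k w)).val := by
          rw [hupow' x w]; simp only [mul_assoc]
      _ = x * u ^ (k x).val * w * u ^ (k w).val * (z ^ (k w * k x + q (k x + k w)).val) := by
          rw [hzn, pow_val_add hzp]; simp only [mul_assoc]
      _ = x * u ^ (k x).val * (w * u ^ (k w).val * z ^ (q (k x)).val) * z ^ (q (k w)).val := by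
          rw [hq, pow_val_add hzp]; simp only [mul_assoc]
      _ = _ := by rw [← hzn _ (w * u ^ (k w).val)]; simp only [mul_assoc]
  have hs : ∀ x w, s (x * s w) = s x := fun x w => by
    have : k (x * s w) = k x := by rw [hkmul, hks, add_zero]
    simp only [s] at this ⊢
    rw [this]
  have hsy : s y = u * z ^ (q 1).val := by
    simp only [s]
    rw [hky, ZMod.val_one, pow_one]
  have hsyc : s y ∉ center G := fun h => huc <| by
    rw [hsy] at h
    exact (mul_mem_cancel_right (pow_mem hzc _)).1 h
  obtain ⟨h, hh⟩ := hinner (MulAut.ofMulRight s hmul hs)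
    (MulAut.orderOf_ofMulRight s hmul hs hp (fun x => by
      rw [(show Commute (u ^ (k x).val) (z ^ (q (k x)).val) from (hzn _ _).symm).mul_pow,
        pow_right_comm, hup, pow_right_comm z, hzp, one_pow, one_pow, one_mul])
      ⟨y, fun h => hsyc (h ▸ one_mem _)⟩)
    (fun x hx => by simp [s, q, hkc x hx])
  refine hsyc ?_
  have h3 := hh y
  rw [MulAut.ofMulRight_apply, ← eq_inv_mul_iff_mul_eq] at h3
  rw [h3]
  convert hcomm h y using 1
  group

theorem commutative_of_card_center_eq_two (hcard : Nat.card (center G) = 2)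
    (hpow : ∀ x : G, x ^ 2 ∈ center G)
    (hcomm : ∀ x y : G, (x * y)⁻¹ * (y * x) ∈ center G)
    (hinner : ∀ α : MulAut G, orderOf α = 2 → (∀ x ∈ center G, α x = x) →
      ∃ h : G, ∀ x : G, α x = h⁻¹ * x * h) : ∀ a b : G, a * b = b * a := by
  classical
  by_contra hna
  have heq : ∀ a ∈ center G, ∀ b ∈ center G, a ≠ 1 → b ≠ 1 → a = b := fun a ha b hb ha1 hb1 => by
    obtain ⟨m, hm⟩ : ∃ m : ℕ, (⟨b, hb⟩ : center G) ^ m = ⟨a, ha⟩ :=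
      mem_powers_of_prime_card (hp := ⟨Nat.prime_two⟩) hcard (by simpa [Subtype.ext_iff] using hb1)
    have hb2 := pow_card_eq_one' (x := (⟨b, hb⟩ : center G))
    rw [hcard] at hb2
    rw [pow_eq_pow_mod _ hb2] at hm
    have hm' : b ^ (m % 2) = a := congrArg Subtype.val hm
    rcases Nat.mod_two_eq_zero_or_one m with h | h <;> rw [h] at hm'
    · exact absurd (hm'.symm.trans (pow_zero b)) ha1
    · rw [← hm', pow_one]
  obtain ⟨u, huc, hu2⟩ : ∃ u : G, u ∉ center G ∧ u * u ≠ 1 := by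
    push Not at hna
    obtain ⟨a, b, hab⟩ := hna
    by_contra! h
    have ha : a * a = 1 := h a fun h => hab (mem_center_iff.1 h b).symm
    have hb : b * b = 1 := h b fun h => hab (mem_center_iff.1 h a)
    have hc : a * b * (a * b) = 1 := h (a * b) fun h => hab <| by
      have := mem_center_iff.1 h a
      rw [mul_assoc] at this
      exact mul_left_cancel this
    refine hab ?_
    calc a * b = a * (a * b * (a * b)) * b := by rw [hc, mul_one]
      _ = (a * a) * (b * a) * (b * b) := by simp only [mul_assoc]
      _ = b * a := by rw [ha, hb, one_mul, mul_one]
  have hu2c : u * u ∈ center G := by rw [← sq]; exact hpow u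
  have hu4 : u * u * (u * u) = 1 := by
    have := pow_card_eq_one' (x := (⟨u * u, hu2c⟩ : center G))
    rw [hcard, sq] at this
    exact congrArg Subtype.val this
  have hu2n := fun g => mem_center_iff.1 hu2c g
  have hyu : ∀ y, ¬ Commute y u → y * u = u * y * (u * u) := fun y hy => by
    rw [← heq _ (hcomm u y) _ hu2c (fun h => hy (inv_mul_eq_one.1 h).symm) hu2]
    group
  have huyu : ∀ y, ¬ Commute y u → u * y * u = y := fun y hy => by
    calc u * y * u = u * u * (y * (u * u)) := by
          rw [mul_assoc, hyu y hy]; simp only [mul_assoc]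
      _ = y := by rw [hu2n, ← mul_assoc, hu4, one_mul]
  let s : G → G := fun x => if Commute x u then 1 else u
  have hs1 : ∀ x, Commute x u → s x = 1 := fun x hx => if_pos hx
  have hsu : ∀ x, ¬ Commute x u → s x = u := fun x hx => if_neg hx
  have hscomm : ∀ x, Commute (s x) u := fun x => by
    by_cases hx : Commute x u
    · rw [hs1 x hx]; exact Commute.one_left u
    · rw [hsu x hx]
  have hmul : ∀ x y, x * y * s (x * y) = x * s x * (y * s y) := fun x y => by
    by_cases hx : Commute x u <;> by_cases hy : Commute y u
    · rw [hs1 x hx, hs1 y hy, hs1 _ (hx.mul_left hy)]; simp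
    · have : ¬ Commute (x * y) u := fun h => hy (by simpa using hx.inv_left.mul_left h)
      rw [hs1 x hx, hsu y hy, hsu _ this]; simp [mul_assoc]
    · have : ¬ Commute (x * y) u := fun h => hx (by simpa using h.mul_left hy.inv_left)
      rw [hsu x hx, hs1 y hy, hsu _ this, mul_assoc, hy.eq]; simp [mul_assoc]
    · have : Commute (x * y) u := by
        change x * y * u = u * (x * y)
        conv_lhs => rw [← huyu x hx]
        rw [mul_assoc _ y u, mul_assoc _ u (y * u), ← mul_assoc u y u, huyu y hy, mul_assoc]
      rw [hsu x hx, hsu y hy, hs1 _ this, mul_assoc x u, ← mul_assoc u y u, huyu y hy, mul_one]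
  have hs : ∀ x y, s (x * s y) = s x := fun x y => by
    by_cases hx : Commute x u
    · rw [hs1 x hx, hs1 _ (hx.mul_left (hscomm y))]
    · rw [hsu x hx, hsu]
      exact fun h => hx (by simpa using h.mul_left (hscomm y).inv_left)
  obtain ⟨g, hg⟩ : ∃ g, ¬ Commute g u := by
    simpa [mem_center_iff, commute_iff_eq] using huc
  let α := MulAut.ofMulRight s hmul hs
  have hαg : α g = g * u := by rw [MulAut.ofMulRight_apply, hsu g hg]
  have hαα : ∀ x, α (α x) = u * x * u⁻¹ := fun x => by
    rw [MulAut.ofMulRight_apply, MulAut.ofMulRight_apply, hs]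
    by_cases hx : Commute x u
    · rw [hs1 x hx, ← hx.eq]; simp
    · rw [hsu x hx, eq_mul_inv_iff_mul_eq, mul_assoc (x * u), hyu x hx, mul_assoc (u * x), hu4,
        mul_one]
  let β := MulAut.conj g * α
  have hββ : β ^ 2 = 1 := by
    ext x
    have hc : g * (g * u) * u ∈ center G := by
      have : g * (g * u) * u = g ^ 2 * (u * u) := by rw [sq]; simp only [mul_assoc]
      rw [this]
      exact mul_mem (hpow g) hu2c
    calc (β ^ 2) x = g * α (g * α x * g⁻¹) * g⁻¹ := by
          rw [sq]; rfl
      _ = (g * (g * u) * u) * x * (g * (g * u) * u)⁻¹ := by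
          rw [map_mul, map_mul, map_inv, hαα, hαg]; group
      _ = x := by rw [← mem_center_iff.1 hc x, mul_inv_cancel_right]
  have hin : ∃ h : G, ∀ x : G, β x = h⁻¹ * x * h := by
    by_cases h1 : β = 1
    · exact ⟨1, fun x => by simp [h1]⟩
    · have := Fact.mk Nat.prime_two
      refine hinner β (orderOf_eq_prime hββ h1) fun x hx => ?_
      change g * (x * s x) * g⁻¹ = x
      rw [hs1 x (mem_center_iff.1 hx u).symm, mul_one, mem_center_iff.1 hx g, mul_inv_cancel_right]
  obtain ⟨h, hh⟩ := hin
  have h3 : g * (g * u) * g⁻¹ = h⁻¹ * g * h := by rw [← hh g, ← hαg]; rfl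
  refine huc ?_
  have h4 : u = (h * g * g)⁻¹ * (g * (h * g)) := by
    calc u = g⁻¹ * g⁻¹ * (g * (g * u) * g⁻¹) * g := by group
      _ = _ := by rw [h3]; group
  rw [h4]
  exact hcomm (h * g) g

end Subgroup

open Subgroup in
open scoped IsMulCommutative in

/-- Let `G` be a finite non-abelian `p`-group of coclass `c` (i.e.
`|G| = p ^ n`, `n > 2`, of nilpotency class `n - c`). If every order-`p`
automorphism of `G` fixing `Φ(G)` elementwise is inner, then
`d(Z(G)) * (d(G) + 1) ≤ c + 1`. -/
theorem stmt5 {p : ℕ} (hp : p.Prime) (G : Type*) [Group G] [Finite G]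
    [Group.IsNilpotent G] (hpG : IsPGroup p G) (hna : ¬ ∀ a b : G, a * b = b * a)
    {n c : ℕ} (hn : 2 < n) (hcard : Nat.card G = p ^ n)
    (hclass : Group.nilpotencyClass G = n - c)
    (hinner : ∀ α : MulAut G, orderOf α = p → (∀ x ∈ frattini G, α x = x) →
      ∃ h : G, ∀ x : G, α x = h⁻¹ * x * h) :
    Group.rank (Subgroup.center G) * (Group.rank G + 1) ≤ c + 1 := by
  have := Fact.mk hp
  have hZ := hpG.center_le_frattini hp hna hinner
  obtain ⟨a, ha⟩ := IsPGroup.iff_card.1 (hpG.to_quotient (frattini G))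
  have hE := (hpG.to_subgroup (center G)).to_subgroup
    (powMonoidHom p : center G →* center G).ker
  obtain ⟨b, hb⟩ := IsPGroup.iff_card.1 hE
  have hra := hpG.rank_le_of_card_quotient_frattini hp ha
  have hrb : Group.rank (center G) ≤ b :=
    (hpG.to_subgroup (center G)).rank_le_of_card_ker_pow hp hb
  refine (Nat.mul_le_mul hrb (Nat.add_le_add_right hra 1)).trans ?_
  obtain ⟨t, htinj, ht⟩ := IsPGroup.exists_injective_monoidHom_center_quotient hp hZ hinner
  let _ := hpG.commGroupQuotientFrattini hp
  have hhom : Nat.card (G ⧸ frattini G →* (powMonoidHom p : center G →* center G).ker) =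
      p ^ (a * b) :=
    CommGroup.card_monoidHom_eq_pow hp (hpG.pow_eq_one_quotient_frattini hp)
      (fun w => Subtype.ext w.2) ha hb
  have hZQ : p ^ (a * b) ≤ Nat.card (center (G ⧸ center G)) :=
    hhom ▸ Nat.card_le_card_of_injective t htinj
  have hbZ : p ^ b ≤ Nat.card (center G) := hb ▸ Subgroup.card_le_card_group _
  have hGcard := (center G).card_eq_card_quotient_mul_card_subgroup
  have hQcard := (center (G ⧸ center G)).card_eq_card_quotient_mul_card_subgroup
  have hnt : Nontrivial G := by
    by_contra h
    have := not_nontrivial_iff_subsingleton.1 h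
    exact hna fun a b => Subsingleton.elim _ _
  have hcl := Group.nilpotencyClass_eq_quotient_center_plus_one (G := G)
  have key : ∀ m, p ^ m ≤ p ^ n → m ≤ n := fun m => (Nat.pow_le_pow_iff_right hp.one_lt).1
  by_cases hQ : ∀ x y : G ⧸ center G, x * y = y * x
  · have hQ1 : Group.nilpotencyClass (G ⧸ center G) ≤ 1 := by
      let _ : CommGroup (G ⧸ center G) := { mul_comm := hQ }
      exact CommGroup.nilpotencyClass_le_one
    have hle : p ^ (a * b) ≤ Nat.card (G ⧸ center G) :=
      hZQ.trans (Subgroup.card_le_card_group _)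
    have h1 : b * (a + 1) ≤ n := key _ <| by
      rw [← hcard, hGcard, mul_add, mul_one, pow_add, mul_comm b a]
      exact Nat.mul_le_mul hle hbZ
    suffices b * (a + 1) ≠ n by omega
    intro h2
    have hprod : Nat.card (G ⧸ center G) * Nat.card (center G) = p ^ (a * b) * p ^ b := by
      rw [← hGcard, hcard, ← h2, mul_add, mul_one, pow_add, mul_comm b a]
    have hcQ : Nat.card (G ⧸ center G) = p ^ (a * b) := by
      refine le_antisymm ?_ hle
      by_contra! hlt
      exact absurd hprod (Nat.mul_lt_mul_of_lt_of_le hlt hbZ Nat.card_pos).ne'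
    have hcZ : Nat.card (center G) = p ^ b := by
      rw [hcQ] at hprod
      exact Nat.eq_of_mul_eq_mul_left (pow_pos hp.pos _) hprod
    have hsurj : Function.Surjective t := by
      refine ((Nat.bijective_iff_injective_and_card t).2 ⟨htinj, ?_⟩).2
      rw [hhom]
      exact le_antisymm hZQ ((Subgroup.card_le_card_group _).trans hcQ.le)
    have hΦ : frattini G ≤ center G := fun x hx => mem_center_iff.2 fun g => by
      obtain ⟨f, hf⟩ := hsurj ⟨(g : G ⧸ center G), mem_center_iff.2 fun y => hQ _ _⟩
      exact ht f g (congrArg Subtype.val hf) x hx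
    have hZΦ : center G = frattini G := le_antisymm hZ hΦ
    have hab : a = a * b := by
      refine Nat.pow_right_injective hp.two_le ?_
      change p ^ a = p ^ (a * b)
      rw [← ha, ← hcQ, ← index_eq_card, ← index_eq_card, hZΦ]
    have ha0 : a ≠ 0 := by
      rintro rfl
      rw [zero_mul, pow_zero, ← index_eq_card, index_eq_one] at hcQ
      exact hna fun x y => mem_center_iff.1 (hcQ ▸ mem_top y) x
    have hb1 : b = 1 := Nat.eq_of_mul_eq_mul_left (Nat.pos_of_ne_zero ha0) (by omega)
    rw [hb1, pow_one] at hcZ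
    rw [← hZΦ] at hinner
    refine hna ?_
    by_cases h2 : p = 2
    · subst h2
      exact commutative_of_card_center_eq_two hcZ (fun x => hZΦ ▸ hpG.pow_mem_frattini_s5 hp x)
        (fun x y => hZΦ ▸ hpG.commutator_mem_frattini hp x y) hinner
    · exact commutative_of_card_center_of_ne_two hp h2 hcZ
        (fun x => hZΦ ▸ hpG.pow_mem_frattini_s5 hp x)
        (fun x y => hZΦ ▸ hpG.commutator_mem_frattini hp x y) hinner
  · have h1 := IsPGroup.pow_nilpotencyClass_le hp (G ⧸ center G) inferInstance
      (hpG.to_quotient _) hQ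
    have h2 : Group.nilpotencyClass (G ⧸ center G) + b * (a + 1) ≤ n := key _ <| by
      rw [← hcard, hGcard, hQcard, mul_add, mul_one, ← add_assoc, pow_add, pow_add, mul_comm b a]
      exact Nat.mul_le_mul (Nat.mul_le_mul h1 hZQ) hbZ
    omega
end

section
/- Let p be an odd prime and let G be a finite non-abelian p-group such that the quotient Q = G/Z(G) is powerful, i.e., the derived subgroup Q' is contained in Q^p, the subgroup of Q generated by all p-th powers. Then G has a noninner automorphism of order p that fixes the Frattini subgroup Φ(G) elementwise. -/
/-- The subgroup generated by all `p`-th powers. -/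
def powSubgroup (p : ℕ) (G : Type*) [Group G] : Subgroup G :=
  Subgroup.closure {x : G | ∃ y : G, y ^ p = x}

section

open Subgroup

open scoped commutatorElement

section ClassTwo

variable {G : Type*} [Group G]

theorem pow_mul_eq_of_mul_eq_mul {a b w : G} (hw : w ∈ center G) (h : b * a = a * b * w) (n : ℕ) :
    b ^ n * a = a * b ^ n * w ^ n := by
  have hc := fun g => mem_center_iff.1 hw g
  have hcn : ∀ (n : ℕ) (g : G), g * w ^ n = w ^ n * g := fun n g =>
    mem_center_iff.1 (pow_mem hw n) g
  induction n with
  | zero => simp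
  | succ n ih =>
    calc b ^ (n + 1) * a = b ^ n * (b * a) := by rw [pow_succ, mul_assoc]
      _ = (b ^ n * a) * b * w := by rw [h]; simp only [mul_assoc]
      _ = a * b ^ n * (w ^ n * b) * w := by rw [ih]; simp only [mul_assoc]
      _ = a * b ^ (n + 1) * w ^ (n + 1) := by
        rw [← hcn]; simp only [pow_succ, mul_assoc]

theorem mul_pow_eq_of_mul_eq_mul {a b w : G} (hw : w ∈ center G) (h : b * a = a * b * w) (n : ℕ) :
    (a * b) ^ n = a ^ n * b ^ n * w ^ (n * (n - 1) / 2) := by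
  have hcn : ∀ (n : ℕ) (g : G), w ^ n * g = g * w ^ n := fun n g =>
    (mem_center_iff.1 (pow_mem hw n) g).symm
  induction n with
  | zero => simp
  | succ n ih =>
    have e : (n + 1) * (n + 1 - 1) / 2 = n * (n - 1) / 2 + n := by
      have h1 : ∑ i ∈ Finset.range (n + 1), i = (n + 1) * (n + 1 - 1) / 2 :=
        Finset.sum_range_id (n + 1)
      have h2 : ∑ i ∈ Finset.range n, i = n * (n - 1) / 2 := Finset.sum_range_id n
      rw [← h1, ← h2, Finset.sum_range_succ]
    rw [pow_succ, ih, e]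
    calc a ^ n * b ^ n * w ^ (n * (n - 1) / 2) * (a * b)
        = a ^ n * (b ^ n * a) * b * w ^ (n * (n - 1) / 2) := by
          rw [mul_assoc _ (w ^ _), hcn]; simp only [mul_assoc]
      _ = a ^ n * a * b ^ n * (w ^ n * b) * w ^ (n * (n - 1) / 2) := by
          rw [pow_mul_eq_of_mul_eq_mul hw h]; simp only [mul_assoc]
      _ = _ := by
          rw [hcn n b, add_comm (n * (n - 1) / 2) n, pow_add w, pow_add a, pow_add b,
            pow_one, pow_one]
          simp only [mul_assoc]

theorem mul_pow_odd_of_mul_eq_mul {p : ℕ} (hodd : Odd p) {a b w : G} (hw : w ∈ center G)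
    (h : b * a = a * b * w) (hwp : w ^ p = 1) : (a * b) ^ p = a ^ p * b ^ p := by
  obtain ⟨m, rfl⟩ := hodd
  have e : (2 * m + 1) * (2 * m + 1 - 1) / 2 = (2 * m + 1) * m := by
    rw [Nat.add_sub_cancel, Nat.mul_div_assoc _ (Dvd.intro m rfl)]; simp
  rw [mul_pow_eq_of_mul_eq_mul hw h, e, pow_mul, hwp, one_pow, mul_one]

end ClassTwo

section Powerful

variable {p : ℕ} {G H : Type*} [Group G] [Group H]

theorem pow_mem_powSubgroup (x : G) : x ^ p ∈ powSubgroup p G := subset_closure ⟨x, rfl⟩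

theorem powSubgroup_le_iff {K : Subgroup G} : powSubgroup p G ≤ K ↔ ∀ x : G, x ^ p ∈ K := by
  rw [powSubgroup, closure_le]
  exact ⟨fun h x => h ⟨x, rfl⟩, fun h _ ⟨x, hx⟩ => hx ▸ h x⟩

theorem map_powSubgroup {f : G →* H} (hf : Function.Surjective f) :
    (powSubgroup p G).map f = powSubgroup p H := by
  rw [powSubgroup, powSubgroup, MonoidHom.map_closure]
  congr 1
  ext y
  constructor
  · rintro ⟨_, ⟨x, rfl⟩, rfl⟩
    exact ⟨f x, (map_pow f x p).symm⟩
  · rintro ⟨z, rfl⟩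
    obtain ⟨x, rfl⟩ := hf z
    exact ⟨x ^ p, ⟨x, rfl⟩, map_pow f x p⟩

instance powSubgroup_characteristic : (powSubgroup p G).Characteristic :=
  characteristic_iff_map_eq.2 fun f => map_powSubgroup f.surjective

theorem commutator_le_powSubgroup_of_surjective {f : G →* H} (hf : Function.Surjective f)
    (h : commutator G ≤ powSubgroup p G) : commutator H ≤ powSubgroup p H := by
  rw [← map_powSubgroup hf, commutator_def, ← map_top_of_surjective f hf, ← map_commutator]
  exact map_mono h

/-- In a nilpotent group, a normal subgroup contained in its commutator with the whole group
is trivial. -/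
theorem eq_bot_of_le_commutator_top [Group.IsNilpotent G] {A : Subgroup G}
    (h : A ≤ ⁅A, (⊤ : Subgroup G)⁆) : A = ⊥ := by
  obtain ⟨n, hn⟩ := (isNilpotent_iff_lowerCentralSeries (⊤ : Subgroup G)).1
    (inferInstanceAs (Group.IsNilpotent (⊤ : Subgroup G)))
  have key : ∀ n, A ≤ Subgroup.lowerCentralSeries ⊤ n := by
    intro n
    induction n with
    | zero => simp
    | succ n ih => exact h.trans (commutator_mono ih le_rfl)
  exact le_bot_iff.1 (hn ▸ key n)

theorem map_mk_le_center_iff {N C : Subgroup G} [C.Normal] :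
    N.map (QuotientGroup.mk' C) ≤ center (G ⧸ C) ↔ ⁅N, (⊤ : Subgroup G)⁆ ≤ C := by
  rw [← commutator_top_right_eq_bot_iff_le_center,
    ← map_top_of_surjective _ (QuotientGroup.mk'_surjective C), ← map_commutator,
    Subgroup.map_eq_bot_iff, QuotientGroup.ker_mk']

theorem powSubgroup_le_center_of_commute (hodd : Odd p) (hG : commutator G ≤ powSubgroup p G)
    (hexp : ∀ x ∈ powSubgroup p G, x ^ p = 1)
    (hc : ⁅powSubgroup p G, (⊤ : Subgroup G)⁆ ≤ center G) :
    powSubgroup p G ≤ center G := by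
  rw [powSubgroup_le_iff]
  intro x
  rw [mem_center_iff]
  intro g
  have hcN : ⁅x⁻¹, g⁻¹⁆ ∈ powSubgroup p G :=
    hG (commutator_mem_commutator (mem_top _) (mem_top _))
  have hw : ⁅(⁅x⁻¹, g⁻¹⁆)⁻¹, x⁻¹⁆ ∈ ⁅powSubgroup p G, (⊤ : Subgroup G)⁆ :=
    commutator_mem_commutator (inv_mem hcN) (mem_top _)
  have h1 := mul_pow_odd_of_mul_eq_mul hodd (a := x) (b := ⁅x⁻¹, g⁻¹⁆) (hc hw)
    (by simp only [commutatorElement_def]; group) (hexp _ (commutator_le_left _ _ hw))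
  rw [hexp _ hcN, mul_one] at h1
  have h2 : x * ⁅x⁻¹, g⁻¹⁆ = g⁻¹ * x * g⁻¹⁻¹ := by simp only [commutatorElement_def]; group
  rw [h2, conj_pow] at h1
  nth_rewrite 1 [← h1]
  group

theorem powSubgroup_le_center [Group.IsNilpotent G] (hodd : Odd p)
    (hG : commutator G ≤ powSubgroup p G) (hexp : ∀ x ∈ powSubgroup p G, x ^ p = 1) :
    powSubgroup p G ≤ center G := by
  rw [← commutator_top_right_eq_bot_iff_le_center]
  apply eq_bot_of_le_commutator_top
  set C := ⁅⁅powSubgroup p G, (⊤ : Subgroup G)⁆, (⊤ : Subgroup G)⁆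
  have hs := QuotientGroup.mk'_surjective C
  rw [← map_mk_le_center_iff, map_powSubgroup hs]
  refine powSubgroup_le_center_of_commute hodd (commutator_le_powSubgroup_of_surjective hs hG) ?_ ?_
  · rw [← map_powSubgroup hs]
    rintro _ ⟨x, hx, rfl⟩
    rw [← map_pow, hexp x hx, map_one]
  · rw [← map_powSubgroup hs, ← map_top_of_surjective _ hs, ← map_commutator,
      map_mk_le_center_iff]

/-- The subgroup generated by the `p`-th powers of elements of `powSubgroup p G`. -/
abbrev powSubgroupTwo (p : ℕ) (G : Type*) [Group G] : Subgroup G :=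
  (powSubgroup p (powSubgroup p G)).map (powSubgroup p G).subtype

theorem pow_mem_powSubgroupTwo {x : G} (hx : x ∈ powSubgroup p G) : x ^ p ∈ powSubgroupTwo p G :=
  ⟨⟨x, hx⟩ ^ p, pow_mem_powSubgroup _, rfl⟩

theorem commutator_powSubgroup_le [Group.IsNilpotent G] (hodd : Odd p)
    (hG : commutator G ≤ powSubgroup p G) :
    ⁅powSubgroup p G, (⊤ : Subgroup G)⁆ ≤ powSubgroupTwo p G := by
  have hs := QuotientGroup.mk'_surjective (powSubgroupTwo p G)
  rw [← map_mk_le_center_iff, map_powSubgroup hs]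
  refine powSubgroup_le_center hodd (commutator_le_powSubgroup_of_surjective hs hG) ?_
  rw [← map_powSubgroup hs]
  rintro _ ⟨x, hx, rfl⟩
  rw [← map_pow]
  exact (QuotientGroup.eq_one_iff _).2 (pow_mem_powSubgroupTwo hx)

theorem commutator_powSubgroup_le_powSubgroup [Group.IsNilpotent G] (hodd : Odd p)
    (hG : commutator G ≤ powSubgroup p G) :
    commutator (powSubgroup p G) ≤ powSubgroup p (powSubgroup p G) := by
  rw [← map_subtype_le_map_subtype, map_subtype_commutator]
  exact (commutator_mono le_rfl le_top).trans (commutator_powSubgroup_le hodd hG)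

/-- In a powerful nilpotent group, the `p`-th power map is a homomorphism modulo
`powSubgroupTwo p G`. -/
theorem exists_hom_eq_mk_pow [Group.IsNilpotent G] (hodd : Odd p)
    (hG : commutator G ≤ powSubgroup p G) :
    ∃ ψ : G →* G ⧸ powSubgroupTwo p G, ∀ x, ψ x = QuotientGroup.mk' _ (x ^ p) := by
  refine ⟨MonoidHom.mk' (fun x => QuotientGroup.mk' _ (x ^ p)) fun x y => ?_, fun x => rfl⟩
  have hyx : ⁅y⁻¹, x⁻¹⁆ ∈ powSubgroup p G :=
    hG (commutator_mem_commutator (mem_top _) (mem_top _))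
  simp only [map_pow, map_mul]
  refine mul_pow_odd_of_mul_eq_mul hodd (w := QuotientGroup.mk' _ ⁅y⁻¹, x⁻¹⁆)
    (map_mk_le_center_iff.2 (commutator_powSubgroup_le hodd hG) ⟨_, hyx, rfl⟩) ?_ ?_
  · rw [← map_mul, ← map_mul, ← map_mul]
    congr 1
    simp only [commutatorElement_def]; group
  · rw [← map_pow]
    exact (QuotientGroup.eq_one_iff _).2 (pow_mem_powSubgroupTwo hyx)

/-- A maximal subgroup of a finite `p`-group is the kernel of a homomorphism onto `ℤ/p`. -/
theorem IsPGroup.exists_ker_eq_of_isCoatom [Fact p.Prime] [Finite G] (hpG : IsPGroup p G)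
    {M : Subgroup G} (hM : IsCoatom M) : ∃ f : G →* Multiplicative (ZMod p), f.ker = M := by
  have hn : Group.IsNilpotent G := hpG.isNilpotent
  have hMn : M.Normal := (Group.normalizerCondition_of_isNilpotent (G := G)).normal_of_coatom M hM
  have hs := QuotientGroup.mk'_surjective M
  obtain ⟨g, hg⟩ : ∃ g, g ∉ M := by
    by_contra! h
    exact hM.1 (eq_top_iff.2 fun x _ => h x)
  have : Nontrivial (G ⧸ M) := ⟨(g : G ⧸ M), 1, fun h => hg ((QuotientGroup.eq_one_iff g).1 h)⟩
  obtain ⟨n, hn0, hn⟩ := (hpG.to_quotient M).nontrivial_iff_card.1 this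
  obtain ⟨q, hq⟩ := exists_prime_orderOf_dvd_card' (G := G ⧸ M) p (hn ▸ dvd_pow_self p hn0.ne')
  have htop : zpowers q = ⊤ := by
    have h1 := hM.2 ((zpowers q).comap (QuotientGroup.mk' M))
    by_contra h
    have hle : M ≤ (zpowers q).comap (QuotientGroup.mk' M) := by
      nth_rewrite 1 [← QuotientGroup.ker_mk' M]
      exact ker_le_comap _ _
    rcases hle.lt_or_eq with h2 | h2
    · have h3 := h1 h2
      rw [← comap_top (QuotientGroup.mk' M)] at h3
      exact h (comap_injective hs h3)
    · obtain ⟨x, rfl⟩ := hs q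
      have : x ∈ M := h2 ▸ mem_zpowers (QuotientGroup.mk' M x)
      rw [show QuotientGroup.mk' M x = 1 from (QuotientGroup.eq_one_iff x).2 this,
        orderOf_one] at hq
      exact (Fact.out : p.Prime).one_lt.ne hq
  have hcard : Nat.card (G ⧸ M) = p := by
    rw [← card_top (G := G ⧸ M), ← htop, Nat.card_zpowers, hq]
  let e : G ⧸ M ≃* Multiplicative (ZMod p) :=
    mulEquivOfPrimeCardEq (p := p) hcard (by simp)
  refine ⟨e.toMonoidHom.comp (QuotientGroup.mk' M), ?_⟩
  ext x
  simp

theorem Multiplicative.zmod_pow_eq_one (a : Multiplicative (ZMod p)) : a ^ p = 1 := by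
  rw [← toAdd_eq_zero, toAdd_pow]; simp

theorem IsPGroup.powSubgroup_lt_top [Fact p.Prime] [Finite G] [Nontrivial G] (hpG : IsPGroup p G) :
    powSubgroup p G < ⊤ := by
  obtain h | ⟨M, hM, -⟩ := eq_top_or_exists_le_coatom (⊥ : Subgroup G)
  · exact absurd h bot_ne_top
  obtain ⟨f, rfl⟩ := hpG.exists_ker_eq_of_isCoatom hM
  refine lt_of_le_of_lt (powSubgroup_le_iff.2 fun x => ?_) hM.lt_top
  rw [MonoidHom.mem_ker, map_pow, Multiplicative.zmod_pow_eq_one]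

/-- A subgroup of exponent `p` of a powerful `p`-group has order at most the index of the subgroup
generated by `p`-th powers. -/
theorem IsPGroup.card_le_index_powSubgroup [hp : Fact p.Prime] (hodd : Odd p) (n : ℕ) :
    ∀ (G : Type*) [Group G] [Finite G], IsPGroup p G → commutator G ≤ powSubgroup p G →
      Nat.card G ≤ n → ∀ A : Subgroup G, (∀ x ∈ A, x ^ p = 1) →
      Nat.card A ≤ (powSubgroup p G).index := by
  induction n with
  | zero =>
    intro G _ _ _ _ h
    exact absurd h (Nat.card_pos (α := G)).not_ge
  | succ n ih =>
    intro G _ _ hpG hG hn A hA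
    have hnil : Group.IsNilpotent G := hpG.isNilpotent
    cases subsingleton_or_nontrivial G with
    | inl h =>
      rw [Nat.card_unique, Nat.succ_le_iff]
      exact Nat.pos_of_ne_zero index_ne_zero_of_finite
    | inr h =>
      set N := powSubgroup p G with hN
      have hlt : Nat.card N < Nat.card G := by
        have := hpG.powSubgroup_lt_top
        by_contra! h
        exact this.ne (eq_top_of_le_card _ h)
      have h1 := ih N (hpG.to_subgroup N) (commutator_powSubgroup_le_powSubgroup hodd hG)
        (by omega) (A.subgroupOf N) fun x hx => Subtype.ext (hA x hx)
      obtain ⟨ψ, hψ⟩ := exists_hom_eq_mk_pow hodd hG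
      have hrange : ψ.range = N.map (QuotientGroup.mk' (powSubgroupTwo p G)) := by
        rw [map_powSubgroup (QuotientGroup.mk'_surjective _)]
        apply le_antisymm
        · rintro _ ⟨x, rfl⟩
          rw [hψ, map_pow]
          exact pow_mem_powSubgroup _
        · rw [powSubgroup_le_iff]
          intro y
          obtain ⟨x, rfl⟩ := QuotientGroup.mk'_surjective _ y
          exact ⟨x, by rw [hψ, map_pow]⟩
      have hT : ψ.ker.index = (powSubgroup p N).index := by
        rw [index_ker, hrange, ← relIndex_ker, QuotientGroup.ker_mk', relIndex,
          subgroupOf, comap_map_eq_self_of_injective (subtype_injective _)]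
      have hNT : N ≤ ψ.ker := powSubgroup_le_iff.2 fun x => by
        rw [MonoidHom.mem_ker, hψ]
        exact (QuotientGroup.eq_one_iff _).2 (pow_mem_powSubgroupTwo (pow_mem_powSubgroup x))
      have hAT : A ≤ ψ.ker := fun x hx => by rw [MonoidHom.mem_ker, hψ, hA x hx, map_one]
      have h2 : N.relIndex A ≤ N.relIndex ψ.ker :=
        relIndex_le_of_le_right hAT index_ne_zero_of_finite
      have h3 : Nat.card (A.subgroupOf N) = Nat.card (N.subgroupOf A) := by
        rw [← card_map_of_injective (subtype_injective N), subgroupOf_map_subtype, inf_comm,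
          ← subgroupOf_map_subtype, card_map_of_injective (subtype_injective A)]
      calc Nat.card A = Nat.card (N.subgroupOf A) * N.relIndex A := (card_mul_index _).symm
        _ ≤ ψ.ker.index * N.relIndex ψ.ker := by
          rw [← h3, hT]
          exact Nat.mul_le_mul h1 h2
        _ = N.index := by rw [mul_comm, relIndex_mul_index hNT]

end Powerful

section Homs

theorem card_le_card_monoidHom_of_pow_eq_one {p : ℕ} [Fact p.Prime] {A : Type*} [CommGroup A]
    [Finite A] (hA : ∀ a : A, a ^ p = 1) :
    Nat.card A ≤ Nat.card (A →* Multiplicative (ZMod p)) := by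
  let _ : Module (ZMod p) (Additive A) := AddCommGroup.zmodModule (n := p) fun a => hA a.toMul
  have : Module.Finite (ZMod p) (Additive A) := Module.Finite.of_finite
  have : Finite (A →* Multiplicative (ZMod p)) := .of_injective _ DFunLike.coe_injective
  have h1 : Nat.card (Additive A) = Nat.card (Module.Dual (ZMod p) (Additive A)) := by
    rw [Module.natCard_eq_pow_finrank (K := ZMod p) (V := Additive A),
      Module.natCard_eq_pow_finrank (K := ZMod p) (V := Module.Dual (ZMod p) (Additive A)),
      Subspace.dual_finrank_eq]
  change Nat.card (Additive A) ≤ _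
  rw [h1]
  refine Nat.card_le_card_of_injective
    (fun l : Module.Dual (ZMod p) (Additive A) =>
      AddMonoidHom.toMultiplicativeRight l.toAddMonoidHom)
    fun l l' h => ?_
  exact LinearMap.toAddMonoidHom_injective (AddMonoidHom.toMultiplicativeRight.injective h)

theorem index_powSubgroup_le_card_hom {p : ℕ} [hp : Fact p.Prime] {Q : Type*} [Group Q] [Finite Q]
    (hQ : commutator Q ≤ powSubgroup p Q) :
    (powSubgroup p Q).index ≤ Nat.card (Q →* Multiplicative (ZMod p)) := by
  set S := powSubgroup p Q
  have hs := QuotientGroup.mk'_surjective S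
  let _ : CommGroup (Q ⧸ S) :=
    { (inferInstance : Group (Q ⧸ S)) with
      mul_comm := by
        intro a b
        obtain ⟨x, rfl⟩ := hs a
        obtain ⟨y, rfl⟩ := hs b
        refine commutatorElement_eq_one_iff_mul_comm.1 ?_
        rw [← map_commutatorElement]
        exact (QuotientGroup.eq_one_iff _).2
          (hQ (commutator_mem_commutator (mem_top _) (mem_top _))) }
  have : Finite (Q →* Multiplicative (ZMod p)) := .of_injective _ DFunLike.coe_injective
  refine (card_le_card_monoidHom_of_pow_eq_one (p := p) (A := Q ⧸ S) fun a => ?_).trans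
    (Nat.card_le_card_of_injective (fun f => f.comp (QuotientGroup.mk' S)) fun f f' he =>
      (MonoidHom.cancel_right hs).1 he)
  obtain ⟨x, rfl⟩ := hs a
  rw [← map_pow]
  exact (QuotientGroup.eq_one_iff _).2 (pow_mem_powSubgroup x)

theorem frattini_le_ker {p : ℕ} [hp : Fact p.Prime] {G : Type*} [Group G]
    (f : G →* Multiplicative (ZMod p)) : frattini G ≤ f.ker := by
  have : Fact (Nat.card (Multiplicative (ZMod p))).Prime := ⟨by simpa using hp.out⟩
  have : IsSimpleGroup (Multiplicative (ZMod p)) := isSimpleGroup_of_prime_card (p := p) (by simp)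
  rcases f.range.eq_bot_or_eq_top_of_prime_card with h | h
  · rw [MonoidHom.range_eq_bot_iff] at h
    intro x _
    simp [h]
  · rw [← MonoidHom.comap_bot]
    exact frattini_le_coatom
      (isCoatom_comap_of_surjective (MonoidHom.range_eq_top.1 h) isCoatom_bot)

end Homs

section PowZMod

variable {p : ℕ} {G : Type*} [Group G]

/-- The power of `z` to an exponent modulo `p`, meaningful when `z ^ p = 1`. -/
def powZMod (z : G) (t : ZMod p) : G := z ^ t.val

variable {z : G}

theorem powZMod_natCast (hz : z ^ p = 1) (n : ℕ) : powZMod z (n : ZMod p) = z ^ n := by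
  rw [powZMod, ZMod.val_natCast]
  conv_rhs => rw [← Nat.mod_add_div n p, pow_add, pow_mul, hz, one_pow, mul_one]

theorem powZMod_mem {K : Subgroup G} (h : z ∈ K) (t : ZMod p) : powZMod z t ∈ K := pow_mem h _

variable [Fact p.Prime]

theorem powZMod_add (hz : z ^ p = 1) (s t : ZMod p) :
    powZMod z (s + t) = powZMod z s * powZMod z t := by
  have : s + t = ((s.val + t.val : ℕ) : ZMod p) := by simp
  rw [this, powZMod_natCast hz, pow_add]; rfl

theorem powZMod_zero : powZMod z (0 : ZMod p) = 1 := by simp [powZMod]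

theorem powZMod_one : powZMod z (1 : ZMod p) = z := by
  have : Fact (1 < p) := ⟨(Fact.out : p.Prime).one_lt⟩
  simp [powZMod, ZMod.val_one]

theorem powZMod_pow (hz : z ^ p = 1) (t : ZMod p) (n : ℕ) :
    powZMod z t ^ n = powZMod z ((n : ZMod p) * t) := by
  have : (n : ZMod p) * t = ((t.val * n : ℕ) : ZMod p) := by simp [mul_comm]
  rw [this, powZMod_natCast hz, pow_mul]; rfl

theorem powZMod_eq_one_iff (hz : z ^ p = 1) (h1 : z ≠ 1) {t : ZMod p} :
    powZMod z t = 1 ↔ t = 0 := by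
  rw [powZMod, ← orderOf_dvd_iff_pow_eq_one, orderOf_eq_prime hz h1, ← ZMod.natCast_eq_zero_iff,
    ZMod.natCast_zmod_val]

/-- An automorphism acting trivially on the kernel of `f : G → ℤ/p` and moving each element `x`
by a factor `u ^ f x`, up to a power of a central element. -/
theorem exists_mulAut_of_hom (hodd : Odd p) {f : G →* Multiplicative (ZMod p)} {u : G}
    (hu : u ^ p = 1) (hz : z ^ p = 1) (hzc : z ∈ center G) (hfu : f u = 1) (hfz : f z = 1)
    (huy : ∀ y, u * y = y * u * powZMod z (-(f y).toAdd)) :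
    ∃ α : MulAut G, α ^ p = 1 ∧ ∀ x, α x =
      x * (powZMod u (f x).toAdd * powZMod z (-((f x).toAdd ^ 2 * 2⁻¹))) := by
  set W : G → G := fun x =>
    powZMod u (f x).toAdd * powZMod z (-((f x).toAdd ^ 2 * 2⁻¹)) with hW
  have hzc' : ∀ (t : ZMod p), powZMod z t ∈ center G := powZMod_mem hzc
  have hcomm : ∀ (t : ZMod p) g, powZMod z t * g = g * powZMod z t := fun t g =>
    (mem_center_iff.1 (hzc' t) g).symm
  have hfW : ∀ x, f (W x) = 1 := fun x => by simp [hW, powZMod, hfu, hfz]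
  have hWp : ∀ x, W x ^ p = 1 := fun x => by
    rw [hW, Commute.mul_pow (hcomm _ _).symm, powZMod_pow hu, powZMod_pow hz]
    simp [powZMod_zero]
  have hWf : ∀ x y, f x = f y → W x = W y := fun x y h => by simp only [hW, h]
  have h2 : (2 : ZMod p) ≠ 0 := by
    intro h
    have h3 : p ∣ 2 := (ZMod.natCast_eq_zero_iff 2 p).1 (by exact_mod_cast h)
    rcases (Nat.dvd_prime Nat.prime_two).1 h3 with h | h
    · exact (Fact.out : p.Prime).one_lt.ne' h
    · subst h; exact absurd hodd (by decide)
  have huy' : ∀ (a : ZMod p) y,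
      powZMod u a * y = y * powZMod u a * powZMod z (-(a * (f y).toAdd)) := fun a y => by
    rw [powZMod, pow_mul_eq_of_mul_eq_mul (hzc' _) (huy y), powZMod_pow hz]
    simp
  let φ : G →* G := MonoidHom.mk' (fun x => x * W x) fun x y => by
    have e : -((f x).toAdd * (f y).toAdd) + (-((f x).toAdd ^ 2 * 2⁻¹) + -((f y).toAdd ^ 2 * 2⁻¹)) =
        -(((f x).toAdd + (f y).toAdd) ^ 2 * 2⁻¹) := by
      field_simp; ring
    simp only [hW, map_mul, toAdd_mul]
    rw [powZMod_add hu, ← e, powZMod_add hz, powZMod_add hz]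
    have h₁ := hcomm (-((f x).toAdd * (f y).toAdd))
    have h₂ := hcomm (-((f x).toAdd ^ 2 * 2⁻¹))
    have h₃ := huy' (f x).toAdd y
    generalize powZMod u (f x).toAdd = X at *
    generalize powZMod u (f y).toAdd = Y
    generalize powZMod z (-((f x).toAdd * (f y).toAdd)) = Z₁ at *
    generalize powZMod z (-((f x).toAdd ^ 2 * 2⁻¹)) = Z₂ at *
    generalize powZMod z (-((f y).toAdd ^ 2 * 2⁻¹)) = Z₃
    calc x * y * (X * Y * (Z₁ * (Z₂ * Z₃)))
        = x * (y * X) * (Y * Z₁) * Z₂ * Z₃ := by simp only [mul_assoc]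
      _ = x * (y * X * Z₁) * (Y * Z₂) * Z₃ := by rw [← h₁]; simp only [mul_assoc]
      _ = x * X * (y * Y * Z₂) * Z₃ := by rw [← h₃]; simp only [mul_assoc]
      _ = x * (X * Z₂) * (y * (Y * Z₃)) := by rw [← h₂]; simp only [mul_assoc]
  have hφ : ∀ x, φ x = x * W x := fun x => rfl
  have hfφ : ∀ x, f (φ x) = f x := fun x => by rw [hφ, map_mul, hfW, mul_one]
  have hbij : Function.Bijective φ := by
    constructor
    · intro x y h
      have h1 : f x = f y := by rw [← hfφ, h, hfφ]
      rw [hφ, hφ, hWf x y h1] at h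
      exact mul_right_cancel h
    · intro y
      refine ⟨y * (W y)⁻¹, ?_⟩
      rw [hφ, hWf (y * (W y)⁻¹) y (by rw [map_mul, map_inv, hfW, inv_one, mul_one]),
        inv_mul_cancel_right]
  let α : MulAut G := MulEquiv.ofBijective φ hbij
  have hα : ∀ x, α x = x * W x := fun x => rfl
  refine ⟨α, ?_, hα⟩
  have hn : ∀ (n : ℕ) x, (α ^ n) x = x * W x ^ n := by
    intro n
    induction n with
    | zero => simp
    | succ n ih =>
      intro x
      rw [pow_succ, MulAut.mul_apply, ih, hWf (α x) x (hfφ x), hα, pow_succ', mul_assoc]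
  ext x
  rw [hn, hWp, mul_one, MulAut.one_apply]

end PowZMod

section Transvections

variable {p : ℕ} [hp : Fact p.Prime] {G : Type*} [Group G]

/-- The pairs `(h, f)` such that conjugation by `h` moves each `x` by the factor `z ^ f x`. -/
def transvections {z : G} (hz : z ^ p = 1) (hzc : z ∈ center G) :
    Subgroup (G × (G →* Multiplicative (ZMod p))) where
  carrier := {a | ∀ x, x * a.1 = a.1 * x * powZMod z (a.2 x).toAdd}
  one_mem' x := by simp [powZMod]
  mul_mem' {a b} ha hb x := by
    have hc := fun g => mem_center_iff.1 (powZMod_mem hzc (a.2 x).toAdd) g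
    simp only [Prod.fst_mul, Prod.snd_mul, MonoidHom.mul_apply, toAdd_mul, powZMod_add hz]
    rw [← mul_assoc, ha x, mul_assoc _ _ b.1, ← hc, ← mul_assoc, mul_assoc a.1 x, hb x]
    simp only [mul_assoc]
    rw [← hc]
  inv_mem' {a} ha x := by
    have hc := fun g => mem_center_iff.1 (powZMod_mem hzc (a.2 x).toAdd) g
    have h1 : powZMod z (-(a.2 x).toAdd) = (powZMod z (a.2 x).toAdd)⁻¹ := by
      rw [eq_inv_iff_mul_eq_one, ← powZMod_add hz, neg_add_cancel, powZMod_zero]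
    simp only [Prod.fst_inv, Prod.snd_inv, MonoidHom.inv_apply, toAdd_inv, h1]
    rw [eq_mul_inv_iff_mul_eq, mul_assoc, eq_inv_mul_iff_mul_eq, hc, ← mul_assoc, ← mul_assoc,
      ← ha x, mul_inv_cancel_right]

variable {z : G} {hz : z ^ p = 1} {hzc : z ∈ center G} {h h' : G}
  {f f' : G →* Multiplicative (ZMod p)}

theorem mem_transvections_iff :
    (h, f) ∈ transvections hz hzc ↔ ∀ x, x * h = h * x * powZMod z (f x).toAdd := Iff.rfl

theorem mk_one_mem_transvections_iff :
    (h, (1 : G →* Multiplicative (ZMod p))) ∈ transvections hz hzc ↔ h ∈ center G := by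
  simp [mem_transvections_iff, mem_center_iff, powZMod_zero]

theorem mem_center_iff_of_mem_transvections (h1 : z ≠ 1) (hm : (h, f) ∈ transvections hz hzc) :
    h ∈ center G ↔ f = 1 := by
  constructor
  · intro hc
    ext x
    have := hm x
    rw [mem_center_iff.1 hc x, left_eq_mul, powZMod_eq_one_iff hz h1] at this
    simpa using this
  · rintro rfl
    exact mk_one_mem_transvections_iff.1 hm

theorem pow_mem_center_of_mem_transvections (hm : (h, f) ∈ transvections hz hzc) :
    h ^ p ∈ center G := by
  have h1 := pow_mem hm p
  have h2 : f ^ p = 1 := by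
    ext x
    rw [MonoidHom.pow_apply, Multiplicative.zmod_pow_eq_one, MonoidHom.one_apply]
  rw [Prod.pow_mk, h2] at h1
  exact mk_one_mem_transvections_iff.1 h1

/-- If there are at least as many transvections as homomorphisms `G → ℤ/p`, and the central
quotient is powerful, then every element of order `p` modulo the center is a transvection. -/
theorem exists_mem_transvections_of_pow_mem_center [Finite G] (hodd : Odd p) (hpG : IsPGroup p G)
    (hpow : commutator (G ⧸ center G) ≤ powSubgroup p (G ⧸ center G)) (h1 : z ≠ 1)
    (hsurj : ∀ f, ∃ h, (h, f) ∈ transvections hz hzc) (hh : h ^ p ∈ center G) :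
    ∃ f, (h, f) ∈ transvections hz hzc := by
  set π := QuotientGroup.mk' (center G)
  let A₀ := (transvections hz hzc).map (π.comp (MonoidHom.fst _ _))
  have hA₀p : ∀ a ∈ A₀, a ^ p = 1 := by
    rintro _ ⟨⟨g, f⟩, hg, rfl⟩
    rw [← map_pow]
    exact (QuotientGroup.eq_one_iff _).2 (pow_mem_center_of_mem_transvections hg)
  have hA₀c : A₀ ≤ center _ := by
    rintro _ ⟨⟨g, f⟩, hg, rfl⟩
    rw [mem_center_iff]
    intro q
    obtain ⟨x, rfl⟩ := QuotientGroup.mk'_surjective _ q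
    have h2 : π (powZMod z (f x).toAdd) = 1 := (QuotientGroup.eq_one_iff _).2 (powZMod_mem hzc _)
    change π x * π g = π g * π x
    rw [← map_mul, hg x, map_mul, map_mul, h2, mul_one]
  have hA₀n : A₀.Normal := ⟨fun a ha g => by
    rwa [mem_center_iff.1 (hA₀c ha) g, mul_inv_cancel_right]⟩
  have hcard : Nat.card (G →* Multiplicative (ZMod p)) ≤ Nat.card A₀ := by
    choose t ht using hsurj
    refine Nat.card_le_card_of_injective (fun f => ⟨π (t f), (t f, f), ht f, rfl⟩) fun f f' he => ?_
    have h2 : (t f)⁻¹ * t f' ∈ center G := QuotientGroup.eq.1 (Subtype.ext_iff.1 he)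
    have h3 := mul_mem (inv_mem (ht f)) (ht f')
    exact inv_mul_eq_one.1 ((mem_center_iff_of_mem_transvections h1 h3).1 h2)
  have hle : Nat.card (A₀ ⊔ zpowers (π h) : Subgroup _) ≤ Nat.card A₀ := by
    refine (IsPGroup.card_le_index_powSubgroup hodd _ (G ⧸ center G) (hpG.to_quotient _) hpow le_rfl
      _ ?_).trans (((index_powSubgroup_le_card_hom hpow).trans ?_).trans hcard)
    · intro x hx
      rw [← SetLike.mem_coe, normal_mul] at hx
      obtain ⟨a, ha, _, ⟨i, rfl⟩, rfl⟩ := hx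
      have hc : Commute a (π h ^ i) := (mem_center_iff.1 (hA₀c ha) _).symm
      have h2 : π h ^ p = 1 := by
        rw [← map_pow]
        exact (QuotientGroup.eq_one_iff _).2 hh
      change (a * π h ^ i) ^ p = 1
      rw [hc.mul_pow, hA₀p a ha, ← zpow_natCast, zpow_comm, zpow_natCast, h2, one_zpow, one_mul]
    · have : Finite (G →* Multiplicative (ZMod p)) := .of_injective _ DFunLike.coe_injective
      exact Nat.card_le_card_of_injective (fun f => f.comp π) fun f f' he =>
        MonoidHom.cancel_right (QuotientGroup.mk'_surjective _) |>.1 he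
  have heq : A₀ = A₀ ⊔ zpowers (π h) := eq_of_le_of_card_ge le_sup_left hle
  have hmem : π h ∈ A₀ := heq ▸ mem_sup_right (mem_zpowers _)
  obtain ⟨⟨g, f⟩, hg, hgh⟩ := hmem
  have h2 : g⁻¹ * h ∈ center G := QuotientGroup.eq.1 hgh
  have h3 := mul_mem hg (mk_one_mem_transvections_iff (hz := hz) (hzc := hzc).2 h2)
  exact ⟨f, by simpa using h3⟩

end Transvections

/-- If the elements of order dividing `p` in a finite commutative group form a group of order `p`,
then the group of `p`-th powers has prime index. -/
theorem exists_eq_pow_or_eq_zpow_mul_pow {p : ℕ} [hp : Fact p.Prime] {Z : Type*} [CommGroup Z]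
    [Finite Z] {z : Z} (hz : orderOf z = p) (h : ∀ y : Z, y ^ p = 1 → y ∈ zpowers z) (a b : Z) :
    (∃ r, a = r ^ p) ∨ ∃ (m : ℤ) (r : Z), b = a ^ m * r ^ p := by
  by_cases ha : a ∈ (powMonoidHom p : Z →* Z).range
  · obtain ⟨r, hr⟩ := ha
    exact .inl ⟨r, hr.symm⟩
  right
  set R := (powMonoidHom p : Z →* Z).range
  have hker : (powMonoidHom p : Z →* Z).ker = zpowers z :=
    le_antisymm (fun y hy => h y hy) (zpowers_le.2 (by
      rw [MonoidHom.mem_ker, powMonoidHom_apply, ← hz, pow_orderOf_eq_one]))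
  have hidx : R.index = p := by rw [index_range, hker, Nat.card_zpowers, hz]
  have hlt : R < zpowers a ⊔ R := lt_of_le_of_ne le_sup_right fun he =>
    ha (he ▸ mem_sup_left (mem_zpowers a))
  have h1 : (zpowers a ⊔ R).index = 1 :=
    ((Nat.dvd_prime hp.out).1 (hidx ▸ index_dvd_of_le le_sup_right)).resolve_right
      fun he => (index_strictAnti hlt).ne (he.trans hidx.symm)
  have hb : b ∈ zpowers a ⊔ R := index_eq_one.1 h1 ▸ mem_top b
  obtain ⟨_, ⟨m, rfl⟩, _, ⟨r, rfl⟩, rfl⟩ := mem_sup.1 hb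
  exact ⟨m, r, rfl⟩

/-- A nontrivial commutator subgroup of a nilpotent group meets the center. -/
theorem Group.IsNilpotent.commutator_inf_center_ne_bot {G : Type*} [Group G] [Group.IsNilpotent G]
    (h : commutator G ≠ ⊥) : commutator G ⊓ center G ≠ ⊥ := by
  classical
  have hex := (isNilpotent_iff_lowerCentralSeries (⊤ : Subgroup G)).1 inferInstance
  have hn := Nat.find_spec hex
  have hmin := fun m => Nat.find_min hex (m := m)
  set n := Nat.find hex
  have h2 : 2 ≤ n := by
    by_contra! hlt
    have := Subgroup.lowerCentralSeries_antitone (⊤ : Subgroup G) (Nat.lt_succ_iff.1 hlt)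
    rw [hn, top_lowerCentralSeries_one] at this
    exact h (le_bot_iff.1 this)
  obtain ⟨m, hm⟩ := Nat.exists_eq_add_of_le' h2
  rw [hm] at hn hmin
  intro hbot
  apply hmin (m + 1) (by omega)
  rw [← le_bot_iff, ← hbot]
  refine le_inf ?_ ?_
  · rw [← top_lowerCentralSeries_one]
    exact Subgroup.lowerCentralSeries_antitone _ (by omega)
  · rw [← commutator_top_right_eq_bot_iff_le_center]
    exact hn

section Main

variable {p : ℕ} [hp : Fact p.Prime] {G : Type*} [Group G]

/-- If all automorphisms of order dividing `p` fixing the Frattini subgroup are inner, then the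
automorphism attached to `f`, `u` and `z` is conjugation by an element whose `p`-th power is
central. -/
theorem exists_conj_of_forall_inner (hodd : Odd p)
    (H : ∀ α : MulAut G, α ^ p = 1 → (∀ x ∈ frattini G, α x = x) →
      ∃ h : G, ∀ x, α x = h⁻¹ * x * h)
    {f : G →* Multiplicative (ZMod p)} {u z : G}
    (hu : u ^ p = 1) (hz : z ^ p = 1) (hzc : z ∈ center G) (hfu : f u = 1) (hfz : f z = 1)
    (huy : ∀ y, u * y = y * u * powZMod z (-(f y).toAdd)) :
    ∃ h : G, h ^ p ∈ center G ∧ ∀ x, h⁻¹ * x * h =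
      x * (powZMod u (f x).toAdd * powZMod z (-((f x).toAdd ^ 2 * 2⁻¹))) := by
  obtain ⟨α, hαp, hα⟩ := exists_mulAut_of_hom hodd hu hz hzc hfu hfz huy
  obtain ⟨h, hh⟩ := H α hαp fun x hx => by
    rw [hα, (frattini_le_ker f hx : f x = 1)]
    simp [powZMod_zero]
  refine ⟨h, ?_, fun x => by rw [← hh, hα]⟩
  have hn : ∀ (n : ℕ) x, (α ^ n) x = (h ^ n)⁻¹ * x * h ^ n := by
    intro n
    induction n with
    | zero => simp
    | succ n ih =>
      intro x
      rw [pow_succ, MulAut.mul_apply, ih, hh, pow_succ' h]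
      simp only [mul_assoc, mul_inv_rev]
  rw [mem_center_iff]
  intro g
  have h1 := hn p g
  rw [hαp, MulAut.one_apply, mul_assoc, eq_inv_mul_iff_mul_eq] at h1
  exact h1.symm

theorem exists_mem_transvections_of_forall_inner (hodd : Odd p)
    (H : ∀ α : MulAut G, α ^ p = 1 → (∀ x ∈ frattini G, α x = x) →
      ∃ h : G, ∀ x, α x = h⁻¹ * x * h)
    {z : G} (hz : z ^ p = 1) (hzc : z ∈ center G) {f : G →* Multiplicative (ZMod p)}
    (hfz : f z = 1) : ∃ h, (h, f) ∈ transvections hz hzc := by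
  obtain ⟨h, -, hh⟩ := exists_conj_of_forall_inner hodd H hz (one_pow p) (one_mem _) hfz (map_one f)
    fun y => by rw [mem_center_iff.1 hzc y]; simp [powZMod]
  refine ⟨h, fun x => ?_⟩
  have h1 := hh x
  rw [mul_assoc, inv_mul_eq_iff_eq_mul] at h1
  rw [h1]
  simp [powZMod, mul_assoc]

theorem mem_of_powZMod_mem {K : Subgroup G} {u : G} (hu : u ^ p = 1) {t : ZMod p} (ht : t ≠ 0)
    (h : powZMod u t ∈ K) : u ∈ K := by
  have h1 := pow_mem h (t⁻¹).val
  rwa [powZMod_pow hu, ZMod.natCast_zmod_val, inv_mul_cancel₀ ht, powZMod_one] at h1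

/-- A non-abelian finite `p`-group has two independent homomorphisms to `ℤ/p`. -/
theorem exists_independent_homs [Finite G] (hpG : IsPGroup p G)
    (hna : ¬ ∀ a b : G, a * b = b * a) :
    ∃ f₁ f₂ : G →* Multiplicative (ZMod p), f₁ ≠ 1 ∧ ∀ m : ℤ, f₂ * (f₁ ^ m)⁻¹ ≠ 1 := by
  have : Nontrivial G := by
    by_contra h
    rw [not_nontrivial_iff_subsingleton] at h
    exact hna fun a b => Subsingleton.elim _ _
  obtain h | ⟨M₁, hM₁, -⟩ := eq_top_or_exists_le_coatom (⊥ : Subgroup G)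
  · exact absurd h bot_ne_top
  obtain ⟨g, hg⟩ : ∃ g, g ∉ M₁ := by
    by_contra! h
    exact hM₁.1 (eq_top_iff.2 fun x _ => h x)
  obtain h | ⟨M₂, hM₂, hgM₂⟩ := eq_top_or_exists_le_coatom (zpowers g)
  · refine absurd (fun a b => ?_) hna
    obtain ⟨i, rfl⟩ : a ∈ zpowers g := h ▸ mem_top a
    obtain ⟨j, rfl⟩ : b ∈ zpowers g := h ▸ mem_top b
    exact zpow_mul_comm g i j
  obtain ⟨f₁, rfl⟩ := hpG.exists_ker_eq_of_isCoatom hM₁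
  obtain ⟨f₂, rfl⟩ := hpG.exists_ker_eq_of_isCoatom hM₂
  have hg2 : f₂ g = 1 := hgM₂ (mem_zpowers g)
  refine ⟨f₁, f₂, fun h => hM₁.1 (by simp [h]), fun m h => hM₂.1 ?_⟩
  rw [mul_inv_eq_one] at h
  have h1 : f₁ g ^ m = 1 := by rw [← hg2, h]; rfl
  have h2 : (m : ZMod p) = 0 := by
    rw [← toAdd_eq_zero, toAdd_zpow, zsmul_eq_mul, mul_eq_zero] at h1
    exact h1.resolve_right fun h3 => hg (toAdd_eq_zero.1 h3)
  rw [h, MonoidHom.ker_eq_top_iff]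
  ext x
  change (f₁ x ^ m).toAdd = 0
  rw [toAdd_zpow, zsmul_eq_mul, h2, zero_mul]

theorem exists_toAdd_ne_zero {f : G →* Multiplicative (ZMod p)} (hf : f ≠ 1) :
    ∃ x, (f x).toAdd ≠ 0 := by
  by_contra! h
  exact hf (MonoidHom.ext fun x => toAdd_eq_zero.1 (h x))

open scoped IsMulCommutative in
theorem exists_transvection_pow_eq_one [Finite G] (hodd : Odd p) {z : G} (hz : z ^ p = 1)
    (hzc : z ∈ center G) (h1 : z ≠ 1) (hzu : ∀ y ∈ center G, y ^ p = 1 → y ∈ zpowers z)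
    {f₁ f₂ : G →* Multiplicative (ZMod p)} (hf₁ : f₁ ≠ 1) (hf₂ : ∀ m : ℤ, f₂ * (f₁ ^ m)⁻¹ ≠ 1)
    (hsurj : ∀ f, ∃ h, (h, f) ∈ transvections hz hzc) :
    ∃ u f, f ≠ 1 ∧ u ^ p = 1 ∧ (u, f) ∈ transvections hz hzc := by
  obtain ⟨t₁, ht₁⟩ := hsurj f₁
  obtain ⟨t₂, ht₂⟩ := hsurj f₂
  have hmul : ∀ {t f} (r : center G), (t, f) ∈ transvections hz hzc →
      (t * (r : G)⁻¹, f) ∈ transvections hz hzc := fun {t f} r ht => by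
    simpa using mul_mem ht (mk_one_mem_transvections_iff.2 (inv_mem r.2))
  have hpow : ∀ {t : G} (r : center G), t ^ p = (r : G) ^ p → (t * (r : G)⁻¹) ^ p = 1 :=
    fun {t} r ht => by
      rw [Commute.mul_pow (mem_center_iff.1 (inv_mem r.2) t), ht, inv_pow, mul_inv_cancel]
  rcases exists_eq_pow_or_eq_zpow_mul_pow (Z := center G) (z := ⟨z, hzc⟩)
    (orderOf_eq_prime (Subtype.ext hz) fun h => h1 (congrArg Subtype.val h))
    (fun y hy => by
      obtain ⟨i, hi⟩ := hzu y y.2 (congrArg Subtype.val hy)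
      exact ⟨i, Subtype.ext hi⟩)
    ⟨t₁ ^ p, pow_mem_center_of_mem_transvections ht₁⟩
    ⟨t₂ ^ p, pow_mem_center_of_mem_transvections ht₂⟩ with ⟨r, hr⟩ | ⟨m, r, hr⟩
  · have hr' : t₁ ^ p = (r : G) ^ p := congrArg Subtype.val hr
    exact ⟨t₁ * (r : G)⁻¹, f₁, hf₁, hpow r hr', hmul r ht₁⟩
  · refine ⟨t₂ * (t₁ ^ m)⁻¹ * (r : G)⁻¹, f₂ * (f₁ ^ m)⁻¹, hf₂ m, hpow r ?_,
      hmul r (mul_mem ht₂ (inv_mem (zpow_mem ht₁ m)))⟩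
    have hr' : t₂ ^ p = (t₁ ^ p) ^ m * (r : G) ^ p := congrArg Subtype.val hr
    change (t₂ * (t₁ ^ m)⁻¹) ^ p = _
    rw [mul_pow_odd_of_mul_eq_mul hodd (powZMod_mem hzc _) (ht₂ _)
      (by rw [powZMod_pow hz]; simp [powZMod_zero]), hr', inv_pow, ← zpow_natCast (t₁ ^ m),
      zpow_comm, zpow_natCast]
    rw [mem_center_iff.1 (pow_mem r.2 p), mul_inv_cancel_right]

theorem exists_not_inner_of_commutator_le_powSubgroup [Finite G] (hodd : Odd p) (hpG : IsPGroup p G)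
    (hna : ¬ ∀ a b : G, a * b = b * a)
    (hpow : commutator (G ⧸ center G) ≤ powSubgroup p (G ⧸ center G)) :
    ∃ α : MulAut G, α ^ p = 1 ∧ (∀ x ∈ frattini G, α x = x) ∧
      ¬ ∃ h : G, ∀ x, α x = h⁻¹ * x * h := by
  by_contra! H
  have hnil : Group.IsNilpotent G := hpG.isNilpotent
  have hcne : commutator G ≠ ⊥ := fun h => hna fun a b => by
    have h1 := commutator_mem_commutator (mem_top a) (mem_top b)
    rw [← commutator_def, h, mem_bot, commutatorElement_eq_one_iff_mul_comm] at h1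
    exact h1
  have hD := Group.IsNilpotent.commutator_inf_center_ne_bot hcne
  have hDn : Nontrivial (commutator G ⊓ center G : Subgroup G) := (nontrivial_iff_ne_bot _).2 hD
  obtain ⟨n, hn0, hn⟩ := (hpG.to_subgroup _).nontrivial_iff_card.1 hDn
  obtain ⟨⟨z, hzm⟩, hzo⟩ := exists_prime_orderOf_dvd_card'
    (G := (commutator G ⊓ center G : Subgroup G)) p (hn ▸ dvd_pow_self p hn0.ne')
  obtain ⟨hzD, hzc⟩ := mem_inf.1 hzm
  rw [Subgroup.orderOf_mk] at hzo
  have hz : z ^ p = 1 := hzo ▸ pow_orderOf_eq_one z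
  have h1 : z ≠ 1 := fun h => by
    rw [h, orderOf_one] at hzo
    exact hp.out.one_lt.ne hzo
  have hsurj : ∀ f, ∃ h, (h, f) ∈ transvections hz hzc := fun f =>
    exists_mem_transvections_of_forall_inner hodd H hz hzc
      (Abelianization.commutator_subset_ker f hzD)
  have hkill : ∀ (f : G →* Multiplicative (ZMod p)), ∀ c ∈ center G, f c = 1 := fun f c hc => by
    obtain ⟨h, hh⟩ := hsurj f
    have h2 := hh c
    rw [(mem_center_iff.1 hc h).symm, left_eq_mul, powZMod_eq_one_iff hz h1] at h2
    exact toAdd_eq_zero.1 h2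
  obtain ⟨f₁, f₂, hf₁, hf₂⟩ := exists_independent_homs hpG hna
  have hzu : ∀ y ∈ center G, y ^ p = 1 → y ∈ zpowers z := fun y hyc hy => by
    obtain ⟨h, hh⟩ := exists_mem_transvections_of_forall_inner hodd H hy hyc (hkill f₁ y hyc)
    obtain ⟨f, hf⟩ := exists_mem_transvections_of_pow_mem_center hodd hpG hpow h1 hsurj
      (pow_mem_center_of_mem_transvections hh)
    obtain ⟨x, hx⟩ := exists_toAdd_ne_zero hf₁
    apply mem_of_powZMod_mem hy hx
    rw [mul_left_cancel ((hh x).symm.trans (hf x))]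
    exact powZMod_mem (mem_zpowers z) _
  obtain ⟨u, f, hf, hu, hm⟩ := exists_transvection_pow_eq_one hodd hz hzc h1 hzu hf₁ hf₂ hsurj
  have huc : u ∉ center G := fun h => hf ((mem_center_iff_of_mem_transvections h1 hm).1 h)
  have hfu : f u = 1 := by
    have h2 := hm u
    rw [left_eq_mul, powZMod_eq_one_iff hz h1] at h2
    exact toAdd_eq_zero.1 h2
  obtain ⟨h, hh, hc⟩ := exists_conj_of_forall_inner hodd H hu hz hzc hfu (hkill f z hzc) fun y => by
    rw [hm y, mul_assoc, ← powZMod_add hz, add_neg_cancel, powZMod_zero, mul_one]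
  obtain ⟨f', hf'⟩ := exists_mem_transvections_of_pow_mem_center hodd hpG hpow h1 hsurj hh
  obtain ⟨x, hx⟩ := exists_toAdd_ne_zero hf
  refine huc (mem_of_powZMod_mem hu hx ?_)
  have h2 := hc x
  rw [mul_assoc, hf' x, mul_assoc h, inv_mul_cancel_left] at h2
  exact ((center G).mul_mem_cancel_right (powZMod_mem hzc _)).1
    (mul_left_cancel h2 ▸ powZMod_mem hzc _)

end Main

end

/-- Let `p` be odd and `G` a finite non-abelian `p`-group with
`G/Z(G)` powerful (its derived subgroup lies in the subgroup generated by `p`-th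
powers). Then `G` has a noninner automorphism of order `p` fixing `Φ(G)`
elementwise. -/
theorem stmt6 {p : ℕ} (hp : p.Prime) (hodd : Odd p) (G : Type*) [Group G] [Finite G]
    (hpG : IsPGroup p G) (hna : ¬ ∀ a b : G, a * b = b * a)
    (hpow : commutator (G ⧸ Subgroup.center G) ≤
      Subgroup.closure {x : G ⧸ Subgroup.center G | ∃ y : G ⧸ Subgroup.center G, y ^ p = x}) :
    ∃ α : MulAut G, orderOf α = p ∧ (∀ x ∈ frattini G, α x = x) ∧
      ¬ ∃ h : G, ∀ x : G, α x = h⁻¹ * x * h := by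
  have : Fact p.Prime := ⟨hp⟩
  obtain ⟨α, h1, h2, h3⟩ := exists_not_inner_of_commutator_le_powSubgroup hodd hpG hna hpow
  exact ⟨α, orderOf_eq_prime h1 fun h => h3 ⟨1, fun x => by simp [h]⟩, h2, h3⟩
end
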